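/- arXiv:2509.06273 — 5 statements merged into one kernel-verified Lean document; each statement's English description precedes it below -/
import Mathlib

section
/- (Proposition 2.2) Let X ⊆ [m] be a set of odd size |X| = 2k+1 and let d ∈ {0,1,…,n−1}. Define the weight g(S) = w_d^occ(S) · w_d^occ(X∖S) for S ⊆ X (this is proportional to ν_d^occ(S)ν_d^occ(X∖S)). Then the bipartite graph H_X with the weight function g satisfies the normalized matching property (NMP-B): there exists ω : F → ℝ≥0 such that for every vertex U of H_X, the sum of ω(e) over edges e of H_X incident to U equals g(U). -/
/-!
(Proposition 2.2) The bipartite graph `H_X` with the weight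
`g(S) = w_d^occ(S) · w_d^occ(X∖S)` satisfies the normalized matching property (NMP-B).
The urn model has `n+1` urns (so `d` ranges over `{0,…,n}`), the distinguished
urn being the last one, `Fin.last n`.
-/

open Finset
open scoped Classical

noncomputable section

/-- The weight of an assignment `σ` of `m` balls to the urns. -/
def urnWeight {m n : ℕ} (p : Fin m → Fin n → ℝ) (σ : Fin m → Fin n) : ℝ :=
  ∏ i, p i (σ i)

/-- `B_j(σ)`: the number of balls in urn `j`. -/
def ballCount {m n : ℕ} (σ : Fin m → Fin n) (j : Fin n) : ℕ :=
  (Finset.univ.filter fun i => σ i = j).card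

/-- `w_d^occ(Z)`: total weight of assignments `σ` with `σ⁻¹(last urn) = Z` and with
each of the first `d` urns nonempty. -/
def wOcc {m n : ℕ} (p : Fin m → Fin (n+1) → ℝ) (d : ℕ) (Z : Finset (Fin m)) : ℝ :=
  ∑ σ : Fin m → Fin (n+1),
    if (∀ i : Fin m, σ i = Fin.last n ↔ i ∈ Z) ∧
        (∀ j : Fin (n+1), (j : ℕ) < d → 1 ≤ ballCount σ j) then urnWeight p σ else 0

/-- The normalized matching property (NMP-B) for the bipartite graph `H_X`
(parts: `k`-subsets and `(k+1)`-subsets of `X`, edges: strict inclusions)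
with vertex weight `g`: there is a nonnegative edge weight `ω` whose sums at
each vertex recover `g`. -/
def NMPB {m : ℕ} (X : Finset (Fin m)) (k : ℕ) (g : Finset (Fin m) → ℝ) : Prop :=
  ∃ ω : Finset (Fin m) → Finset (Fin m) → ℝ,
    (∀ S T, 0 ≤ ω S T) ∧
    (∀ S : Finset (Fin m), S ⊆ X → S.card = k →
      (∑ T ∈ Finset.univ.filter
          (fun T : Finset (Fin m) => T ⊆ X ∧ T.card = k + 1 ∧ S ⊆ T), ω S T) = g S) ∧
    (∀ T : Finset (Fin m), T ⊆ X → T.card = k + 1 →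
      (∑ S ∈ Finset.univ.filter
          (fun S : Finset (Fin m) => S ⊆ X ∧ S.card = k ∧ S ⊆ T), ω S T) = g T)

/-! ### Closure properties of NMPB -/

theorem NMPB.congr' {m : ℕ} {X : Finset (Fin m)} {k : ℕ} {f g : Finset (Fin m) → ℝ}
    (hf : NMPB X k f) (h : ∀ S, S ⊆ X → f S = g S) : NMPB X k g := by
  obtain ⟨ω, h0, h1, h2⟩ := hf
  exact ⟨ω, h0, fun S hS hc => (h1 S hS hc).trans (h S hS),
    fun S hS hc => (h2 S hS hc).trans (h S hS)⟩

theorem NMPB.zero' {m : ℕ} (X : Finset (Fin m)) (k : ℕ) : NMPB X k (fun _ => 0) :=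
  ⟨fun _ _ => 0, fun _ _ => le_rfl, by simp, by simp⟩

theorem NMPB.add' {m : ℕ} {X : Finset (Fin m)} {k : ℕ} {f g : Finset (Fin m) → ℝ}
    (hf : NMPB X k f) (hg : NMPB X k g) : NMPB X k (fun S => f S + g S) := by
  obtain ⟨ω, h0, h1, h2⟩ := hf
  obtain ⟨ω', h0', h1', h2'⟩ := hg
  refine ⟨fun S T => ω S T + ω' S T, fun S T => add_nonneg (h0 S T) (h0' S T), ?_, ?_⟩
  · intro S hS hc
    rw [Finset.sum_add_distrib, h1 S hS hc, h1' S hS hc]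
  · intro S hS hc
    rw [Finset.sum_add_distrib, h2 S hS hc, h2' S hS hc]

theorem NMPB.smul' {m : ℕ} {X : Finset (Fin m)} {k : ℕ} {f : Finset (Fin m) → ℝ}
    {a : ℝ} (ha : 0 ≤ a) (hf : NMPB X k f) : NMPB X k (fun S => a * f S) := by
  obtain ⟨ω, h0, h1, h2⟩ := hf
  refine ⟨fun S T => a * ω S T, fun S T => mul_nonneg ha (h0 S T), ?_, ?_⟩
  · intro S hS hc
    rw [← Finset.mul_sum, h1 S hS hc]
  · intro S hS hc
    rw [← Finset.mul_sum, h2 S hS hc]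

theorem NMPB.sum' {m : ℕ} {X : Finset (Fin m)} {k : ℕ} {α : Type*} (s : Finset α)
    (f : α → Finset (Fin m) → ℝ)
    (hf : ∀ a ∈ s, NMPB X k (f a)) : NMPB X k (fun S => ∑ a ∈ s, f a S) := by
  induction s using Finset.induction_on with
  | empty => simpa using NMPB.zero' X k
  | insert a s ha ih =>
    refine NMPB.congr' (NMPB.add' (hf a (by simp)) (ih fun b hb => hf b (by simp [hb]))) ?_
    intro S _
    rw [Finset.sum_insert ha]

theorem ite_one_congr {P Q : Prop} [Decidable P] [Decidable Q] (h : P ↔ Q) :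
    (if P then (1:ℝ) else 0) = if Q then 1 else 0 := by
  by_cases hQ : Q
  · rw [if_pos hQ, if_pos (h.mpr hQ)]
  · rw [if_neg hQ, if_neg (fun hP => hQ (h.mp hP))]

theorem ite_one_congr_imp {P Q : Prop} {i1 : Decidable P} {i2 : Decidable Q} (h : P ↔ Q) :
    (if P then (1:ℝ) else 0) = if Q then 1 else 0 := by
  by_cases hQ : Q
  · rw [if_pos hQ, if_pos (h.mpr hQ)]
  · rw [if_neg hQ, if_neg (fun hP => hQ (h.mp hP))]

theorem mul_ite_one_zero {P Q : Prop} [Decidable P] [Decidable Q] :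
    (if P then (1:ℝ) else 0) * (if Q then 1 else 0) = if P ∧ Q then 1 else 0 := by
  by_cases hP : P <;> by_cases hQ : Q <;> simp [hP, hQ]

/-! ### Symmetric chains -/

def chainInd {m : ℕ} (c : ℕ → Finset (Fin m)) (len : ℕ) (S : Finset (Fin m)) : ℝ :=
  ∑ i ∈ Finset.range (len + 1), if S = c i then 1 else 0

inductive SC {m : ℕ} (X : Finset (Fin m)) : (Finset (Fin m) → ℝ) → Prop
  | congr (f g : Finset (Fin m) → ℝ) (h : ∀ S, S ⊆ X → f S = g S) (hf : SC X f) : SC X g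
  | zero : SC X (fun _ => 0)
  | add (f g : Finset (Fin m) → ℝ) (hf : SC X f) (hg : SC X g) : SC X (fun S => f S + g S)
  | chain (c : ℕ → Finset (Fin m)) (lo len : ℕ) (hsym : 2 * lo + len = X.card)
      (hsub : ∀ i, i ≤ len → c i ⊆ X) (hcard : ∀ i, i ≤ len → (c i).card = lo + i)
      (hmono : ∀ i, i + 1 ≤ len → c i ⊆ c (i+1)) : SC X (chainInd c len)

theorem chainInd_of_card {m : ℕ} (c : ℕ → Finset (Fin m)) (lo len : ℕ)
    (hcard : ∀ i, i ≤ len → (c i).card = lo + i) (S : Finset (Fin m)) (i : ℕ) (hi : i ≤ len)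
    (hS : S.card = lo + i) : chainInd c len S = if S = c i then 1 else 0 := by
  unfold chainInd
  rw [Finset.sum_eq_single i]
  · intro j hj hji
    rw [if_neg]
    rintro rfl
    have := hcard j (by simp at hj; omega)
    omega
  · intro h
    simp at h
    omega

theorem SC.nmpb {m : ℕ} {X : Finset (Fin m)} {k : ℕ} (hX : X.card = 2 * k + 1)
    {f : Finset (Fin m) → ℝ} (hf : SC X f) : NMPB X k f := by
  induction hf with
  | congr f g h _ ih => exact ih.congr' h
  | zero => exact NMPB.zero' X k
  | add f g _ _ ih1 ih2 => exact ih1.add' ih2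
  | chain c lo len hsym hsub hcard hmono =>
    obtain ⟨i, rfl⟩ : ∃ i, k = lo + i := ⟨k - lo, by omega⟩
    have hi : i + 1 ≤ len := by omega
    refine ⟨fun S T => if S = c i ∧ T = c (i+1) then 1 else 0, ?_, ?_, ?_⟩
    · intro S T
      dsimp only
      split_ifs <;> norm_num
    · intro S hS hc
      rw [chainInd_of_card c lo len hcard S i (by omega) hc]
      by_cases h : S = c i
      · subst h
        rw [Finset.sum_eq_single (c (i+1))]
        · simp
        · intro T _ hT
          simp [hT]
        · intro hn
          exfalso
          apply hn
          simp only [Finset.mem_filter, Finset.mem_univ, true_and]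
          exact ⟨hsub _ hi, by rw [hcard _ hi]; omega, hmono i hi⟩
      · simp [h]
    · intro S hS hc
      rw [chainInd_of_card c lo len hcard S (i+1) hi (by omega)]
      by_cases h : S = c (i+1)
      · subst h
        rw [Finset.sum_eq_single (c i)]
        · simp
        · intro T _ hT
          simp [hT]
        · intro hn
          exfalso
          apply hn
          simp only [Finset.mem_filter, Finset.mem_univ, true_and]
          exact ⟨hsub _ (by omega), by rw [hcard _ (by omega)], hmono i hi⟩
      · simp [h]

/-- Product of two chains, as a sum over a grid. -/
theorem SC.grid {m : ℕ} (X X1 X2 : Finset (Fin m)) (hd : Disjoint X1 X2) (hX : X = X1 ∪ X2)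
    (C : ℕ → Finset (Fin m)) (l1 : ℕ) :
    ∀ (a b : ℕ) (D : ℕ → Finset (Fin m)) (l2 : ℕ), 2 * (l1 + l2) + a + b = X.card →
    (∀ i, i ≤ a → C i ⊆ X1) → (∀ i, i ≤ a → (C i).card = l1 + i) →
    (∀ i, i + 1 ≤ a → C i ⊆ C (i+1)) →
    (∀ i, i ≤ b → D i ⊆ X2) → (∀ i, i ≤ b → (D i).card = l2 + i) →
    (∀ i, i + 1 ≤ b → D i ⊆ D (i+1)) →
    SC X (fun S => ∑ i ∈ Finset.range (a+1), ∑ j ∈ Finset.range (b+1),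
      if S = C i ∪ D j then 1 else 0) := by
  intro a
  induction a with
  | zero =>
    intro b D l2 hs hC1 hC2 hC3 hD1 hD2 hD3
    have := SC.chain (X := X) (fun s => C 0 ∪ D s) (l1 + l2) b (by omega)
      (fun i hi => by
        rw [hX]; exact Finset.union_subset_union (hC1 0 le_rfl) (hD1 i hi))
      (fun i hi => by
        rw [Finset.card_union_of_disjoint (Finset.disjoint_of_subset_left (hC1 0 le_rfl)
          (Finset.disjoint_of_subset_right (hD1 i hi) hd)), hC2 0 le_rfl, hD2 i hi]; omega)
      (fun i hi => Finset.union_subset_union_right (hD3 i hi))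
    refine SC.congr _ _ ?_ this
    intro S _
    simp [chainInd]
  | succ a ih =>
    intro b D l2 hs hC1 hC2 hC3 hD1 hD2 hD3
    have hdd : ∀ i j, i ≤ a + 1 → j ≤ b → (C i ∪ D j).card = l1 + l2 + i + j := by
      intro i j hi hj
      rw [Finset.card_union_of_disjoint (Finset.disjoint_of_subset_left (hC1 i hi)
          (Finset.disjoint_of_subset_right (hD1 j hj) hd)), hC2 i hi, hD2 j hj]
      omega
    have hch := SC.chain (X := X) (fun s => C (min s (a+1)) ∪ D (s - (a+1))) (l1 + l2) (a + 1 + b)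
      (by omega)
      (fun i hi => by
        rw [hX]
        exact Finset.union_subset_union (hC1 _ (by omega)) (hD1 _ (by omega)))
      (fun i hi => by
        rw [hdd _ _ (by omega) (by omega)]; omega)
      (fun i hi => by
        by_cases h : i + 1 ≤ a + 1
        · rw [min_eq_left h, min_eq_left (by omega : i ≤ a + 1),
            show i + 1 - (a+1) = 0 by omega, show i - (a+1) = 0 by omega]
          exact Finset.union_subset_union_left (hC3 i h)
        · rw [min_eq_right (by omega : a + 1 ≤ i + 1), min_eq_right (by omega : a + 1 ≤ i),
            show i + 1 - (a+1) = (i - (a+1)) + 1 by omega]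
          exact Finset.union_subset_union_right (hD3 _ (by omega)))
    have hsplit : ∀ S, chainInd (fun s => C (min s (a+1)) ∪ D (s - (a+1))) (a + 1 + b) S
        = (∑ i ∈ Finset.range (a+1+1), if S = C i ∪ D 0 then (1:ℝ) else 0)
          + ∑ j ∈ Finset.range b, if S = C (a+1) ∪ D (j+1) then (1:ℝ) else 0 := by
      intro S
      unfold chainInd
      rw [show a + 1 + b + 1 = (a + 1 + 1) + b by omega, Finset.sum_range_add]
      congr 1
      · refine Finset.sum_congr rfl fun i hi => ?_
        simp only [Finset.mem_range] at hi
        beta_reduce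
        rw [min_eq_left (by omega), show i - (a+1) = 0 by omega]
      · refine Finset.sum_congr rfl fun j _ => ?_
        beta_reduce
        rw [min_eq_right (by omega), show a + 1 + 1 + j - (a+1) = j + 1 by omega]
    cases b with
    | zero =>
      refine SC.congr _ _ ?_ hch
      intro S _
      rw [hsplit]
      simp only [Finset.range_zero, Finset.sum_empty, add_zero, zero_add, Finset.sum_range_one]
    | succ b =>
      have hrest := ih b (fun j => D (j+1)) (l2 + 1) (by omega)
        (fun i hi => hC1 i (by omega)) (fun i hi => hC2 i (by omega))
        (fun i hi => hC3 i (by omega)) (fun i hi => hD1 _ (by omega))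
        (fun i hi => by rw [hD2 _ (by omega)]; omega) (fun i hi => hD3 _ (by omega))
      refine SC.congr _ _ ?_ (SC.add _ _ hch hrest)
      intro S _
      rw [hsplit]
      have : ∀ i, ∑ j ∈ Finset.range (b+1+1), (if S = C i ∪ D j then (1:ℝ) else 0)
          = (if S = C i ∪ D 0 then 1 else 0)
            + ∑ j ∈ Finset.range (b+1), (if S = C i ∪ D (j+1) then (1:ℝ) else 0) := by
        intro i
        rw [Finset.sum_range_succ', add_comm]
      simp only [this]
      rw [Finset.sum_add_distrib, Finset.sum_range_succ
        (fun i => ∑ j ∈ Finset.range (b+1), (if S = C i ∪ D (j+1) then (1:ℝ) else 0)) (a+1)]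
      ring

theorem SC.mul {m : ℕ} {X1 X2 : Finset (Fin m)} (hd : Disjoint X1 X2)
    {f g : Finset (Fin m) → ℝ} (hf : SC X1 f) (hg : SC X2 g) :
    SC (X1 ∪ X2) (fun S => f (S ∩ X1) * g (S ∩ X2)) := by
  induction hf with
  | congr f f' h _ ih =>
    refine SC.congr _ _ ?_ ih
    intro S _
    simp only [h (S ∩ X1) Finset.inter_subset_right]
  | zero => simpa using SC.zero (X := X1 ∪ X2)
  | add f f' _ _ ih1 ih2 =>
    refine SC.congr _ _ ?_ (SC.add _ _ ih1 ih2)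
    intro S _
    ring
  | chain C l1 a hs hC1 hC2 hC3 =>
    induction hg with
    | congr f f' h _ ih =>
      refine SC.congr _ _ ?_ ih
      intro S _
      simp only [h (S ∩ X2) Finset.inter_subset_right]
    | zero => simpa using SC.zero (X := X1 ∪ X2)
    | add f f' _ _ ih1 ih2 =>
      refine SC.congr _ _ ?_ (SC.add _ _ ih1 ih2)
      intro S _
      ring
    | chain D l2 b hs' hD1 hD2 hD3 =>
      have := SC.grid (X1 ∪ X2) X1 X2 hd rfl C l1 a b D l2
        (by rw [Finset.card_union_of_disjoint hd]; omega) hC1 hC2 hC3 hD1 hD2 hD3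
      refine SC.congr _ _ ?_ this
      intro S hS
      unfold chainInd
      rw [Finset.sum_mul_sum]
      refine Finset.sum_congr rfl fun i hi => Finset.sum_congr rfl fun j hj => ?_
      have hi' := hC1 i (by simp at hi; omega)
      have hj' := hD1 j (by simp at hj; omega)
      have : S = C i ∪ D j ↔ (S ∩ X1 = C i ∧ S ∩ X2 = D j) := by
        constructor
        · rintro rfl
          constructor
          · ext x
            have := @hi' x
            have := @hj' x
            have := fun h => Finset.disjoint_left.mp hd (h : x ∈ X1)
            simp only [Finset.mem_inter, Finset.mem_union]
            tauto
          · ext x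
            have := @hi' x
            have := @hj' x
            have := fun h => Finset.disjoint_left.mp hd (h : x ∈ X1)
            simp only [Finset.mem_inter, Finset.mem_union]
            tauto
        · rintro ⟨h1, h2⟩
          rw [← h1, ← h2, ← Finset.inter_union_distrib_left]
          exact (Finset.inter_eq_left.mpr hS).symm
      by_cases h1 : S ∩ X1 = C i <;> by_cases h2 : S ∩ X2 = D j <;> simp [this, h1, h2]

theorem SC.bool_aux {m : ℕ} (A : Finset (Fin m)) :
    ∃ (c : ℕ → Finset (Fin m)) (r : Finset (Fin m) → ℝ), c 0 = ∅ ∧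
      (∀ i, i ≤ A.card → c i ⊆ A) ∧ (∀ i, i ≤ A.card → (c i).card = i) ∧
      (∀ i, i + 1 ≤ A.card → c i ⊆ c (i+1)) ∧ SC A r ∧
      ∀ S, S ⊆ A → chainInd c A.card S + r S = 1 := by
  induction A using Finset.induction_on with
  | empty =>
    refine ⟨fun _ => ∅, fun _ => 0, rfl, by simp, by simp, by simp, SC.zero, ?_⟩
    intro S hS
    rw [Finset.subset_empty] at hS
    simp [chainInd, hS]
  | insert a A ha ih =>
    obtain ⟨c, r, h0, h1, h2, h3, hr, h4⟩ := ih
    have hcA : c A.card = A := Finset.eq_of_subset_of_card_le (h1 _ le_rfl) (by rw [h2 _ le_rfl])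
    have hone : SC {a} (fun _ : Finset (Fin m) => (1:ℝ)) := by
      refine SC.congr _ _ ?_ (SC.chain (X := {a}) (fun i => if i = 0 then ∅ else {a}) 0 1 (by simp)
        ?_ ?_ ?_)
      · intro S hS
        rcases Finset.subset_singleton_iff.mp hS with rfl | rfl <;>
          simp [chainInd, Finset.sum_range_succ]
      · intro i _
        by_cases h : i = 0 <;> simp [h]
      · intro i hi
        interval_cases i <;> simp
      · intro i hi
        have : i = 0 := by omega
        subst this
        simp
    have hprod := SC.mul (by simpa using ha : Disjoint A {a}) hr hone
    rw [show A ∪ {a} = insert a A by rw [Finset.union_comm, Finset.insert_eq]] at hprod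
    have hcins : ∀ i, i ≤ A.card → a ∉ c i := fun i hi h => ha (h1 i hi h)
    have hsecond : SC (insert a A) (fun S => ∑ i ∈ Finset.range A.card,
        if S = insert a (c i) then (1:ℝ) else 0) := by
      by_cases hA : A.card = 0
      · simp only [hA, Finset.range_zero, Finset.sum_empty]
        exact SC.zero
      · have := SC.chain (X := insert a A) (fun i => insert a (c i)) 1 (A.card - 1)
          (by rw [Finset.card_insert_of_notMem ha]; omega)
          (fun i hi => Finset.insert_subset_insert _ (h1 i (by omega)))
          (fun i hi => by
            rw [Finset.card_insert_of_notMem (hcins i (by omega)), h2 i (by omega)]; omega)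
          (fun i hi => Finset.insert_subset_insert _ (h3 i (by omega)))
        refine SC.congr _ _ ?_ this
        intro S _
        unfold chainInd
        rw [show A.card - 1 + 1 = A.card by omega]
    refine ⟨fun i => if i ≤ A.card then c i else insert a A, _, ?_, ?_, ?_, ?_,
      SC.add _ _ hprod hsecond, ?_⟩
    · simp [h0]
    · intro i hi
      dsimp only
      split_ifs with h
      · exact (h1 i h).trans (Finset.subset_insert _ _)
      · exact subset_rfl
    · intro i hi
      dsimp only
      rw [Finset.card_insert_of_notMem ha] at hi
      split_ifs with h
      · exact h2 i h
      · rw [Finset.card_insert_of_notMem ha]; omega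
    · intro i hi
      rw [Finset.card_insert_of_notMem ha] at hi
      dsimp only
      rw [if_pos (by omega)]
      split_ifs with h
      · exact h3 i h
      · exact (h1 i (by omega)).trans (Finset.subset_insert _ _)
    · intro S hS
      have hSA : S ∩ A ⊆ A := Finset.inter_subset_right
      have hkey := h4 (S ∩ A) hSA
      unfold chainInd at hkey ⊢
      rw [Finset.card_insert_of_notMem ha, Finset.sum_range_succ]
      have e1 : ∑ i ∈ Finset.range (A.card + 1),
          (if S = (if i ≤ A.card then c i else insert a A) then (1:ℝ) else 0)
          = ∑ i ∈ Finset.range (A.card + 1), if S = c i then (1:ℝ) else 0 := by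
        refine Finset.sum_congr rfl fun i hi => ?_
        simp only [Finset.mem_range] at hi
        rw [if_pos (by omega : i ≤ A.card)]
      beta_reduce
      rw [e1, if_neg (by omega : ¬ (A.card + 1 ≤ A.card))]
      by_cases haS : a ∈ S
      · have e2 : ∑ i ∈ Finset.range (A.card + 1), (if S = c i then (1:ℝ) else 0) = 0 := by
          refine Finset.sum_eq_zero fun i hi => if_neg ?_
          rintro rfl
          exact hcins i (by simp at hi; omega) haS
        have e3 : ∀ i, i ≤ A.card → (S = insert a (c i) ↔ S ∩ A = c i) := by
          intro i hi
          constructor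
          · rintro rfl
            ext x
            have := @h1 i hi x
            simp only [Finset.mem_inter, Finset.mem_insert]
            constructor
            · rintro ⟨rfl | h, h'⟩
              · exact absurd h' ha
              · exact h
            · intro h
              exact ⟨Or.inr h, this h⟩
          · intro h
            rw [← h]
            ext x
            have := @hS x
            simp only [Finset.mem_inter, Finset.mem_insert] at this ⊢
            constructor
            · intro hx
              rcases this hx with h | h
              · exact Or.inl h
              · exact Or.inr ⟨hx, h⟩
            · rintro (rfl | h)
              · exact haS
              · exact h.1
        rw [Finset.sum_range_succ] at hkey
        rw [e2]
        have e4 : (if S = insert a A then (1:ℝ) else 0) = if S ∩ A = c A.card then 1 else 0 := by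
          have := e3 A.card le_rfl
          rw [hcA] at this ⊢
          simp only [this]
        have e5 : ∑ i ∈ Finset.range A.card, (if S = insert a (c i) then (1:ℝ) else 0)
            = ∑ i ∈ Finset.range A.card, (if S ∩ A = c i then (1:ℝ) else 0) := by
          refine Finset.sum_congr rfl fun i hi => ?_
          simp only [e3 i (by simp at hi; omega)]
        rw [e4, e5]
        linarith
      · have hSA' : S ∩ A = S := by
          rw [Finset.inter_eq_left]
          exact (Finset.subset_insert_iff_of_notMem haS).mp hS
        rw [hSA'] at hkey ⊢
        have e2 : ∑ i ∈ Finset.range A.card, (if S = insert a (c i) then (1:ℝ) else 0) = 0 := by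
          refine Finset.sum_eq_zero fun i hi => if_neg ?_
          rintro rfl
          exact haS (by simp)
        rw [e2, if_neg (by rintro rfl; exact haS (by simp))]
        linarith

theorem SC.one {m : ℕ} (A : Finset (Fin m)) : SC A (fun _ => 1) := by
  obtain ⟨c, r, h0, h1, h2, h3, hr, h4⟩ := SC.bool_aux A
  exact SC.congr _ _ h4 (SC.add _ _ (SC.chain c 0 A.card (by omega) h1
    (fun i hi => by rw [h2 i hi]; omega) h3) hr)

theorem SC.split {m : ℕ} (A : Finset (Fin m)) :
    SC A (fun S => if (∃ x ∈ A, x ∈ S) ∧ (∃ x ∈ A, x ∉ S) then 1 else 0) := by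
  by_cases hA : A.card ≤ 1
  · refine SC.congr _ _ ?_ SC.zero
    intro S _
    rw [if_neg]
    rintro ⟨⟨x, hx, hxS⟩, ⟨y, hy, hyS⟩⟩
    rw [Finset.card_le_one] at hA
    exact hyS (hA x hx y hy ▸ hxS)
  obtain ⟨c, r, h0, h1, h2, h3, hr, h4⟩ := SC.bool_aux A
  have hcA : c A.card = A := Finset.eq_of_subset_of_card_le (h1 _ le_rfl) (by rw [h2 _ le_rfl])
  obtain ⟨N, hN⟩ : ∃ N, A.card = N + 2 := ⟨A.card - 2, by omega⟩
  have hch := SC.chain (X := A) (fun i => c (i+1)) 1 N (by omega) (fun i hi => h1 _ (by omega))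
    (fun i hi => by rw [h2 _ (by omega)]; omega) (fun i hi => h3 _ (by omega))
  -- the remainder vanishes at the bottom and the top
  have hsp : ∀ S, chainInd c A.card S = chainInd (fun i => c (i+1)) N S
      + (if S = ∅ then 1 else 0) + (if S = A then 1 else 0) := by
    intro S
    unfold chainInd
    rw [Finset.sum_range_succ, hcA, hN, Finset.sum_range_succ', h0]
  refine SC.congr _ _ ?_ (SC.add _ _ hch hr)
  intro S hS
  have hk := h4 S hS
  rw [hsp] at hk
  have c1 : (∃ x ∈ A, x ∈ S) ↔ S ≠ ∅ := by
    rw [← Finset.nonempty_iff_ne_empty]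
    exact ⟨fun ⟨x, _, h⟩ => ⟨x, h⟩, fun ⟨x, h⟩ => ⟨x, hS h, h⟩⟩
  have c2 : (∃ x ∈ A, x ∉ S) ↔ S ≠ A := by
    constructor
    · rintro ⟨x, hx, hxS⟩ rfl
      exact hxS hx
    · intro h
      by_contra! h'
      exact h (Finset.Subset.antisymm hS h')
  simp only [c1, c2]
  have hne : A ≠ ∅ := by
    rintro rfl
    simp at hN
  by_cases hS0 : S = ∅
  · subst hS0
    simp [hne.symm] at hk ⊢
    linarith
  · by_cases hS1 : S = A
    · subst hS1
      simp [hne] at hk ⊢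
      linarith
    · simp [hS0, hS1] at hk ⊢
      linarith

theorem SC.blocks {m : ℕ} {V : Type*} (X : Finset (Fin m)) (τ : (Fin m) → V) (D : Finset V) :
    SC (X.filter fun x => τ x ∈ D) (fun S => if ∀ j ∈ D,
      (∃ x ∈ X, τ x = j ∧ x ∈ S) ∧ (∃ x ∈ X, τ x = j ∧ x ∉ S) then 1 else 0) := by
  induction D using Finset.induction_on with
  | empty => simpa using SC.one (∅ : Finset (Fin m))
  | insert j D hj ih =>
    have hd : Disjoint (X.filter fun x => τ x ∈ D) (X.filter fun x => τ x = j) := by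
      rw [Finset.disjoint_left]
      intro x hx hx'
      simp only [Finset.mem_filter] at hx hx'
      exact hj (hx'.2 ▸ hx.2)
    have := SC.mul hd ih (SC.split _)
    rw [show (X.filter fun x => τ x ∈ D) ∪ (X.filter fun x => τ x = j)
      = X.filter fun x => τ x ∈ insert j D by
        ext x; simp only [Finset.mem_filter, Finset.mem_union, Finset.mem_insert]; tauto] at this
    refine SC.congr _ _ ?_ this
    intro S hS
    rw [mul_ite_one_zero]
    refine ite_one_congr ?_
    rw [Finset.forall_mem_insert, and_comm]
    refine and_congr ?_ ?_
    · refine and_congr ?_ ?_ <;> refine exists_congr fun x => ?_ <;>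
        simp only [Finset.mem_filter, Finset.mem_inter] <;> tauto
    · refine forall₂_congr fun i hi => ?_
      refine and_congr ?_ ?_ <;> refine exists_congr fun x => ?_ <;>
        simp only [Finset.mem_filter, Finset.mem_inter] <;>
        refine and_congr_right fun hx => and_congr_right fun hxi => ?_ <;>
        subst hxi <;> tauto

theorem SC.blocks' {m : ℕ} {V : Type*} (X : Finset (Fin m)) (τ : (Fin m) → V) (D : Finset V) :
    SC X (fun S => if ∀ j ∈ D,
      (∃ x ∈ X, τ x = j ∧ x ∈ S) ∧ (∃ x ∈ X, τ x = j ∧ x ∉ S) then 1 else 0) := by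
  have := SC.mul (Finset.disjoint_filter_filter_not X X fun x => τ x ∈ D)
    (SC.blocks X τ D) (SC.one _)
  rw [Finset.filter_union_filter_not_eq] at this
  refine SC.congr _ _ ?_ this
  intro S hS
  rw [mul_one]
  refine ite_one_congr ?_
  refine forall₂_congr fun i hi => ?_
  refine and_congr ?_ ?_ <;> refine exists_congr fun x => ?_ <;>
    simp only [Finset.mem_filter, Finset.mem_inter] <;>
    refine and_congr_right fun hx => and_congr_right fun hxi => ?_ <;>
    subst hxi <;> tauto

/-! ### Orientations and deletion-contraction -/

def vend {V : Type*} (q : V × V) (b : Bool) : V := if b = true then q.1 else q.2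

def vsd {m : ℕ} {V : Type*} (e : (Fin m) → V × V) (U : Finset (Fin m)) (i : (Fin m)) (b : Bool) : V :=
  vend (e i) (if i ∈ U then !b else b)

def Val {m : ℕ} {V : Type*} (Z : Finset (Fin m)) (e : (Fin m) → V × V) (D : Finset V) (U : Finset (Fin m)) : Prop :=
  ∀ j ∈ D, ∀ b, ∃ i ∈ Z, vsd e U i b = j

def cnt {m : ℕ} {V : Type*} (X Y : Finset (Fin m)) (e : (Fin m) → V × V) (D : Finset V) (S : Finset (Fin m)) : ℝ :=
  ∑ R ∈ Y.powerset, if Val (X ∪ Y) e D (S ∪ R) then 1 else 0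

theorem val_insert₁ {m : ℕ} {V : Type*} (Z : Finset (Fin m)) (e : (Fin m) → V × V) (D : Finset V) (U : Finset (Fin m))
    (y : (Fin m)) (hyU : y ∉ U) :
    Val (insert y Z) e D U ↔
      ∀ j ∈ D, ∀ b, vend (e y) b = j ∨ ∃ i ∈ Z, vsd e U i b = j := by
  unfold Val
  refine forall₂_congr fun j _ => forall_congr' fun b => ?_
  rw [Finset.exists_mem_insert]
  simp [vsd, hyU]

theorem val_insert₂ {m : ℕ} {V : Type*} (Z : Finset (Fin m)) (e : (Fin m) → V × V) (D : Finset V) (U : Finset (Fin m))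
    (y : (Fin m)) (hyZ : y ∉ Z) :
    Val (insert y Z) e D (insert y U) ↔
      ∀ j ∈ D, ∀ b, vend (e y) (!b) = j ∨ ∃ i ∈ Z, vsd e U i b = j := by
  unfold Val
  refine forall₂_congr fun j _ => forall_congr' fun b => ?_
  rw [Finset.exists_mem_insert]
  refine or_congr (by simp [vsd]) ?_
  refine exists_congr fun i => and_congr_right fun hi => ?_
  have : i ≠ y := by rintro rfl; exact hyZ hi
  simp [vsd, this]

theorem cnt_insert {m : ℕ} {V : Type*} (X Y : Finset (Fin m)) (e : (Fin m) → V × V) (D : Finset V) (S : Finset (Fin m))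
    (hS : S ⊆ X) (y : (Fin m)) (hyX : y ∉ X) (hyY : y ∉ Y) :
    cnt X (insert y Y) e D S = ∑ R ∈ Y.powerset,
      ((if ∀ j ∈ D, ∀ b, vend (e y) b = j ∨ ∃ i ∈ X ∪ Y, vsd e (S ∪ R) i b = j then 1 else 0)
      + (if ∀ j ∈ D, ∀ b, vend (e y) (!b) = j ∨ ∃ i ∈ X ∪ Y, vsd e (S ∪ R) i b = j
          then 1 else 0)) := by
  unfold cnt
  rw [Finset.sum_powerset_insert hyY, ← Finset.sum_add_distrib]
  refine Finset.sum_congr rfl fun R hR => ?_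
  rw [Finset.mem_powerset] at hR
  have hyU : y ∉ S ∪ R := by
    rw [Finset.mem_union]
    rintro (h | h)
    · exact hyX (hS h)
    · exact hyY (hR h)
  have hyZ : y ∉ X ∪ Y := by simp [hyX, hyY]
  rw [Finset.union_insert, Finset.union_insert]
  congr 1
  · exact ite_one_congr (val_insert₁ _ _ _ _ _ hyU)
  · exact ite_one_congr (val_insert₂ _ _ _ _ _ hyZ)

theorem dc_A {V : Type*} (P : V → Bool → Prop) (D : Finset V) (q : V × V) (hne : q.1 ≠ q.2)
    (h1 : q.1 ∈ D) (h2 : q.2 ∈ D) (hu : P q.1 true ∨ P q.1 false)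
    (hv : P q.2 true ∨ P q.2 false)
    {i1 : Decidable (∀ j ∈ D, ∀ b, vend q b = j ∨ P j b)}
    {i2 : Decidable (∀ j ∈ D, ∀ b, vend q (!b) = j ∨ P j b)}
    {i3 : Decidable (∀ j ∈ D.erase q.1, ∀ b, P j b ∨ (j = q.2 ∧ P q.1 b))}
    {i4 : Decidable (∀ j ∈ D, ∀ b, P j b)} :
    (if ∀ j ∈ D, ∀ b, vend q b = j ∨ P j b then (1:ℝ) else 0)
      + (if ∀ j ∈ D, ∀ b, vend q (!b) = j ∨ P j b then 1 else 0)
    = (if ∀ j ∈ D.erase q.1, ∀ b, P j b ∨ (j = q.2 ∧ P q.1 b) then 1 else 0)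
      + (if ∀ j ∈ D, ∀ b, P j b then 1 else 0) := by
  obtain ⟨u, v⟩ := q
  simp only at hne h1 h2 hu hv ⊢
  by_cases hQ : ∀ j ∈ D, j ≠ u → j ≠ v → ∀ b, P j b
  · have a1 : (∀ j ∈ D, ∀ b, vend (u,v) b = j ∨ P j b) ↔ P u false ∧ P v true := by
      constructor
      · intro h
        have x1 := h u h1 false
        have x2 := h v h2 true
        simp [vend, hne, hne.symm] at x1 x2
        exact ⟨x1, x2⟩
      · rintro ⟨x1, x2⟩ j hj b
        by_cases hju : j = u
        · subst hju; cases b <;> simp [vend, x1]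
        · by_cases hjv : j = v
          · subst hjv; cases b <;> simp [vend, x2]
          · exact Or.inr (hQ j hj hju hjv b)
    have a2 : (∀ j ∈ D, ∀ b, vend (u,v) (!b) = j ∨ P j b) ↔ P u true ∧ P v false := by
      constructor
      · intro h
        have x1 := h u h1 true
        have x2 := h v h2 false
        simp [vend, hne, hne.symm] at x1 x2
        exact ⟨x1, x2⟩
      · rintro ⟨x1, x2⟩ j hj b
        by_cases hju : j = u
        · subst hju; cases b <;> simp [vend, x1]
        · by_cases hjv : j = v
          · subst hjv; cases b <;> simp [vend, x2]
          · exact Or.inr (hQ j hj hju hjv b)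
    have a3 : (∀ j ∈ D.erase u, ∀ b, P j b ∨ (j = v ∧ P u b)) ↔
        (P v true ∨ P u true) ∧ (P v false ∨ P u false) := by
      constructor
      · intro h
        have hm : v ∈ D.erase u := Finset.mem_erase.mpr ⟨hne.symm, h2⟩
        have x1 := h v hm true
        have x2 := h v hm false
        tauto
      · rintro ⟨x1, x2⟩ j hj b
        rw [Finset.mem_erase] at hj
        by_cases hjv : j = v
        · subst hjv; cases b <;> tauto
        · exact Or.inl (hQ j hj.2 hj.1 hjv b)
    have a4 : (∀ j ∈ D, ∀ b, P j b) ↔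
        (P v true ∧ P u true) ∧ (P v false ∧ P u false) := by
      constructor
      · intro h
        exact ⟨⟨h _ h2 _, h _ h1 _⟩, ⟨h _ h2 _, h _ h1 _⟩⟩
      · rintro ⟨⟨x1, x2⟩, x3, x4⟩ j hj b
        by_cases hju : j = u
        · subst hju; cases b <;> tauto
        · by_cases hjv : j = v
          · subst hjv; cases b <;> tauto
          · exact hQ j hj hju hjv b
    rw [ite_one_congr a1, ite_one_congr a2, ite_one_congr a3, ite_one_congr a4]
    by_cases b1 : P u true <;> by_cases b2 : P u false <;> by_cases b3 : P v true <;>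
      by_cases b4 : P v false <;> simp [b1, b2, b3, b4] at hu hv ⊢
  · push Not at hQ
    obtain ⟨j, hj, hju, hjv, b, hb⟩ := hQ
    have a0 : ∀ c, vend (u, v) c ≠ j := by
      intro c; cases c <;> simp [vend, hju.symm, hjv.symm]
    rw [if_neg, if_neg, if_neg, if_neg]
    · exact fun h => hb (h j hj b)
    · intro h
      have := h j (Finset.mem_erase.mpr ⟨hju, hj⟩) b
      tauto
    · intro h
      rcases h j hj b with h | h
      · exact a0 _ h
      · exact hb h
    · intro h
      rcases h j hj b with h | h
      · exact a0 _ h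
      · exact hb h

theorem dc_B {V : Type*} (P : V → Bool → Prop) (D : Finset V) (q : V × V) (c : Bool)
    (h1 : vend q c ∈ D) (h2 : vend q (!c) ∉ D) (hu : P (vend q c) true ∨ P (vend q c) false)
    {i1 : Decidable (∀ j ∈ D, ∀ b, vend q b = j ∨ P j b)}
    {i2 : Decidable (∀ j ∈ D, ∀ b, vend q (!b) = j ∨ P j b)}
    {i3 : Decidable (∀ j ∈ D.erase (vend q c), ∀ b, P j b)}
    {i4 : Decidable (∀ j ∈ D, ∀ b, P j b)} :
    (if ∀ j ∈ D, ∀ b, vend q b = j ∨ P j b then (1:ℝ) else 0)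
      + (if ∀ j ∈ D, ∀ b, vend q (!b) = j ∨ P j b then 1 else 0)
    = (if ∀ j ∈ D.erase (vend q c), ∀ b, P j b then 1 else 0)
      + (if ∀ j ∈ D, ∀ b, P j b then 1 else 0) := by
  set u := vend q c with hudef
  have hor : ∀ c' j, j ∈ D → vend q c' = j → c' = c ∧ j = u := by
    intro c' j hj h
    by_cases hc : c' = c
    · subst hc; exact ⟨rfl, h.symm⟩
    · have : c' = !c := by cases c <;> cases c' <;> simp_all
      subst this
      rw [h] at h2
      exact absurd hj h2
  by_cases hQ : ∀ j ∈ D.erase u, ∀ b, P j b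
  · have hQ' : ∀ j ∈ D, j ≠ u → ∀ b, P j b := fun j hj hju =>
      hQ j (Finset.mem_erase.mpr ⟨hju, hj⟩)
    have a1 : (∀ j ∈ D, ∀ b, vend q b = j ∨ P j b) ↔ P u (!c) := by
      constructor
      · intro h
        rcases h u h1 (!c) with h | h
        · have := (hor _ _ h1 h).1
          cases c <;> simp at this
        · exact h
      · intro x j hj b
        by_cases hju : j = u
        · subst hju
          by_cases hb : b = c
          · subst hb; exact Or.inl rfl
          · have : b = !c := by cases c <;> cases b <;> simp_all
            subst this; exact Or.inr x
        · exact Or.inr (hQ' j hj hju b)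
    have a2 : (∀ j ∈ D, ∀ b, vend q (!b) = j ∨ P j b) ↔ P u c := by
      constructor
      · intro h
        rcases h u h1 c with h | h
        · have := (hor _ _ h1 h).1
          cases c <;> simp at this
        · exact h
      · intro x j hj b
        by_cases hju : j = u
        · subst hju
          by_cases hb : b = c
          · subst hb; exact Or.inr x
          · have : (!b) = c := by cases c <;> cases b <;> simp_all
            rw [this]; exact Or.inl rfl
        · exact Or.inr (hQ' j hj hju b)
    have a4 : (∀ j ∈ D, ∀ b, P j b) ↔ P u c ∧ P u (!c) := by
      constructor
      · intro h
        exact ⟨h _ h1 _, h _ h1 _⟩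
      · rintro ⟨x1, x2⟩ j hj b
        by_cases hju : j = u
        · subst hju
          by_cases hb : b = c
          · subst hb; exact x1
          · have : b = !c := by cases c <;> cases b <;> simp_all
            subst this; exact x2
        · exact hQ' j hj hju b
    have hu' : P u c ∨ P u (!c) := by cases c <;> simp <;> tauto
    rw [ite_one_congr a1, ite_one_congr a2, ite_one_congr a4, if_pos hQ]
    clear a1 a2 a4
    by_cases b1 : P u c <;> by_cases b2 : P u (!c) <;> simp [b1, b2] at hu' ⊢
  · rw [if_neg hQ]
    push Not at hQ
    obtain ⟨j, hj, b, hb⟩ := hQ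
    rw [Finset.mem_erase] at hj
    have a4 : ¬ ∀ j ∈ D, ∀ b, P j b := fun h => hb (h j hj.2 b)
    rw [if_neg a4, if_neg, if_neg]
    · intro h
      rcases h j hj.2 b with h | h
      · exact hj.1 (hor _ _ hj.2 h).2
      · exact hb h
    · intro h
      rcases h j hj.2 b with h | h
      · exact hj.1 (hor _ _ hj.2 h).2
      · exact hb h

theorem vsd_touch {m : ℕ} {V : Type*} (Z : Finset (Fin m)) (e : (Fin m) → V × V) (U : Finset (Fin m)) (u : V)
    (h : ∃ i ∈ Z, ∃ c, vend (e i) c = u) :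
    (∃ i ∈ Z, vsd e U i true = u) ∨ (∃ i ∈ Z, vsd e U i false = u) := by
  obtain ⟨i, hi, c, hc⟩ := h
  by_cases hU : i ∈ U <;> cases c
  · exact Or.inl ⟨i, hi, by simpa [vsd, hU] using hc⟩
  · exact Or.inr ⟨i, hi, by simpa [vsd, hU] using hc⟩
  · exact Or.inr ⟨i, hi, by simpa [vsd, hU] using hc⟩
  · exact Or.inl ⟨i, hi, by simpa [vsd, hU] using hc⟩

theorem core_nmpb {m : ℕ} {V : Type*} (X : Finset (Fin m)) (k : ℕ) (hX : X.card = 2 * k + 1)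
    (Y : Finset (Fin m)) : ∀ (e : Fin m → V × V) (D : Finset V), Disjoint X Y →
    (∀ x ∈ X, (e x).2 ∉ D) → NMPB X k (cnt X Y e D) := by
  induction Y using Finset.induction_on with
  | empty =>
    intro e D _ hl
    refine (SC.nmpb hX (SC.blocks' X (fun x => (e x).1) D)).congr' ?_
    intro S hS
    simp only [cnt, Finset.powerset_empty, Finset.sum_singleton, Finset.union_empty]
    refine ite_one_congr ?_
    unfold Val
    refine forall₂_congr fun j hj => ?_
    have key : ∀ x ∈ X, (e x).2 ≠ j := fun x hx h => hl x hx (h ▸ hj)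
    rw [Bool.forall_bool]
    refine and_congr ?_ ?_ <;> refine exists_congr fun x => and_congr_right fun hx => ?_ <;>
      have := key x hx <;> by_cases hxS : x ∈ S <;> simp [vsd, vend, hxS, this]
  | insert y Y hy ih =>
    intro e D hdis hl
    rw [Finset.disjoint_insert_right] at hdis
    obtain ⟨hyX, hdis⟩ := hdis
    -- a vertex touched by `y` only
    by_cases hvac : ∃ c, vend (e y) c ∈ D ∧ vend (e y) (!c) ≠ vend (e y) c ∧
        ¬ ∃ i ∈ X ∪ Y, ∃ c', vend (e i) c' = vend (e y) c
    · obtain ⟨c, hc, hne, hn⟩ := hvac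
      refine (NMPB.zero' X k).congr' ?_
      intro S hS
      rw [cnt_insert X Y e D S hS y hyX hy]
      symm
      refine Finset.sum_eq_zero fun R _ => ?_
      have hP : ∀ b, ¬ ∃ i ∈ X ∪ Y, vsd e (S ∪ R) i b = vend (e y) c := by
        rintro b ⟨i, hi, h⟩
        exact hn ⟨i, hi, _, h⟩
      rw [if_neg, if_neg, add_zero]
      · intro h
        rcases h _ hc c with h | h
        · exact hne h
        · exact hP _ h
      · intro h
        rcases h _ hc (!c) with h | h
        · exact hne h
        · exact hP _ h
    have htouch : ∀ c, vend (e y) c ∈ D → vend (e y) (!c) ≠ vend (e y) c →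
        ∃ i ∈ X ∪ Y, ∃ c', vend (e i) c' = vend (e y) c := by
      intro c h1 h2
      by_contra h3
      exact hvac ⟨c, h1, h2, h3⟩
    have hlD : ∀ u, ∀ x ∈ X, (e x).2 ∉ D.erase u := fun u x hx h =>
      hl x hx (Finset.mem_of_mem_erase h)
    by_cases hB : ∃ c, vend (e y) c ∈ D ∧ vend (e y) (!c) ∉ D
    · obtain ⟨c, h1, h2⟩ := hB
      refine (NMPB.add' (ih e (D.erase (vend (e y) c)) hdis (hlD _)) (ih e D hdis hl)).congr' ?_
      intro S hS
      rw [cnt_insert X Y e D S hS y hyX hy]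
      unfold cnt
      rw [← Finset.sum_add_distrib]
      refine Finset.sum_congr rfl fun R _ => ?_
      have ht := htouch c h1 (fun h => h2 (h ▸ h1))
      exact (dc_B (fun j b => ∃ i ∈ X ∪ Y, vsd e (S ∪ R) i b = j) D (e y) c h1 h2
        (vsd_touch _ e _ _ ht)).symm
    by_cases h1 : (e y).1 ∈ D
    · have h2 : (e y).2 ∈ D := by
        by_contra h
        exact hB ⟨true, by simpa [vend] using h1, by simpa [vend] using h⟩
      by_cases hne : (e y).1 = (e y).2
      · -- loop
        refine (NMPB.smul' (by norm_num : (0:ℝ) ≤ 2)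
          (ih e (D.erase (e y).1) hdis (hlD _))).congr' ?_
        intro S hS
        rw [cnt_insert X Y e D S hS y hyX hy]
        unfold cnt
        rw [Finset.mul_sum]
        refine Finset.sum_congr rfl fun R _ => ?_
        have hv : ∀ b, vend (e y) b = (e y).1 := by
          intro b; cases b <;> simp [vend, hne]
        have : (∀ j ∈ D, ∀ b : Bool, (e y).1 = j ∨ ∃ i ∈ X ∪ Y, vsd e (S ∪ R) i b = j)
            ↔ Val (X ∪ Y) e (D.erase (e y).1) (S ∪ R) := by
          constructor
          · intro h j hj b
            rw [Finset.mem_erase] at hj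
            exact (h j hj.2 b).resolve_left (fun h => hj.1 h.symm)
          · intro h j hj b
            by_cases hje : (e y).1 = j
            · exact Or.inl hje
            · exact Or.inr (h j (Finset.mem_erase.mpr ⟨fun h => hje h.symm, hj⟩) b)
        simp only [hv]
        rw [ite_one_congr this]
        ring
      · -- contraction
        set u := (e y).1 with hu
        set v := (e y).2 with hv
        let f : V → V := fun w => if w = u then v else w
        let e' : Fin m → V × V := fun i => (f (e i).1, f (e i).2)
        have hl' : ∀ x ∈ X, (e' x).2 ∉ D.erase u := by
          intro x hx h
          have h0 := hl x hx
          by_cases hx2 : (e x).2 = u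
          · rw [hx2] at h0
            exact h0 h1
          · simp only [e', f, if_neg hx2] at h
            exact hlD _ x hx h
        refine (NMPB.add' (ih e' (D.erase u) hdis hl') (ih e D hdis hl)).congr' ?_
        intro S hS
        rw [cnt_insert X Y e D S hS y hyX hy]
        unfold cnt
        rw [← Finset.sum_add_distrib]
        refine Finset.sum_congr rfl fun R _ => ?_
        have t1 := htouch true (by simpa [vend] using h1)
          (by simpa [vend] using fun h => hne h.symm)
        have t2 := htouch false (by simpa [vend] using h2) (by simpa [vend] using hne)
        refine Eq.trans ?_ (dc_A (i3 := Classical.propDecidable _)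
          (i4 := Classical.propDecidable _) (fun j b => ∃ i ∈ X ∪ Y, vsd e (S ∪ R) i b = j) D (e y) hne h1 h2
          (vsd_touch _ e _ _ (by simpa [vend] using t1))
          (vsd_touch _ e _ _ (by simpa [vend] using t2))).symm
        refine congrArg₂ (· + ·) (ite_one_congr_imp ?_) (ite_one_congr_imp Iff.rfl)
        unfold Val
        refine forall₂_congr fun j hj => forall_congr' fun b => ?_
        rw [Finset.mem_erase] at hj
        have hvs : ∀ i, vsd e' (S ∪ R) i b = f (vsd e (S ∪ R) i b) := by
          intro i
          unfold vsd vend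
          dsimp only [e']
          split_ifs <;> rfl
        simp only [hvs]
        constructor
        · rintro ⟨i, hi, h⟩
          by_cases hw : vsd e (S ∪ R) i b = u
          · right
            simp only [f, if_pos hw] at h
            exact ⟨h.symm, i, hi, hw⟩
          · left
            simp only [f, if_neg hw] at h
            exact ⟨i, hi, h⟩
        · rintro (⟨i, hi, h⟩ | ⟨h, i, hi, h'⟩)
          · refine ⟨i, hi, ?_⟩
            simp only [f]
            rw [h, if_neg hj.1]
          · refine ⟨i, hi, ?_⟩
            simp only [f]
            rw [h', if_pos hu, h]
    · have h2 : (e y).2 ∉ D := by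
        intro h
        exact hB ⟨false, by simpa [vend] using h, by simpa [vend] using h1⟩
      refine (NMPB.smul' (by norm_num : (0:ℝ) ≤ 2) (ih e D hdis hl)).congr' ?_
      intro S hS
      rw [cnt_insert X Y e D S hS y hyX hy]
      unfold cnt
      rw [Finset.mul_sum]
      refine Finset.sum_congr rfl fun R _ => ?_
      have hv : ∀ b, vend (e y) b ∉ D := by
        intro b; cases b <;> simpa [vend]
      have hg : ∀ t : Bool → Bool,
          (∀ j ∈ D, ∀ b : Bool, vend (e y) (t b) = j ∨ ∃ i ∈ X ∪ Y, vsd e (S ∪ R) i b = j)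
          ↔ Val (X ∪ Y) e D (S ∪ R) := by
        intro t
        refine forall₂_congr fun j hj => forall_congr' fun b => ?_
        have : vend (e y) (t b) ≠ j := fun h => hv _ (h ▸ hj)
        simp [this]
      rw [ite_one_congr (hg fun b => b), ite_one_congr (hg fun b => !b)]
      ring

/-! ### Assembly -/

def swp {m : ℕ} {V : Type*} (U : Finset (Fin m)) (E : ((Fin m) → V) × ((Fin m) → V)) : ((Fin m) → V) × ((Fin m) → V) :=
  (fun i => if i ∈ U then E.2 i else E.1 i, fun i => if i ∈ U then E.1 i else E.2 i)

theorem swp_invol {m : ℕ} {V : Type*} (U : Finset (Fin m)) : Function.Involutive (swp (V := V) U) := by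
  intro E
  refine Prod.ext ?_ ?_ <;> funext i <;> by_cases h : i ∈ U <;> simp [swp, h]

theorem urnWeight_nonneg {m n : ℕ} {p : Fin m → Fin n → ℝ} (hp : ∀ i j, 0 ≤ p i j)
    (σ : Fin m → Fin n) : 0 ≤ urnWeight p σ :=
  Finset.prod_nonneg fun i _ => hp i (σ i)

theorem swp_weight {m n : ℕ} (p : Fin m → Fin n → ℝ) (U : Finset (Fin m))
    (E : (Fin m → Fin n) × (Fin m → Fin n)) :
    urnWeight p (swp U E).1 * urnWeight p (swp U E).2 = urnWeight p E.1 * urnWeight p E.2 := by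
  unfold urnWeight
  rw [← Finset.prod_mul_distrib, ← Finset.prod_mul_distrib]
  refine Finset.prod_congr rfl fun i _ => ?_
  by_cases h : i ∈ U
  · simp [swp, h, mul_comm]
  · simp [swp, h]

theorem one_le_ballCount {m n : ℕ} (σ : Fin m → Fin n) (j : Fin n) :
    1 ≤ ballCount σ j ↔ ∃ i, σ i = j := by
  unfold ballCount
  rw [Finset.one_le_card]
  constructor
  · rintro ⟨i, hi⟩
    exact ⟨i, by simpa using hi⟩
  · rintro ⟨i, hi⟩
    exact ⟨i, by simpa using hi⟩

theorem ite_shuffle (A B C D : Prop) (a b : ℝ) [Decidable (A ∧ C)] [Decidable (B ∧ D)]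
    [Decidable (A ∧ B)] [Decidable (C ∧ D)] :
    (if A ∧ C then a else 0) * (if B ∧ D then b else 0)
      = (if A ∧ B then a * b else 0) * (if C ∧ D then 1 else 0) := by
  by_cases hA : A <;> by_cases hB : B <;> by_cases hC : C <;> by_cases hD : D <;>
    simp [hA, hB, hC, hD]

def Adm {m n : ℕ} (X : Finset (Fin m)) (E : (Fin m → Fin (n+1)) × (Fin m → Fin (n+1))) : Prop :=
  (∀ i ∈ X, E.1 i ≠ Fin.last n ∧ E.2 i = Fin.last n) ∧
  (∀ i, i ∉ X → E.1 i ≠ Fin.last n ∧ E.2 i ≠ Fin.last n)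

theorem occ_prod {m n : ℕ} (p : Fin m → Fin (n+1) → ℝ) (d : ℕ) (X S R : Finset (Fin m))
    (hS : S ⊆ X) (hR : R ⊆ Finset.univ \ X) :
    wOcc p d S * wOcc p d (X \ S) =
      ∑ E : (Fin m → Fin (n+1)) × (Fin m → Fin (n+1)),
        (if Adm X E then urnWeight p E.1 * urnWeight p E.2 else 0) *
        (if Val (X ∪ (Finset.univ \ X)) (fun i => (E.1 i, E.2 i))
          (Finset.univ.filter fun j : Fin (n+1) => (j : ℕ) < d) (S ∪ R) then 1 else 0) := by
  unfold wOcc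
  rw [Finset.sum_mul_sum, ← Finset.sum_product', Finset.univ_product_univ,
    ← Equiv.sum_comp (swp_invol (S ∪ R)).toPerm]
  refine Finset.sum_congr rfl fun E _ => ?_
  rw [Function.Involutive.coe_toPerm]
  rw [← swp_weight p (S ∪ R) E]
  have hadm : Adm X E ↔ (∀ i, (swp (S ∪ R) E).1 i = Fin.last n ↔ i ∈ S) ∧
      (∀ i, (swp (S ∪ R) E).2 i = Fin.last n ↔ i ∈ X \ S) := by
    unfold Adm
    rw [← forall_and, ← forall_and]
    refine forall_congr' fun i => ?_
    have q1 := @hS i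
    have q2 := @hR i
    simp only [Finset.mem_sdiff, Finset.mem_univ, true_and] at q2
    by_cases x1 : i ∈ S
    · have x3 := q1 x1
      simp [swp, x1, x3, and_comm]
    · by_cases x2 : i ∈ R
      · have x3 := q2 x2
        simp [swp, x1, x2, x3, and_comm]
      · by_cases x3 : i ∈ X <;> simp [swp, x1, x2, x3]
  have hval : Val (X ∪ (Finset.univ \ X)) (fun i => (E.1 i, E.2 i))
      (Finset.univ.filter fun j : Fin (n+1) => (j : ℕ) < d) (S ∪ R) ↔
      (∀ j : Fin (n+1), (j : ℕ) < d → 1 ≤ ballCount (swp (S ∪ R) E).1 j) ∧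
      (∀ j : Fin (n+1), (j : ℕ) < d → 1 ≤ ballCount (swp (S ∪ R) E).2 j) := by
    constructor
    · intro h
      constructor
      · intro j hj
        obtain ⟨i, _, hi⟩ := h j (by simpa using hj) true
        rw [one_le_ballCount]
        refine ⟨i, ?_⟩
        by_cases hU : i ∈ S ∪ R
        · simp only [swp, if_pos hU]; simpa only [vsd, vend, if_pos hU, Bool.not_true, Bool.not_false, Bool.false_eq_true, reduceIte] using hi
        · simp only [swp, if_neg hU]; simpa only [vsd, vend, if_neg hU, Bool.not_true, Bool.not_false, Bool.false_eq_true, reduceIte] using hi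
      · intro j hj
        obtain ⟨i, _, hi⟩ := h j (by simpa using hj) false
        rw [one_le_ballCount]
        refine ⟨i, ?_⟩
        by_cases hU : i ∈ S ∪ R
        · simp only [swp, if_pos hU]; simpa only [vsd, vend, if_pos hU, Bool.not_true, Bool.not_false, Bool.false_eq_true, reduceIte] using hi
        · simp only [swp, if_neg hU]; simpa only [vsd, vend, if_neg hU, Bool.not_true, Bool.not_false, Bool.false_eq_true, reduceIte] using hi
    · rintro ⟨h1, h2⟩ j hj b
      have hj' : (j : ℕ) < d := by simpa using hj
      cases b
      · obtain ⟨i, hi⟩ := (one_le_ballCount _ _).mp (h2 j hj')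
        refine ⟨i, by simp, ?_⟩
        by_cases hU : i ∈ S ∪ R
        · simp only [swp, if_pos hU] at hi; simpa only [vsd, vend, if_pos hU, Bool.not_true, Bool.not_false, Bool.false_eq_true, reduceIte] using hi
        · simp only [swp, if_neg hU] at hi; simpa only [vsd, vend, if_neg hU, Bool.not_true, Bool.not_false, Bool.false_eq_true, reduceIte] using hi
      · obtain ⟨i, hi⟩ := (one_le_ballCount _ _).mp (h1 j hj')
        refine ⟨i, by simp, ?_⟩
        by_cases hU : i ∈ S ∪ R
        · simp only [swp, if_pos hU] at hi; simpa only [vsd, vend, if_pos hU, Bool.not_true, Bool.not_false, Bool.false_eq_true, reduceIte] using hi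
        · simp only [swp, if_neg hU] at hi; simpa only [vsd, vend, if_neg hU, Bool.not_true, Bool.not_false, Bool.false_eq_true, reduceIte] using hi
  rw [ite_one_congr hval]
  have h3 : ∀ a : ℝ, (if Adm X E then a else 0) =
      if (∀ i, (swp (S ∪ R) E).1 i = Fin.last n ↔ i ∈ S) ∧
      (∀ i, (swp (S ∪ R) E).2 i = Fin.last n ↔ i ∈ X \ S) then a else 0 := by
    intro a
    by_cases h : Adm X E
    · rw [if_pos h, if_pos (hadm.mp h)]
    · rw [if_neg h, if_neg (fun h' => h (hadm.mpr h'))]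
  rw [h3]
  exact ite_shuffle _ _ _ _ _ _

theorem HX_NMPB_occ (m n : ℕ) (p : Fin m → Fin (n+1) → ℝ)
    (hp : ∀ i j, 0 ≤ p i j) (hsum : ∀ i, ∑ j, p i j = 1)
    (d : ℕ) (hd : d ≤ n)
    (X : Finset (Fin m)) (k : ℕ) (hX : X.card = 2 * k + 1) :
    NMPB X k (fun S => wOcc p d S * wOcc p d (X \ S)) := by
  have hpos : (0:ℝ) < ((Finset.univ \ X).powerset.card : ℝ) := by
    rw [Finset.card_powerset]; positivity
  have main : NMPB X k (fun S => ((Finset.univ \ X).powerset.card : ℝ)⁻¹ *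
      ∑ E : (Fin m → Fin (n+1)) × (Fin m → Fin (n+1)),
        (if Adm X E then urnWeight p E.1 * urnWeight p E.2 else 0) *
        cnt X (Finset.univ \ X) (fun i => (E.1 i, E.2 i))
          (Finset.univ.filter fun j : Fin (n+1) => (j : ℕ) < d) S) := by
    refine NMPB.smul' (inv_nonneg.mpr hpos.le) (NMPB.sum' _ _ fun E _ => ?_)
    by_cases hE : Adm X E
    · rw [if_pos hE]
      refine NMPB.smul' (mul_nonneg (urnWeight_nonneg hp _) (urnWeight_nonneg hp _))
        (core_nmpb X k hX _ _ _ Finset.disjoint_sdiff ?_)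
      intro x hx
      simp [(hE.1 x hx).2, hd]
    · simp only [if_neg hE, zero_mul]
      exact NMPB.zero' X k
  refine main.congr' ?_
  intro S hS
  rw [inv_mul_eq_iff_eq_mul₀ hpos.ne']
  unfold cnt
  simp only [Finset.mul_sum]
  rw [Finset.sum_comm, ← nsmul_eq_mul, ← Finset.sum_const]
  refine Finset.sum_congr rfl fun R hR => ?_
  rw [occ_prod p d X S R hS (Finset.mem_powerset.mp hR)]

end
end

section
/- (Proposition 2.3) Let X ⊆ [m] be a set of odd size |X| = 2k+1, let d ∈ {0,1,…,n−1}, and let a = (a_1,…,a_d) ∈ ℕ^d. Define the weight g(S) = w_a(S) · w_a(X∖S) for S ⊆ X (this is proportional to ν_a(S)ν_a(X∖S)). Then the bipartite graph H_X with the weight function g satisfies the normalized matching property (NMP-B): there exists ω : F → ℝ≥0 such that for every vertex U of H_X, the sum of ω(e) over edges e of H_X incident to U equals g(U). -/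
/-!
(Proposition 2.3) The bipartite graph `H_X` with the weight
`g(S) = w_a(S) · w_a(X∖S)` satisfies the normalized matching property (NMP-B).
The urn model has `n+1` urns (so `d` ranges over `{0,…,n}`), the distinguished
urn being the last one, `Fin.last n`.
-/

open Finset
open scoped Classical

noncomputable section

/-- `w_a(Z)`: total weight of assignments `σ` with `σ⁻¹(last urn) = Z` and with
urn `j` containing exactly `a_j` balls for each of the first `d` urns. -/
def wBall {m n : ℕ} (p : Fin m → Fin (n+1) → ℝ) {d : ℕ} (a : Fin d → ℕ)
    (Z : Finset (Fin m)) : ℝ :=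
  ∑ σ : Fin m → Fin (n+1),
    if (∀ i : Fin m, σ i = Fin.last n ↔ i ∈ Z) ∧
        (∀ j : Fin (n+1), ∀ h : (j : ℕ) < d, ballCount σ j = a ⟨(j : ℕ), h⟩) then
      urnWeight p σ else 0

lemma NMPB_congr {m : ℕ} {X : Finset (Fin m)} {k : ℕ} {g g' : Finset (Fin m) → ℝ}
    (h : ∀ S, S ⊆ X → g S = g' S) (hg : NMPB X k g) : NMPB X k g' := by
  obtain ⟨ω, h0, h1, h2⟩ := hg
  refine ⟨ω, h0, ?_, ?_⟩
  · intro S hS hc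
    rw [h1 S hS hc, h S hS]
  · intro S hS hc
    rw [h2 S hS hc, h S hS]

lemma NMPB_sum {m : ℕ} {X : Finset (Fin m)} {k : ℕ} {ι : Type*} (s : Finset ι)
    (c : ι → ℝ) (g : ι → Finset (Fin m) → ℝ) (hc : ∀ i, 0 ≤ c i)
    (hg : ∀ i ∈ s, NMPB X k (g i)) : NMPB X k (fun S => ∑ i ∈ s, c i * g i S) := by
  have hg' : ∀ i, ∃ ω : Finset (Fin m) → Finset (Fin m) → ℝ, i ∈ s →
    ((∀ S T, 0 ≤ ω S T) ∧
    (∀ S : Finset (Fin m), S ⊆ X → S.card = k →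
      (∑ T ∈ Finset.univ.filter
          (fun T : Finset (Fin m) => T ⊆ X ∧ T.card = k + 1 ∧ S ⊆ T), ω S T) = g i S) ∧
    (∀ T : Finset (Fin m), T ⊆ X → T.card = k + 1 →
      (∑ S ∈ Finset.univ.filter
          (fun S : Finset (Fin m) => S ⊆ X ∧ S.card = k ∧ S ⊆ T), ω S T) = g i T)) := by
    intro i
    by_cases hi : i ∈ s
    · obtain ⟨ω, h⟩ := hg i hi
      exact ⟨ω, fun _ => h⟩
    · exact ⟨fun _ _ => 0, fun h => absurd h hi⟩
  choose ω hω using hg'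
  refine ⟨fun S T => ∑ i ∈ s, c i * ω i S T, ?_, ?_, ?_⟩
  · intro S T
    exact Finset.sum_nonneg fun i hi => mul_nonneg (hc i) ((hω i hi).1 S T)
  · intro S hS hk
    rw [Finset.sum_comm]
    refine Finset.sum_congr rfl fun i hi => ?_
    rw [← Finset.mul_sum, (hω i hi).2.1 S hS hk]
  · intro S hS hk
    rw [Finset.sum_comm]
    refine Finset.sum_congr rfl fun i hi => ?_
    rw [← Finset.mul_sum, (hω i hi).2.2 S hS hk]

/-- abstract flipping lemma -/
lemma NMPB_flip {m : ℕ} {X : Finset (Fin m)} {k : ℕ} (hX : X.card = 2 * k + 1)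
    {α : Type*} (Ω : Finset α) (out : α → Finset (Fin m)) (U : Finset (Fin m)) (hU : U ⊆ X)
    (hbal : ∀ s ∈ Ω, 2 * (out s ∩ (X \ U)).card = (X \ U).card)
    (flip : Fin m → α → α)
    (hf1 : ∀ x ∈ U, ∀ s ∈ Ω, flip x s ∈ Ω)
    (hf2 : ∀ x ∈ U, ∀ s ∈ Ω, ∀ i, i ∈ out (flip x s) ↔ (if i = x then i ∉ out s else i ∈ out s))
    (hf3 : ∀ x ∈ U, ∀ s ∈ Ω, flip x (flip x s) = s) :
    NMPB X k (fun S => ((Ω.filter fun s => out s = S).card : ℝ)) := by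
  set N : Finset (Fin m) → ℕ := fun S => (Ω.filter fun s => out s = S).card with hN
  have hNflip : ∀ x ∈ U, ∀ S, x ∉ S → N (insert x S) = N S := by
    intro x hx S hxS
    refine Finset.card_bij' (fun s _ => flip x s) (fun s _ => flip x s) ?_ ?_ ?_ ?_
    · intro s hs
      simp only [Finset.mem_filter] at hs ⊢
      refine ⟨hf1 x hx s hs.1, ?_⟩
      ext i
      rw [hf2 x hx s hs.1, hs.2]
      by_cases hi : i = x
      · subst hi; simp [hxS]
      · simp [hi]
    · intro s hs
      simp only [Finset.mem_filter] at hs ⊢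
      refine ⟨hf1 x hx s hs.1, ?_⟩
      ext i
      rw [hf2 x hx s hs.1, hs.2]
      by_cases hi : i = x
      · subst hi; simp [hxS]
      · simp [hi]
    · intro s hs
      simp only [Finset.mem_filter] at hs
      exact hf3 x hx s hs.1
    · intro s hs
      simp only [Finset.mem_filter] at hs
      exact hf3 x hx s hs.1
  obtain ⟨t, ht⟩ : ∃ t : ℕ, t = U.card / 2 := ⟨_, rfl⟩
  have hcard : ∀ S ⊆ X, N S ≠ 0 → (S ∩ U).card + (X.card - U.card) / 2 = S.card ∧ U.card = 2 * t + 1 ∧ U.card ≤ X.card := by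
    intro S hS hne
    obtain ⟨s, hs⟩ := Finset.card_pos.mp (Nat.pos_of_ne_zero hne)
    simp only [Finset.mem_filter] at hs
    have h1 := hbal s hs.1
    rw [hs.2, Finset.card_sdiff_of_subset hU] at h1
    have h2 : S ∩ (X \ U) = S \ U := by
      ext i; simp only [Finset.mem_inter, Finset.mem_sdiff]
      constructor
      · tauto
      · intro h; exact ⟨h.1, hS h.1, h.2⟩
    rw [h2] at h1
    have h3 := Finset.card_inter_add_card_sdiff S U
    have h4 := Finset.card_le_card hU
    omega
  refine ⟨fun S T => if T \ S ⊆ U then (N S : ℝ) / (t + 1) else 0, ?_, ?_, ?_⟩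
  · intro S T
    dsimp only
    split_ifs <;> positivity
  · intro S hS hk
    show _ = (N S : ℝ)
    have e1 : (∑ T ∈ Finset.univ.filter
          (fun T : Finset (Fin m) => T ⊆ X ∧ T.card = k + 1 ∧ S ⊆ T),
          if T \ S ⊆ U then (N S : ℝ) / (t + 1) else 0) =
        ∑ x ∈ X \ S, if x ∈ U then (N S : ℝ) / (t + 1) else 0 := by
      symm
      refine Finset.sum_bij (fun x _ => insert x S) ?_ ?_ ?_ ?_
      · intro x hx
        simp only [Finset.mem_sdiff] at hx
        simp only [Finset.mem_filter, Finset.mem_univ, true_and]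
        exact ⟨Finset.insert_subset hx.1 hS, by rw [Finset.card_insert_of_notMem hx.2, hk],
          Finset.subset_insert _ _⟩
      · intro x hx y hy hxy
        simp only [Finset.mem_sdiff] at hx hy
        have : x ∈ insert y S := by
          rw [← hxy]; exact Finset.mem_insert_self _ _
        rcases Finset.mem_insert.mp this with h | h
        · exact h
        · exact absurd h hx.2
      · intro T hT
        simp only [Finset.mem_filter, Finset.mem_univ, true_and] at hT
        have h1 : (T \ S).card = 1 := by
          rw [Finset.card_sdiff_of_subset hT.2.2]; omega
        obtain ⟨x, hx⟩ := Finset.card_eq_one.mp h1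
        have hxT : x ∈ T \ S := by rw [hx]; simp
        simp only [Finset.mem_sdiff] at hxT
        refine ⟨x, by simp [hT.1 hxT.1, hxT.2], ?_⟩
        rw [← Finset.union_sdiff_of_subset hT.2.2, hx]
        ext i; simp
      · intro x hx
        simp only [Finset.mem_sdiff] at hx
        rw [Finset.insert_sdiff_of_notMem _ hx.2]
        simp
    rw [e1, ← Finset.sum_filter, Finset.sum_const, nsmul_eq_mul]
    by_cases hz : N S = 0
    · simp [hz]
    · obtain ⟨h1, h2, h3⟩ := hcard S hS hz
      have h4 : ((X \ S).filter (fun x => x ∈ U)) = U \ S := by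
        ext i; simp only [Finset.mem_filter, Finset.mem_sdiff]
        constructor
        · tauto
        · intro h; exact ⟨⟨hU h.1, h.2⟩, h.1⟩
      have h5 := Finset.card_inter_add_card_sdiff U S
      rw [Finset.inter_comm] at h5
      have h6 : (U \ S).card = t + 1 := by omega
      rw [h4, h6]
      push_cast
      field_simp
  · intro T hT hk
    show _ = (N T : ℝ)
    have e1 : (∑ S ∈ Finset.univ.filter
          (fun S : Finset (Fin m) => S ⊆ X ∧ S.card = k ∧ S ⊆ T),
          if T \ S ⊆ U then (N S : ℝ) / (t + 1) else 0) =
        ∑ x ∈ T, if x ∈ U then (N T : ℝ) / (t + 1) else 0 := by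
      symm
      refine Finset.sum_bij (fun x _ => T.erase x) ?_ ?_ ?_ ?_
      · intro x hx
        simp only [Finset.mem_filter, Finset.mem_univ, true_and]
        exact ⟨(Finset.erase_subset _ _).trans hT, by rw [Finset.card_erase_of_mem hx, hk]; rfl,
          Finset.erase_subset _ _⟩
      · intro x hx y hy hxy
        by_contra hne
        have : x ∈ T.erase y := Finset.mem_erase.mpr ⟨hne, hx⟩
        rw [← hxy] at this
        simp at this
      · intro S hS
        simp only [Finset.mem_filter, Finset.mem_univ, true_and] at hS
        have h1 : (T \ S).card = 1 := by
          rw [Finset.card_sdiff_of_subset hS.2.2]; omega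
        obtain ⟨x, hx⟩ := Finset.card_eq_one.mp h1
        have hxT : x ∈ T \ S := by rw [hx]; simp
        simp only [Finset.mem_sdiff] at hxT
        refine ⟨x, hxT.1, ?_⟩
        rw [Finset.erase_eq, ← hx, Finset.sdiff_sdiff_eq_self hS.2.2]
      · intro x hx
        have h1 : T \ T.erase x = {x} := by
          rw [Finset.erase_eq, Finset.sdiff_sdiff_eq_self (by simpa using hx)]
        rw [h1]
        by_cases hxU : x ∈ U
        · have := hNflip x hxU (T.erase x) (by simp)
          rw [Finset.insert_erase hx] at this
          simp [hxU, this]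
        · simp [hxU]
    rw [e1, ← Finset.sum_filter, Finset.sum_const, nsmul_eq_mul]
    by_cases hz : N T = 0
    · simp [hz]
    · obtain ⟨h1, h2, h3⟩ := hcard T hT hz
      have h4 : (T.filter (fun x => x ∈ U)) = T ∩ U := by
        ext i; simp
      have h6 : (T ∩ U).card = t + 1 := by omega
      rw [h4, h6]
      push_cast
      field_simp

/-- graph whose edges are given by two maps -/
def twoGraph {V : Type*} (e P : V → V) : SimpleGraph V :=
  SimpleGraph.fromRel (fun f g => g = e f ∨ g = P f)

lemma twoGraph_adj {V : Type*} {e P : V → V} (he : ∀ f, e (e f) = f) (hP : ∀ f, P (P f) = f)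
    {f g : V} : (twoGraph e P).Adj f g ↔ f ≠ g ∧ (g = e f ∨ g = P f) := by
  unfold twoGraph
  rw [SimpleGraph.fromRel_adj]
  refine and_congr_right fun _ => ⟨?_, fun h => Or.inl h⟩
  rintro (h | h | h)
  · exact h
  · left; rw [h, he]
  · right; rw [h, hP]

lemma three_fixed {V : Type*} [Fintype V] (e P : V → V) (he : ∀ f, e (e f) = f)
    (hP : ∀ f, P (P f) = f) (x y z : V) (hx : P x = x) (hy : P y = y) (hz : P z = z)
    (hxy : x ≠ y) (hxz : x ≠ z) (hyz : y ≠ z)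
    (h1 : (twoGraph e P).Reachable x y) (h2 : (twoGraph e P).Reachable x z) : False := by
  set c := (twoGraph e P).connectedComponentMk x with hc
  let H := c.toSimpleGraph
  have hconn : H.Connected := c.connected_toSimpleGraph
  have hcount := hconn.card_vert_le_card_edgeSet_add_one
  have hsum := H.sum_degrees_eq_twice_card_edges
  have hdeg : ∀ v : c, (H.degree v : ℕ) + (if P v.1 = v.1 then 1 else 0) ≤ 2 := by
    intro v
    have hadj : ∀ w : c, H.Adj v w → v.1 ≠ w.1 ∧ (w.1 = e v.1 ∨ w.1 = P v.1) := by
      intro w hw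
      have : (twoGraph e P).Adj v.1 w.1 := hw
      exact (twoGraph_adj he hP).1 this
    have himg : H.degree v = ((H.neighborFinset v).image Subtype.val).card := by
      rw [Finset.card_image_of_injective _ Subtype.val_injective, H.card_neighborFinset_eq_degree]
    rw [himg]
    split_ifs with hv
    · have : ((H.neighborFinset v).image Subtype.val) ⊆ {e v.1} := by
        intro w hw
        obtain ⟨w', hw', rfl⟩ := Finset.mem_image.mp hw
        have := hadj w' ((H.mem_neighborFinset v w').1 hw')
        rw [hv] at this
        simp only [Finset.mem_singleton]
        rcases this.2 with h | h
        · exact h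
        · exact absurd h.symm this.1
      have := Finset.card_le_card this
      simp at this
      omega
    · have : ((H.neighborFinset v).image Subtype.val) ⊆ {e v.1, P v.1} := by
        intro w hw
        obtain ⟨w', hw', rfl⟩ := Finset.mem_image.mp hw
        have := hadj w' ((H.mem_neighborFinset v w').1 hw')
        simp only [Finset.mem_insert, Finset.mem_singleton]
        exact this.2
      have := (Finset.card_le_card this).trans Finset.card_le_two
      omega
  have hs2 := Finset.sum_le_sum (fun v (_ : v ∈ (Finset.univ : Finset c)) => hdeg v)
  rw [Finset.sum_add_distrib, hsum] at hs2
  have hs3 : 3 ≤ ∑ v : c, (if P v.1 = v.1 then 1 else 0) := by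
    rw [← Finset.card_filter]
    let x' : c := ⟨x, rfl⟩
    let y' : c := ⟨y, SimpleGraph.ConnectedComponent.sound h1.symm⟩
    let z' : c := ⟨z, SimpleGraph.ConnectedComponent.sound h2.symm⟩
    have : ({x', y', z'} : Finset c) ⊆ Finset.univ.filter (fun v : c => P v.1 = v.1) := by
      intro w hw
      simp only [Finset.mem_insert, Finset.mem_singleton] at hw
      simp only [Finset.mem_filter, Finset.mem_univ, true_and]
      rcases hw with rfl | rfl | rfl
      · exact hx
      · exact hy
      · exact hz
    refine le_trans ?_ (Finset.card_le_card this)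
    rw [Finset.card_eq_three.mpr ⟨x', y', z', ?_, ?_, ?_, rfl⟩]
    · exact fun h => hxy (congrArg Subtype.val h)
    · exact fun h => hxz (congrArg Subtype.val h)
    · exact fun h => hyz (congrArg Subtype.val h)
  simp only [Finset.sum_const, Finset.card_univ, smul_eq_mul] at hs2
  rw [Nat.card_eq_fintype_card, Nat.card_eq_fintype_card, ← SimpleGraph.edgeFinset_card] at hcount
  omega

lemma exists_perm_of_fibers {V K : Type*} [Fintype V] (f g : V → K)
    (h : ∀ y, (Finset.univ.filter fun v => f v = y).card = (Finset.univ.filter fun v => g v = y).card) :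
    ∃ θ : Equiv.Perm V, ∀ v, f (θ v) = g v := by
  have : ∀ y, Nonempty ({v // g v = y} ≃ {v // f v = y}) := by
    intro y
    refine ⟨Fintype.equivOfCardEq ?_⟩
    rw [Fintype.card_subtype, Fintype.card_subtype, h]
  refine ⟨Equiv.ofFiberEquiv (fun y => (this y).some), fun v => ?_⟩
  exact Equiv.ofFiberEquiv_map _ v

def eF {m : ℕ} (f : Fin m × Bool) : Fin m × Bool := (f.1, !f.2)

def oF {m : ℕ} (s : Fin m → Bool) (f : Fin m × Bool) : Bool := xor f.2 (s f.1)

lemma eF_eF {m : ℕ} (f : Fin m × Bool) : eF (eF f) = f := by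
  simp [eF]

lemma oF_eF {m : ℕ} (s : Fin m → Bool) (f : Fin m × Bool) : oF s (eF f) = !oF s f := by
  simp [eF, oF]

lemma reach_left {V : Type*} {e P : V → V} (he : ∀ f, e (e f) = f) (hP : ∀ f, P (P f) = f)
    (f : V) : (twoGraph e P).Reachable f (e f) := by
  by_cases h : f = e f
  · rw [← h]
  · exact SimpleGraph.Adj.reachable ((twoGraph_adj he hP).2 ⟨h, Or.inl rfl⟩)

lemma reach_right {V : Type*} {e P : V → V} (he : ∀ f, e (e f) = f) (hP : ∀ f, P (P f) = f)
    (f : V) : (twoGraph e P).Reachable f (P f) := by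
  by_cases h : f = P f
  · rw [← h]
  · exact SimpleGraph.Adj.reachable ((twoGraph_adj he hP).2 ⟨h, Or.inr rfl⟩)

def Cons {V : Type*} (o : V → Bool) (P : V → V) : Prop := ∀ f, P f ≠ f → o (P f) = !o f

set_option maxHeartbeats 1000000 in
lemma NMPB_core {m : ℕ} {X : Finset (Fin m)} {k : ℕ} (hX : X.card = 2 * k + 1)
    (P : Fin m × Bool → Fin m × Bool) (hP : ∀ f, P (P f) = f) (L : Fin m × Bool → Prop)
    (hL : ∀ f, L f → P f = f)
    (hQ1 : ∀ i, (L (i, false) ∨ L (i, true)) ↔ i ∈ X)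
    (hQ2 : ∀ i, ¬ (L (i, false) ∧ L (i, true)))
    (Ω : Finset (Fin m → Bool)) (hΩ : ∀ s, s ∈ Ω ↔ Cons (oF s) P)
    (out : (Fin m → Bool) → Finset (Fin m)) (hout : ∀ s i, i ∈ out s ↔ L (i, s i)) :
    NMPB X k (fun S => ((Ω.filter fun s => out s = S).card : ℝ)) := by
  set R := (twoGraph eF P).Reachable with hR
  have Re : ∀ f, R f (eF f) := reach_left eF_eF hP
  have RP : ∀ f, R f (P f) := reach_right eF_eF hP
  have Rs : ∀ {f g}, R f g → R g f := fun h => SimpleGraph.Reachable.symm h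
  have Rt : ∀ {f g h}, R f g → R g h → R f h := fun h h' => SimpleGraph.Reachable.trans h h'
  have Rb : ∀ i b b', R (i, b) (i, b') := by
    intro i b b'
    by_cases h : b = b'
    · subst h; exact SimpleGraph.Reachable.refl _
    · have := Re (i, b)
      have h2 : eF (i, b) = (i, b') := by
        cases b <;> cases b' <;> simp_all [eF]
      rwa [h2] at this
  have hQ3 : ∀ i ∈ X, ∀ b, L (i, !b) ↔ ¬ L (i, b) := by
    intro i hi b
    have h1 := (hQ1 i).2 hi
    have h2 := hQ2 i
    cases b <;> simp only [Bool.not_true, Bool.not_false] <;> tauto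
  have hQ4 : ∀ i, i ∉ X → ∀ b, ¬ L (i, b) := by
    intro i hi b
    have h1 := mt (hQ1 i).1 hi
    cases b <;> tauto
  have hQ5 : ∀ i ∈ X, ∃ b, L (i, b) := by
    intro i hi
    rcases (hQ1 i).2 hi with h | h
    · exact ⟨_, h⟩
    · exact ⟨_, h⟩
  refine NMPB_flip hX Ω out
    (X.filter fun x => ∃ y, P y = y ∧ ¬ L y ∧ R (x, false) y) (Finset.filter_subset _ _) ?_
    (fun x s i => if R (x, false) (i, false) then !s i else s i) ?_ ?_ ?_
  · intro s hs
    rw [hΩ] at hs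
    set Y := X \ (X.filter fun x => ∃ y, P y = y ∧ ¬ L y ∧ R (x, false) y) with hY
    have memY : ∀ i, i ∈ Y ↔ i ∈ X ∧ ∀ y, P y = y → ¬ L y → ¬ R (i, false) y := by
      intro i
      simp only [hY, Finset.mem_sdiff, Finset.mem_filter]
      push Not
      constructor
      · intro h; exact ⟨h.1, fun y a b => h.2 h.1 y a b⟩
      · intro h; exact ⟨h.1, fun _ => h.2⟩
    let C : Finset (Fin m × Bool) :=
      Finset.univ.filter fun f => ∀ y, P y = y → ¬ L y → ¬ R f y
    have memC : ∀ f, f ∈ C ↔ ∀ y, P y = y → ¬ L y → ¬ R f y := by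
      intro f; simp [C]
    have Ctrans : ∀ f g, R f g → f ∈ C → g ∈ C := by
      intro f g h hf
      rw [memC] at hf ⊢
      intro y a b c
      exact hf y a b (Rt h c)
    let sg : Fin m × Bool → ℤ := fun f => if oF s f then 1 else -1
    have S1 : ∑ f ∈ C, sg f = 0 := by
      refine Finset.sum_involution (fun f _ => eF f) ?_ ?_ ?_ ?_
      · intro f _
        simp only [sg, oF_eF]
        cases oF s f <;> simp
      · intro f _ _ h
        have := congrArg Prod.snd h
        simp [eF] at this
      · intro f hf
        exact Ctrans _ _ (Re f) hf
      · intro f _; exact eF_eF f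
    have S2 : ∑ f ∈ C.filter (fun f => ¬ P f = f), sg f = 0 := by
      refine Finset.sum_involution (fun f _ => P f) ?_ ?_ ?_ ?_
      · intro f hf
        have := hs f (Finset.mem_filter.1 hf).2
        simp only [sg, this]
        cases oF s f <;> simp
      · intro f hf _ h
        exact (Finset.mem_filter.1 hf).2 h
      · intro f hf
        have h := Finset.mem_filter.1 hf
        refine Finset.mem_filter.2 ⟨Ctrans _ _ (RP f) h.1, ?_⟩
        rw [hP]
        exact fun h' => h.2 h'.symm
      · intro f _; exact hP f
    have S3 : ∑ f ∈ C.filter (fun f => P f = f), sg f = 0 := by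
      have := Finset.sum_filter_add_sum_filter_not C (fun f => P f = f) sg
      linarith
    have S4 : ∑ f ∈ C.filter (fun f => P f = f), sg f =
        ∑ i ∈ Y, (if L (i, s i) then (-1 : ℤ) else 1) := by
      symm
      refine Finset.sum_bij' (fun i _ => (i, if L (i, s i) then s i else !s i))
        (fun f _ => f.1) ?_ ?_ ?_ ?_ ?_
      · intro i hi
        rw [memY] at hi
        refine Finset.mem_filter.2 ⟨?_, ?_⟩
        · refine Ctrans (i, false) _ (Rb _ _ _) ?_
          rw [memC]; exact hi.2
        · apply hL
          split_ifs with h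
          · exact h
          · exact (hQ3 i hi.1 _).2 h
      · intro f hf
        have h := Finset.mem_filter.1 hf
        have hLf : L f := by
          by_contra hn
          exact (memC f).1 h.1 f h.2 hn (SimpleGraph.Reachable.refl _)
        rw [memY]
        constructor
        · by_contra hn
          exact hQ4 f.1 hn f.2 hLf
        · exact (memC _).1 (Ctrans f (f.1, false) (Rb f.1 f.2 false) h.1)
      · intro i _; rfl
      · intro f hf
        have h := Finset.mem_filter.1 hf
        have hLf : L f := by
          by_contra hn
          exact (memC f).1 h.1 f h.2 hn (SimpleGraph.Reachable.refl _)
        have hfX : f.1 ∈ X := by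
          by_contra hn
          exact hQ4 f.1 hn f.2 hLf
        obtain ⟨i, b⟩ := f
        have h3 := hQ3 i hfX b
        simp only
        congr 1
        by_cases hb : s i = b
        · rw [hb]; simp [hLf]
        · have hb' : s i = !b := by
            clear * - hb
            cases b <;> simpa using hb
          rw [hb']
          rw [if_neg (by rw [h3]; exact not_not.2 hLf), Bool.not_not]
      · intro i hi
        have o1 : ¬ oF s (i, s i) = true := by simp [oF]
        have o2 : oF s (i, !s i) = true := by simp [oF]
        simp only [sg]
        by_cases h : L (i, s i)
        · rw [if_pos h, if_pos h, if_neg o1]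
        · rw [if_neg h, if_neg h, if_pos o2]
    rw [S3] at S4
    have e1 : out s ∩ Y = Y.filter (fun i => L (i, s i)) := by
      ext i; simp [and_comm, hout]
    rw [e1]
    have e2 := Finset.card_filter_add_card_filter_not (s := Y) (fun i => L (i, s i))
    rw [Finset.sum_ite] at S4
    simp only [Finset.sum_const, nsmul_eq_mul, mul_one, mul_neg] at S4
    omega
  · intro x hx s hs
    rw [hΩ] at hs ⊢
    have key : ∀ f, oF (fun i => if R (x, false) (i, false) then !s i else s i) f =
        if R (x, false) f then !oF s f else oF s f := by
      intro f
      have : R (x, false) (f.1, false) ↔ R (x, false) f :=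
        ⟨fun h => Rt h (Rb f.1 false f.2), fun h => Rt h (Rb f.1 f.2 false)⟩
      simp only [oF, this]
      split_ifs <;> simp
    intro f hf
    have : R (x, false) (P f) ↔ R (x, false) f :=
      ⟨fun h => Rt h (Rs (RP f)), fun h => Rt h (RP f)⟩
    rw [key, key, hs f hf]
    simp only [this]
    split_ifs <;> simp
  · intro x hx s hs i
    simp only [Finset.mem_filter] at hx
    simp only [hout]
    obtain ⟨hxX, y, hy1, hy2, hy3⟩ := hx
    by_cases hix : i = x
    · subst hix
      rw [if_pos rfl, if_pos (SimpleGraph.Reachable.refl _)]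
      exact hQ3 i hxX _
    · rw [if_neg hix]
      split_ifs with h
      · by_cases hiX : i ∈ X
        · exfalso
          obtain ⟨b, hb⟩ := hQ5 i hiX
          obtain ⟨c, hc⟩ := hQ5 x hxX
          refine three_fixed eF P eF_eF hP (x, c) (i, b) y (hL _ hc) (hL _ hb) hy1 ?_ ?_ ?_ ?_ ?_
          · intro h; exact hix (congrArg Prod.fst h).symm
          · intro h; rw [h] at hc; exact hy2 hc
          · intro h; rw [h] at hb; exact hy2 hb
          · exact Rt (Rt (Rb x c false) h) (Rb i false b)
          · exact Rt (Rb x c false) hy3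
        · have := hQ4 i hiX
          simp [this]
      · rfl
  · intro x hx s hs
    funext i
    dsimp only
    split_ifs <;> simp

lemma perm_of_bal {V : Type*} [Fintype V] {n : ℕ} (ℓ : V → Fin n) (d : ℕ) (o o' : V → Bool)
    (h : ∀ j : Fin n, (j : ℕ) < d → ∀ b, (Finset.univ.filter fun f => ℓ f = j ∧ o f = b).card =
      (Finset.univ.filter fun f => ℓ f = j ∧ o' f = b).card) :
    ∃ θ : Equiv.Perm V, ∀ f, ℓ (θ f) = ℓ f ∧ ((ℓ f : ℕ) < d → o (θ f) = o' f) := by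
  obtain ⟨θ, hθ⟩ := exists_perm_of_fibers
    (fun f => (ℓ f, if (ℓ f : ℕ) < d then o f else false))
    (fun f => (ℓ f, if (ℓ f : ℕ) < d then o' f else false)) (by
      rintro ⟨j, b⟩
      by_cases hj : (j : ℕ) < d
      · have := h j hj b
        convert this using 2
        · ext f
          simp only [Finset.mem_filter, Finset.mem_univ, true_and, Prod.mk.injEq]
          refine and_congr_right fun hf => ?_
          rw [hf, if_pos hj]
        · ext f
          simp only [Finset.mem_filter, Finset.mem_univ, true_and, Prod.mk.injEq]
          refine and_congr_right fun hf => ?_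
          rw [hf, if_pos hj]
      · congr 1
        ext f
        simp only [Finset.mem_filter, Finset.mem_univ, true_and, Prod.mk.injEq]
        refine and_congr_right fun hf => ?_
        rw [hf, if_neg hj, if_neg hj])
  refine ⟨θ, fun f => ?_⟩
  have h1 := hθ f
  simp only [Prod.mk.injEq] at h1
  refine ⟨h1.1, fun hf => ?_⟩
  have h2 := h1.2
  rwa [h1.1, if_pos hf, if_pos hf] at h2

lemma card_flag {m n : ℕ} (ℓ : Fin m × Bool → Fin n) (s : Fin m → Bool) (j : Fin n) (b : Bool) :
    (Finset.univ.filter fun i => ℓ (i, xor b (s i)) = j).card =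
    (Finset.univ.filter fun f => ℓ f = j ∧ oF s f = b).card := by
  refine Finset.card_bij' (fun i _ => (i, xor b (s i))) (fun f _ => f.1) ?_ ?_ ?_ ?_
  · intro i hi
    simp only [Finset.mem_filter, Finset.mem_univ, true_and] at hi ⊢
    refine ⟨hi, ?_⟩
    simp [oF]
  · rintro ⟨i, c⟩ hf
    simp only [Finset.mem_filter, Finset.mem_univ, true_and] at hf ⊢
    rw [← hf.2]
    simpa [oF] using hf.1
  · intro i _; rfl
  · rintro ⟨i, c⟩ hf
    simp only [Finset.mem_filter, Finset.mem_univ, true_and] at hf ⊢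
    rw [← hf.2]
    simp [oF]

def pairings {V : Type*} [Fintype V] {n : ℕ} (ℓ : V → Fin n) (d : ℕ) : Finset (V → V) :=
  Finset.univ.filter fun P => (∀ f, P (P f) = f) ∧ (∀ f, ℓ (P f) = ℓ f) ∧
    (∀ f, P f = f ↔ ¬ (ℓ f : ℕ) < d)

lemma pairings_le {V : Type*} [Fintype V] {n : ℕ} (ℓ : V → Fin n) (d : ℕ) (o o' : V → Bool)
    (h : ∀ j : Fin n, (j : ℕ) < d → ∀ b, (Finset.univ.filter fun f => ℓ f = j ∧ o f = b).card =
      (Finset.univ.filter fun f => ℓ f = j ∧ o' f = b).card) :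
    ((pairings ℓ d).filter fun P => Cons o P).card ≤
    ((pairings ℓ d).filter fun P => Cons o' P).card := by
  obtain ⟨θ, hθ⟩ := perm_of_bal ℓ d o o' h
  have hθ' : ∀ f, ℓ (θ.symm f) = ℓ f := by
    intro f
    have := (hθ (θ.symm f)).1
    rw [Equiv.apply_symm_apply] at this
    exact this.symm
  refine Finset.card_le_card_of_injOn (fun P f => θ.symm (P (θ f))) ?_ ?_
  · intro P hP
    simp only [Finset.coe_filter, Set.mem_ofPred_eq, pairings, Finset.mem_filter, Finset.mem_univ,
      true_and] at hP ⊢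
    obtain ⟨⟨h1, h2, h3⟩, h4⟩ := hP
    have h5 : ∀ f, θ.symm (P (θ f)) = f ↔ ¬ (ℓ f : ℕ) < d := by
      intro f
      rw [Equiv.symm_apply_eq, h3, (hθ f).1]
    refine ⟨⟨?_, ?_, h5⟩, ?_⟩
    · intro f; simp [h1]
    · intro f; rw [hθ', h2, (hθ f).1]
    · intro f hf
      have hd : (ℓ f : ℕ) < d := by
        by_contra hn
        exact hf ((h5 f).2 hn)
      have hPf : P (θ f) ≠ θ f := by
        intro h
        exact (h3 _).1 h (by rw [(hθ f).1]; exact hd)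
      have a1 := (hθ (θ.symm (P (θ f)))).2 (by rw [hθ', h2, (hθ f).1]; exact hd)
      rw [Equiv.apply_symm_apply] at a1
      rw [← a1, h4 _ hPf, (hθ f).2 hd]
  · intro P _ P' _ hPP
    funext f
    have := congrFun hPP (θ.symm f)
    simpa using this

lemma pairings_pos {V : Type*} [Fintype V] {n : ℕ} (ℓ : V → Fin n) (d : ℕ) (o : V → Bool)
    (h : ∀ j : Fin n, (j : ℕ) < d → ∀ b, (Finset.univ.filter fun f => ℓ f = j ∧ o f = b).card =
      (Finset.univ.filter fun f => ℓ f = j ∧ (!o f) = b).card) :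
    0 < ((pairings ℓ d).filter fun P => Cons o P).card := by
  obtain ⟨θ, hθ⟩ := perm_of_bal ℓ d o (fun f => !o f) h
  have hθ' : ∀ f, ℓ (θ.symm f) = ℓ f := by
    intro f
    have := (hθ (θ.symm f)).1
    rw [Equiv.apply_symm_apply] at this
    exact this.symm
  have hθ2 : ∀ f, (ℓ f : ℕ) < d → o (θ.symm f) = !o f := by
    intro f hf
    have := (hθ (θ.symm f)).2 (by rw [hθ']; exact hf)
    rw [Equiv.apply_symm_apply] at this
    rw [this]; simp
  let P : V → V := fun f => if (ℓ f : ℕ) < d then (if o f then θ f else θ.symm f) else f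
  have P1 : ∀ f, (ℓ f : ℕ) < d → o f = true → P f = θ f := by
    intro f a b; simp [P, a, b]
  have P2 : ∀ f, (ℓ f : ℕ) < d → o f = false → P f = θ.symm f := by
    intro f a b; simp [P, a, b]
  have P3 : ∀ f, ¬ (ℓ f : ℕ) < d → P f = f := by
    intro f a; simp only [P, if_neg a]
  have hPl : ∀ f, ℓ (P f) = ℓ f := by
    intro f
    by_cases hd : (ℓ f : ℕ) < d
    · cases ho : o f
      · rw [P2 f hd ho, hθ']
      · rw [P1 f hd ho, (hθ f).1]
    · rw [P3 f hd]
  have hPo : ∀ f, (ℓ f : ℕ) < d → o (P f) = !o f := by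
    intro f hd
    cases ho : o f
    · rw [P2 f hd ho, hθ2 f hd, ho]
    · rw [P1 f hd ho, (hθ f).2 hd, ho]
  apply Finset.card_pos.mpr
  refine ⟨P, ?_⟩
  simp only [pairings, Finset.mem_filter, Finset.mem_univ, true_and]
  refine ⟨⟨?_, hPl, ?_⟩, ?_⟩
  · intro f
    by_cases hd : (ℓ f : ℕ) < d
    · have a1 := hPo f hd
      have a2 : (ℓ (P f) : ℕ) < d := by rw [hPl]; exact hd
      cases ho : o f
      · rw [ho] at a1
        rw [P1 _ a2 (by simpa using a1), P2 f hd ho]; simp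
      · rw [ho] at a1
        rw [P2 _ a2 (by simpa using a1), P1 f hd ho]; simp
    · rw [P3 f hd, P3 f hd]
  · intro f
    refine ⟨fun h hd => ?_, P3 f⟩
    have := hPo f hd
    rw [h] at this
    cases ho : o f <;> simp [ho] at this
  · intro f hf
    apply hPo
    by_contra hn
    exact hf (P3 f hn)

lemma NMPB_zero {m : ℕ} {X : Finset (Fin m)} {k : ℕ} : NMPB X k (fun _ => 0) :=
  ⟨fun _ _ => 0, by simp, by simp, by simp⟩

def Bal {m n d : ℕ} (a : Fin d → ℕ) (ℓ : Fin m × Bool → Fin n) (s : Fin m → Bool) : Prop :=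
  ∀ j : Fin n, ∀ h : (j : ℕ) < d, ∀ b,
    (Finset.univ.filter fun f => ℓ f = j ∧ oF s f = b).card = a ⟨(j : ℕ), h⟩

lemma bal_of_cons {m n d : ℕ} (a : Fin d → ℕ) (ℓ : Fin m × Bool → Fin n) (s s0 : Fin m → Bool)
    (h0 : Bal a ℓ s0) (P : Fin m × Bool → Fin m × Bool) (hP : P ∈ pairings ℓ d)
    (hs : Cons (oF s) P) : Bal a ℓ s := by
  simp only [pairings, Finset.mem_filter, Finset.mem_univ, true_and] at hP
  obtain ⟨h1, h2, h3⟩ := hP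
  intro j hj
  have hne : ∀ f, ℓ f = j → P f ≠ f := by
    intro f hf h
    exact (h3 f).1 h (by rw [hf]; exact hj)
  have heq : (Finset.univ.filter fun f => ℓ f = j ∧ oF s f = false).card =
      (Finset.univ.filter fun f => ℓ f = j ∧ oF s f = true).card := by
    refine Finset.card_bij' (fun f _ => P f) (fun f _ => P f) ?_ ?_ ?_ ?_
    · intro f hf
      simp only [Finset.mem_filter, Finset.mem_univ, true_and] at hf ⊢
      refine ⟨by rw [h2]; exact hf.1, ?_⟩
      rw [hs f (hne f hf.1), hf.2]; rfl
    · intro f hf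
      simp only [Finset.mem_filter, Finset.mem_univ, true_and] at hf ⊢
      refine ⟨by rw [h2]; exact hf.1, ?_⟩
      rw [hs f (hne f hf.1), hf.2]; rfl
    · intro f _; exact h1 f
    · intro f _; exact h1 f
  have tot : ∀ t : Fin m → Bool, (Finset.univ.filter fun f => ℓ f = j ∧ oF t f = false).card +
      (Finset.univ.filter fun f => ℓ f = j ∧ oF t f = true).card =
      (Finset.univ.filter fun f => ℓ f = j).card := by
    intro t
    rw [← Finset.card_filter_add_card_filter_not (s := Finset.univ.filter fun f => ℓ f = j)
      (fun f => oF t f = false), Finset.filter_filter, Finset.filter_filter]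
    simp
  have t1 := tot s
  have t2 := tot s0
  have t3 := h0 j hj false
  have t4 := h0 j hj true
  intro b
  cases b <;> omega

lemma NMPB_pair {m n d : ℕ} (hd : d ≤ n) (a : Fin d → ℕ) {X : Finset (Fin m)} {k : ℕ}
    (hX : X.card = 2 * k + 1) (ℓ : Fin m × Bool → Fin (n + 1)) :
    NMPB X k (fun S => ((Finset.univ.filter fun s : Fin m → Bool =>
      ((∀ i, ℓ (i, s i) = Fin.last n ↔ i ∈ S) ∧ (∀ i, ℓ (i, !s i) = Fin.last n ↔ i ∈ X \ S)) ∧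
        Bal a ℓ s).card : ℝ)) := by
  by_cases h0 : ∃ s0, Bal a ℓ s0
  swap
  · refine NMPB_congr ?_ NMPB_zero
    intro S _
    symm
    rw [Nat.cast_eq_zero, Finset.card_eq_zero, Finset.filter_eq_empty_iff]
    intro s _ h
    exact h0 ⟨s, h.2⟩
  obtain ⟨s0, h0⟩ := h0
  by_cases hQ : (∀ i, (ℓ (i, false) = Fin.last n ∨ ℓ (i, true) = Fin.last n) ↔ i ∈ X) ∧
      (∀ i, ¬ (ℓ (i, false) = Fin.last n ∧ ℓ (i, true) = Fin.last n))
  swap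
  · refine NMPB_congr ?_ NMPB_zero
    intro S hSX
    symm
    rw [Nat.cast_eq_zero, Finset.card_eq_zero, Finset.filter_eq_empty_iff]
    intro s _ h
    apply hQ
    obtain ⟨⟨h1, h2⟩, -⟩ := h
    constructor
    · intro i
      have a1 := h1 i
      have a2 := h2 i
      have a3 := @hSX i
      rw [Finset.mem_sdiff] at a2
      cases hs : s i <;> rw [hs] at a1 a2 <;> simp only [Bool.not_true, Bool.not_false] at a2 <;>
        rw [a1, a2] <;> tauto
    · intro i
      have a1 := h1 i
      have a2 := h2 i
      rw [Finset.mem_sdiff] at a2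
      cases hs : s i <;> rw [hs] at a1 a2 <;> simp only [Bool.not_true, Bool.not_false] at a2 <;>
        rw [a1, a2] <;> tauto
  obtain ⟨hQ1, hQ2⟩ := hQ
  set c : ℕ := ((pairings ℓ d).filter fun P => Cons (oF s0) P).card with hc
  have hcpos : 0 < c := by
    refine pairings_pos ℓ d (oF s0) ?_
    intro j hj b
    rw [h0 j hj b, ← h0 j hj (!b)]
    congr 1
    ext f
    simp only [Finset.mem_filter, Finset.mem_univ, true_and]
    cases oF s0 f <;> cases b <;> simp
  have hconst : ∀ s, Bal a ℓ s → ((pairings ℓ d).filter fun P => Cons (oF s) P).card = c := by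
    intro s hs
    refine le_antisymm (pairings_le ℓ d (oF s) (oF s0) ?_) (pairings_le ℓ d (oF s0) (oF s) ?_)
    · intro j hj b; rw [hs j hj b, h0 j hj b]
    · intro j hj b; rw [hs j hj b, h0 j hj b]
  have hnone : ∀ s, ¬ Bal a ℓ s → ((pairings ℓ d).filter fun P => Cons (oF s) P).card = 0 := by
    intro s hs
    rw [Finset.card_eq_zero, Finset.filter_eq_empty_iff]
    intro P hP h
    exact hs (bal_of_cons a ℓ s s0 h0 P hP h)
  have main := NMPB_sum (X := X) (k := k) (pairings ℓ d) (fun _ => (c : ℝ)⁻¹)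
    (fun P S => (((Finset.univ.filter fun s : Fin m → Bool =>
      Cons (oF s) P).filter
        fun s => (Finset.univ.filter fun i => ℓ (i, s i) = Fin.last n) = S).card : ℝ))
    (fun _ => by positivity) (by
      intro P hP
      simp only [pairings, Finset.mem_filter, Finset.mem_univ, true_and] at hP
      refine NMPB_core hX P hP.1 (fun f => ℓ f = Fin.last n) ?_ hQ1 hQ2
        _ (by simp) _ (by simp)
      intro f hf
      rw [hP.2.2, hf]
      simpa using hd)
  refine NMPB_congr ?_ main
  intro S hSX
  rw [← Finset.mul_sum, inv_mul_eq_iff_eq_mul₀ (by exact_mod_cast hcpos.ne')]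
  norm_cast
  have e1 : ∀ P, ((Finset.univ.filter fun s : Fin m → Bool =>
      Cons (oF s) P).filter
        fun s => (Finset.univ.filter fun i => ℓ (i, s i) = Fin.last n) = S).card =
      ∑ s ∈ Finset.univ.filter (fun s : Fin m → Bool =>
        (Finset.univ.filter fun i => ℓ (i, s i) = Fin.last n) = S), if Cons (oF s) P then 1 else 0 := by
    intro P
    rw [← Finset.card_filter, Finset.filter_comm]
  simp only [e1]
  rw [Finset.sum_comm]
  have e2 : ∀ s, (∑ P ∈ pairings ℓ d, if Cons (oF s) P then 1 else 0) = if Bal a ℓ s then c else 0 := by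
    intro s
    rw [← Finset.card_filter]
    split_ifs with h
    · exact hconst s h
    · exact hnone s h
  simp only [e2]
  rw [← Finset.sum_filter, Finset.sum_const, smul_eq_mul, mul_comm]
  congr 2
  ext s
  simp only [Finset.mem_filter, Finset.mem_univ, true_and]
  refine and_congr_left fun _ => ?_
  constructor
  · intro h
    have h1 : ∀ i, ℓ (i, s i) = Fin.last n ↔ i ∈ S := by
      intro i; rw [← h]; simp
    refine ⟨h1, fun i => ?_⟩
    have a1 := h1 i
    have a2 := hQ1 i
    have a3 := hQ2 i
    have a4 := @hSX i
    rw [Finset.mem_sdiff]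
    cases hs : s i <;> rw [hs] at a1 <;> simp only [Bool.not_true, Bool.not_false] <;>
        rw [← a1, ← a2] <;> tauto
  · intro h
    ext i
    simp [h.1 i]

def splitEquiv {m : ℕ} {K : Type*} (s : Fin m → Bool) :
    (Fin m × Bool → K) ≃ (Fin m → K) × (Fin m → K) where
  toFun ℓ := (fun i => ℓ (i, s i), fun i => ℓ (i, !s i))
  invFun στ := fun f => if f.2 = s f.1 then στ.1 f.1 else στ.2 f.1
  left_inv ℓ := by
    funext ⟨i, b⟩
    dsimp only
    split_ifs with h
    · rw [h]
    · congr 2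
      cases b <;> cases hs : s i <;> simp_all
  right_inv στ := by
    obtain ⟨σ, τ⟩ := στ
    simp

lemma ite_aux {A B C : Prop} [Decidable A] [Decidable B] [Decidable C] (h : C ↔ A ∧ B) (u v : ℝ) :
    (if A then u else 0) * (if B then v else 0) = u * v * (if C then 1 else 0) := by
  by_cases hA : A <;> by_cases hB : B <;> simp [h, hA, hB]

theorem HX_NMPB_ball (m n : ℕ) (p : Fin m → Fin (n+1) → ℝ)
    (hp : ∀ i j, 0 ≤ p i j) (hsum : ∀ i, ∑ j, p i j = 1)
    (d : ℕ) (hd : d ≤ n) (a : Fin d → ℕ)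
    (X : Finset (Fin m)) (k : ℕ) (hX : X.card = 2 * k + 1) :
    NMPB X k (fun S => wBall p a S * wBall p a (X \ S)) := by
  have main := NMPB_sum (X := X) (k := k) (Finset.univ : Finset (Fin m × Bool → Fin (n+1)))
    (fun ℓ => ((2 : ℝ) ^ m)⁻¹ * ∏ f, p f.1 (ℓ f))
    (fun ℓ S => ((Finset.univ.filter fun s : Fin m → Bool =>
      ((∀ i, ℓ (i, s i) = Fin.last n ↔ i ∈ S) ∧ (∀ i, ℓ (i, !s i) = Fin.last n ↔ i ∈ X \ S)) ∧
        Bal a ℓ s).card : ℝ))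
    (fun ℓ => mul_nonneg (by positivity) (Finset.prod_nonneg fun f _ => hp _ _))
    (fun ℓ _ => NMPB_pair hd a hX ℓ)
  refine NMPB_congr ?_ main
  intro S hSX
  have hW : ∀ (ℓ : Fin m × Bool → Fin (n+1)) (s : Fin m → Bool), ∏ f, p f.1 (ℓ f) =
      urnWeight p (fun i => ℓ (i, s i)) * urnWeight p (fun i => ℓ (i, !s i)) := by
    intro ℓ s
    rw [Fintype.prod_prod_type, urnWeight, urnWeight, ← Finset.prod_mul_distrib]
    refine Finset.prod_congr rfl fun i _ => ?_
    rw [Fintype.prod_bool]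
    cases s i
    · simp [mul_comm]
    · simp
  have hBal : ∀ (ℓ : Fin m × Bool → Fin (n+1)) (s : Fin m → Bool), Bal a ℓ s ↔
      (∀ j : Fin (n+1), ∀ h : (j : ℕ) < d, ballCount (fun i => ℓ (i, s i)) j = a ⟨(j : ℕ), h⟩) ∧
      (∀ j : Fin (n+1), ∀ h : (j : ℕ) < d, ballCount (fun i => ℓ (i, !s i)) j = a ⟨(j : ℕ), h⟩) := by
    intro ℓ s
    unfold Bal ballCount
    simp only [← card_flag, Bool.forall_bool, Bool.false_xor, Bool.true_xor]
    constructor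
    · intro h; exact ⟨fun j hj => (h j hj).1, fun j hj => (h j hj).2⟩
    · intro h j hj; exact ⟨h.1 j hj, h.2 j hj⟩
  have hg : ∀ s : Fin m → Bool, wBall p a S * wBall p a (X \ S) =
      ∑ ℓ : Fin m × Bool → Fin (n+1), (∏ f, p f.1 (ℓ f)) *
        (if ((∀ i, ℓ (i, s i) = Fin.last n ↔ i ∈ S) ∧ (∀ i, ℓ (i, !s i) = Fin.last n ↔ i ∈ X \ S)) ∧
        Bal a ℓ s then 1 else 0) := by
    intro s
    unfold wBall
    rw [Finset.sum_mul_sum, ← Fintype.sum_prod_type', ← (splitEquiv s).sum_comp]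
    refine Finset.sum_congr rfl fun ℓ _ => ?_
    rw [hW ℓ s]
    refine ite_aux ?_ _ _
    rw [hBal]
    exact and_and_and_comm
  have havg : ∑ s : Fin m → Bool, wBall p a S * wBall p a (X \ S) =
      (2 : ℝ) ^ m * (wBall p a S * wBall p a (X \ S)) := by
    rw [Finset.sum_const]
    simp
  rw [← inv_mul_cancel_left₀ (show (2 : ℝ) ^ m ≠ 0 by positivity)
    (wBall p a S * wBall p a (X \ S)), ← havg, Finset.sum_congr rfl (fun s _ => hg s),
    Finset.sum_comm, Finset.mul_sum]
  refine Finset.sum_congr rfl fun ℓ _ => ?_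
  rw [← Finset.mul_sum, Finset.card_filter, mul_assoc]
  push_cast
  rfl

end
end

section
/- (Lemma 3.1) Let G be a finite graph (parallel edges and loops allowed) with ordered vertices v_1,…,v_n and ordered edges e_1,…,e_m, let X = {j ∈ [m] : e_j is incident to v_n} have odd cardinality, and let d ∈ {0,1,…,n−1}. Then the bipartite graph H_X with the weight function M_{G,d}^occ satisfies the normalized matching property (NMP-B): there exists ω : F → ℝ≥0 such that for every vertex U of H_X, the sum of ω(e) over edges e of H_X incident to U equals M_{G,d}^occ(U). -/
open Finset
open scoped Classical

/- A finite graph `G` with vertices labeled `1,…,n` and edges `e_1,…,e_m` is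
encoded by endpoint maps `ga gb : Fin m → ℕ` (with values in `[1,n]`), edge `j`
joining vertices `ga j` and `gb j` (a loop when `ga j = gb j`).  The edge `e_t`
of the paper (`1 ≤ t ≤ m`) is the index `t - 1 : Fin m`, and the vertex `v_t`
is the label `t : ℕ`; in particular the last vertex `v_n` is the label `n`.
An orientation is `O : Fin m → Bool` (`true`: from `ga j` to `gb j`),
normalized to `false` on loops; a loop at `v` counts as one outgoing and one
incoming edge at `v`. -/

/-- Edges outgoing from vertex `v` under orientation `O`. -/
def outAt {m : ℕ} (ga gb : Fin m → ℕ) (O : Fin m → Bool) (v : ℕ) : Finset (Fin m) :=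
  Finset.univ.filter fun j => (O j = true ∧ ga j = v) ∨ (O j = false ∧ gb j = v)

/-- Edges incoming to vertex `v` under orientation `O`. -/
def inAt {m : ℕ} (ga gb : Fin m → ℕ) (O : Fin m → Bool) (v : ℕ) : Finset (Fin m) :=
  Finset.univ.filter fun j => (O j = true ∧ gb j = v) ∨ (O j = false ∧ ga j = v)

/-- The set of (indices of) edges incident to vertex `v`. -/
def edgesAt {m : ℕ} (ga gb : Fin m → ℕ) (v : ℕ) : Finset (Fin m) :=
  Finset.univ.filter fun j => ga j = v ∨ gb j = v

/-- The degree of vertex `v` (loops counted twice). -/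
def degAt {m : ℕ} (ga gb : Fin m → ℕ) (v : ℕ) : ℕ :=
  (Finset.univ.filter fun j => ga j = v).card + (Finset.univ.filter fun j => gb j = v).card

/-- `M_{G,d}^occ(S)`: the number of `d`-admissible orientations `O` of `G` with
`Out_O(v_n) = S` and `In_O(v_n) = X ∖ S`, where `X = edgesAt ga gb n`. -/
def MoccW (n : ℕ) {m : ℕ} (ga gb : Fin m → ℕ) (d : ℕ) (S : Finset (Fin m)) : ℕ :=
  (Finset.univ.filter fun O : Fin m → Bool =>
    (∀ j, ga j = gb j → O j = false) ∧
    (∀ i : ℕ, 1 ≤ i → i ≤ d → 1 ≤ (outAt ga gb O i).card ∧ 1 ≤ (inAt ga gb O i).card) ∧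
    outAt ga gb O n = S ∧ inAt ga gb O n = edgesAt ga gb n \ S).card

section polys
open MvPolynomial

/-- chain polynomial `1 + x₁ + x₁x₂ + …` -/
noncomputable def chP {m : ℕ} : List (Fin m) → MvPolynomial (Fin m) ℕ
  | [] => 1
  | x :: L => 1 + X x * chP L

noncomputable def lcnt {m : ℕ} : List (Fin m) → (Fin m →₀ ℕ)
  | [] => 0
  | x :: L => Finsupp.single x 1 + lcnt L

theorem lcnt_append {m : ℕ} (L M : List (Fin m)) : lcnt (L ++ M) = lcnt L + lcnt M := by
  induction L with
  | nil => simp [lcnt]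
  | cons x L ih => simp [lcnt, ih, add_assoc]

theorem degree_lcnt {m : ℕ} (L : List (Fin m)) : (lcnt L).degree = L.length := by
  induction L with
  | nil => simp [lcnt]
  | cons x L ih => simp [lcnt, ih, map_add, Finsupp.degree_single, add_comm]

theorem X_mul_mon {m : ℕ} (x : Fin m) (s : Fin m →₀ ℕ) :
    (X x : MvPolynomial (Fin m) ℕ) * monomial s 1 = monomial (Finsupp.single x 1 + s) 1 := by
  rw [X, monomial_mul, one_mul]

theorem chP_snoc_append {m : ℕ} (M : List (Fin m)) (y : Fin m) (L : List (Fin m)) :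
    chP (M ++ y :: L) = chP M + monomial (lcnt (M ++ [y])) 1 * chP L := by
  induction M with
  | nil => simp [chP, lcnt, X]
  | cons x M ih =>
    simp only [List.cons_append, chP, ih, lcnt]
    rw [← X_mul_mon]; ring

/-- sums of symmetric chains -/
inductive SC_s6 {m : ℕ} (N : ℕ) : MvPolynomial (Fin m) ℕ → Prop
  | zero : SC_s6 N 0
  | add (s : Fin m →₀ ℕ) (L : List (Fin m)) (h : 2 * s.degree + L.length = N)
      (p : MvPolynomial (Fin m) ℕ) (hp : SC_s6 N p) : SC_s6 N (monomial s 1 * chP L + p)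

theorem SC_s6.chain {m : ℕ} {N : ℕ} (s : Fin m →₀ ℕ) (L : List (Fin m))
    (h : 2 * s.degree + L.length = N) : SC_s6 N (monomial s 1 * chP L) := by
  simpa using SC_s6.add s L h 0 SC_s6.zero

theorem SC_s6.sum {m : ℕ} {N : ℕ} {p q : MvPolynomial (Fin m) ℕ} (hp : SC_s6 N p) (hq : SC_s6 N q) :
    SC_s6 N (p + q) := by
  induction hp with
  | zero => simpa
  | add s L h p hp ih => rw [add_assoc]; exact SC_s6.add s L h _ ih

theorem SC_s6.mul_chain {m : ℕ} (M : List (Fin m)) : ∀ (L : List (Fin m)) (s t : Fin m →₀ ℕ),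
    SC_s6 (2 * s.degree + L.length + (2 * t.degree + M.length))
      (monomial s 1 * chP L * (monomial t 1 * chP M)) := by
  induction M using List.reverseRecOn with
  | nil =>
    intro L s t
    have : monomial s 1 * chP L * (monomial t 1 * chP ([] : List (Fin m)))
      = monomial (s + t) 1 * chP L := by
      have := monomial_mul (R := ℕ) (s := s) (s' := t) (a := 1) (b := 1)
      rw [one_mul] at this
      rw [← this]; simp only [chP]; ring
    rw [this]
    apply SC_s6.chain; simp [map_add]; ring
  | append_singleton M y ih =>
    intro L s t
    have hst := monomial_mul (R := ℕ) (s := s) (s' := t) (a := 1) (b := 1)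
    rw [one_mul] at hst
    cases L with
    | nil =>
      have : monomial s 1 * chP ([] : List (Fin m)) * (monomial t 1 * chP (M ++ [y]))
        = monomial (s + t) 1 * chP (M ++ [y]) := by
        rw [← hst]; simp only [chP]; ring
      rw [this]
      apply SC_s6.chain; simp [map_add]; ring
    | cons x L =>
      have e1 := chP_snoc_append M y []
      have e2 := chP_snoc_append M y (x :: L)
      have : monomial s 1 * chP (x :: L) * (monomial t 1 * chP (M ++ [y]))
        = monomial (s + t) 1 * chP (M ++ y :: x :: L) +
          monomial (Finsupp.single x 1 + s) 1 * chP L * (monomial t 1 * chP M) := by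
        rw [e1, e2, ← hst, ← X_mul_mon]; simp only [chP]; ring
      rw [this]
      apply SC_s6.sum
      · apply SC_s6.chain; simp [map_add]; ring
      · have := ih L (Finsupp.single x 1 + s) t
        convert this using 1
        simp [map_add, Finsupp.degree_single]; ring

theorem SC_s6.mul {m : ℕ} {N K : ℕ} {p q : MvPolynomial (Fin m) ℕ} (hp : SC_s6 N p) (hq : SC_s6 K q) :
    SC_s6 (N + K) (p * q) := by
  induction hp with
  | zero => rw [zero_mul]; exact SC_s6.zero
  | add s L h p hp ih =>
    rw [add_mul]
    refine SC_s6.sum ?_ ih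
    clear ih
    induction hq with
    | zero => rw [mul_zero]; exact SC_s6.zero
    | add t M h' q hq ih' =>
      rw [mul_add]
      refine SC_s6.sum ?_ ih'
      rw [← h, ← h']
      exact SC_s6.mul_chain M L s t

theorem full_decomp {m : ℕ} (L : List (Fin m)) : ∃ R : MvPolynomial (Fin m) ℕ, SC_s6 L.length R ∧
    (L.map (fun x => 1 + X x)).prod = chP L + R := by
  induction L with
  | nil => exact ⟨0, SC_s6.zero, by simp [chP]⟩
  | cons x L ih =>
    obtain ⟨R, hR, h⟩ := ih
    have h1 : SC_s6 (x :: L).length ((1 + X x) * R) := by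
      have : SC_s6 (m := m) 1 (1 + X x) := by
        have := SC_s6.chain (m := m) (N := 1) 0 [x] (by simp)
        simpa [chP] using this
      have := this.mul hR
      rwa [add_comm] at this
    cases L with
    | nil =>
      refine ⟨_, h1, ?_⟩
      rw [List.map_cons, List.prod_cons, h]
      simp only [chP]; ring
    | cons y L =>
      refine ⟨_, (SC_s6.chain (Finsupp.single y 1) L ?_).sum h1, ?_⟩
      · simp [Finsupp.degree_single]; ring
      · rw [List.map_cons, List.prod_cons, h, ← X]
        simp only [chP]; ring

/-- generating polynomial -/
noncomputable def gen {m : ℕ} (A : Finset (Fin m)) (f : Finset (Fin m) → ℕ) :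
    MvPolynomial (Fin m) ℕ := ∑ S ∈ A.powerset, C (f S) * ∏ x ∈ S, X x

theorem gen_one {m : ℕ} (A : Finset (Fin m)) :
    gen A (fun _ => 1) = (A.toList.map (fun x => 1 + X x)).prod := by
  rw [Finset.prod_map_toList, Finset.prod_one_add]; simp [gen]

theorem SC_gen_one {m : ℕ} (A : Finset (Fin m)) : SC_s6 A.card (gen A (fun _ => 1)) := by
  obtain ⟨R, hR, h⟩ := full_decomp A.toList
  rw [gen_one, h]
  rw [Finset.length_toList] at hR
  refine SC_s6.sum ?_ hR
  simpa using SC_s6.chain (N := A.card) 0 A.toList (by simp)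

def naeS {m : ℕ} (B S : Finset (Fin m)) : ℕ :=
  if (∃ x ∈ B, x ∈ S) ∧ (∃ x ∈ B, x ∉ S) then 1 else 0

theorem mon_list {m : ℕ} (L : List (Fin m)) :
    (monomial (lcnt L) 1 : MvPolynomial (Fin m) ℕ) = (L.map X).prod := by
  induction L with
  | nil => simp [lcnt]
  | cons x L ih => simp only [lcnt, List.map_cons, List.prod_cons, ← ih, X_mul_mon]

theorem gen_nae {m : ℕ} (B : Finset (Fin m)) (hB : B.Nonempty) :
    gen B (fun _ => 1) = gen B (naeS B) + (1 + ∏ x ∈ B, X x) := by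
  have hd : gen B (fun _ => 1) = gen B (naeS B)
      + gen B (fun S => if S = ∅ then 1 else 0) + gen B (fun S => if S = B then 1 else 0) := by
    simp only [gen, ← Finset.sum_add_distrib, ← add_mul, ← map_add]
    refine Finset.sum_congr rfl fun S hS => ?_
    congr 2
    rw [Finset.mem_powerset] at hS
    unfold naeS
    by_cases h1 : S = ∅
    · subst h1
      simp [hB.ne_empty.symm]
    · by_cases h2 : S = B
      · subst h2; simp [h1]
      · rw [if_pos, if_neg h1, if_neg h2]
        constructor
        · obtain ⟨x, hx⟩ := Finset.nonempty_iff_ne_empty.mpr h1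
          exact ⟨x, hS hx, hx⟩
        · by_contra! hc
          exact h2 (hS.antisymm hc)
  rw [hd, add_assoc]
  congr 2
  · simp only [gen]
    rw [Finset.sum_eq_single ∅] <;> simp +contextual
  · simp only [gen]
    rw [Finset.sum_eq_single B] <;> simp +contextual

theorem SC_gen_nae {m : ℕ} (B : Finset (Fin m)) : SC_s6 B.card (gen B (naeS B)) := by
  rcases Finset.eq_empty_or_nonempty B with rfl | hB
  · have : gen (∅ : Finset (Fin m)) (naeS ∅) = 0 := by simp [gen, naeS]
    rw [this]; exact SC_s6.zero
  obtain ⟨R, hR, h⟩ := full_decomp B.toList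
  have h1 := gen_nae B hB
  rw [gen_one, h] at h1
  have hlen := Finset.length_toList B
  have hprod : (monomial (lcnt B.toList) 1 : MvPolynomial (Fin m) ℕ) = ∏ x ∈ B, X x := by
    rw [mon_list, Finset.prod_map_toList]
  rw [← hprod] at h1
  rw [hlen] at hR
  generalize B.toList = L at *
  cases L with
  | nil => have := hB.card_pos; simp only [List.length_nil] at hlen; omega
  | cons x L =>
    rcases List.eq_nil_or_concat L with rfl | ⟨L', y, rfl⟩
    · have : gen B (naeS B) = R := by
        have h2 : gen B (naeS B) + (1 + monomial (lcnt [x]) 1) = R + (1 + monomial (lcnt [x]) 1) := by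
          rw [← h1]; simp [chP, lcnt, X]; ring
        exact add_right_cancel h2
      rwa [this]
    · have : gen B (naeS B) = monomial (Finsupp.single x 1) 1 * chP L' + R := by
        refine add_right_cancel (b := 1 + monomial (lcnt (x :: L'.concat y)) 1) ?_
        rw [← h1]
        simp only [List.concat_eq_append, chP, chP_snoc_append, lcnt]
        rw [← X_mul_mon, ← X]; ring
      rw [this]
      refine SC_s6.sum (SC_s6.chain _ _ ?_) hR
      simp at hlen
      simp [Finsupp.degree_single]; omega

theorem gen_union {m : ℕ} (A B : Finset (Fin m)) (hd : Disjoint A B)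
    (f f1 f2 : Finset (Fin m) → ℕ)
    (h : ∀ S ⊆ A, ∀ T ⊆ B, f (S ∪ T) = f1 S * f2 T) :
    gen (A ∪ B) f = gen A f1 * gen B f2 := by
  simp only [gen]
  rw [Finset.sum_mul_sum, ← Finset.sum_product']
  symm
  refine Finset.sum_bij' (fun p _ => p.1 ∪ p.2) (fun S _ => (S ∩ A, S ∩ B)) ?_ ?_ ?_ ?_ ?_
  · rintro ⟨S, T⟩ hp
    simp only [Finset.mem_product, Finset.mem_powerset] at hp ⊢
    exact Finset.union_subset_union hp.1 hp.2
  · intro S hS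
    simp
  · rintro ⟨S, T⟩ hp
    simp only [Finset.mem_product, Finset.mem_powerset] at hp
    rw [Finset.disjoint_left] at hd
    ext x <;> simp <;> grind
  · intro S hS
    simp only [Finset.mem_powerset] at hS
    rw [← Finset.inter_union_distrib_left, Finset.inter_eq_left.mpr hS]
  · rintro ⟨S, T⟩ hp
    simp only [Finset.mem_product, Finset.mem_powerset] at hp
    have : Disjoint S T := Finset.disjoint_of_subset_left hp.1 (Finset.disjoint_of_subset_right hp.2 hd)
    simp only
    rw [Finset.prod_union this, h S hp.1 T hp.2, map_mul]; ring

theorem SC_gen {m : ℕ} (R : List (Finset (Fin m))) : ∀ A : Finset (Fin m),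
    R.Pairwise Disjoint → (∀ B ∈ R, B ⊆ A) →
    SC_s6 A.card (gen A (fun S => (R.map (fun B => naeS B S)).prod)) := by
  induction R with
  | nil => intro A _ _; simpa using SC_gen_one A
  | cons B R ih =>
    intro A hp hs
    rw [List.pairwise_cons] at hp
    have hBA : B ⊆ A := hs B (by simp)
    have hd : Disjoint B (A \ B) := Finset.disjoint_sdiff
    have h1 := ih (A \ B) hp.2 (fun D hD => by
      rw [Finset.subset_sdiff]
      exact ⟨hs D (by simp [hD]), (hp.1 D hD).symm⟩)
    have h2 := (SC_gen_nae B).mul h1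
    rw [← gen_union B (A \ B) hd (fun S => ((B :: R).map (fun B => naeS B S)).prod),
      ← Finset.card_union_of_disjoint hd, Finset.union_sdiff_of_subset hBA] at h2
    · exact h2
    · intro S hS T hT
      rw [List.map_cons, List.prod_cons]
      congr 1
      · unfold naeS
        rw [Finset.disjoint_left] at hd
        congr 1
        simp only [Finset.mem_union]
        grind
      · congr 1
        refine List.map_congr_left fun D hD => ?_
        have := hp.1 D hD
        rw [Finset.disjoint_left] at this
        unfold naeS
        congr 1
        simp only [Finset.mem_union]
        grind

theorem coeff_chain_low {m : ℕ} (L : List (Fin m)) (s t : Fin m →₀ ℕ)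
    (h : t.degree < s.degree) : coeff t (monomial s 1 * chP L) = 0 := by
  rw [coeff_monomial_mul', if_neg]
  intro hst
  exact absurd (Finsupp.degree_mono hst) (by omega)

theorem coeff_chain {m : ℕ} (L : List (Fin m)) : ∀ (i : ℕ) (s t : Fin m →₀ ℕ),
    i ≤ L.length → t.degree = s.degree + i →
    coeff t (monomial s 1 * chP L) = if s + lcnt (L.take i) = t then 1 else 0 := by
  induction L with
  | nil =>
    intro i s t hi ht
    simp at hi; subst hi
    simp [chP, lcnt, coeff_monomial]
  | cons x L ih =>
    intro i s t hi ht
    have e : monomial s 1 * chP (x :: L) = monomial s 1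
        + monomial (Finsupp.single x 1 + s) 1 * chP L := by
      rw [← X_mul_mon]; simp only [chP]; ring
    rw [e, coeff_add, coeff_monomial]
    cases i with
    | zero =>
      rw [coeff_chain_low]
      · simp [lcnt]
      · simp [map_add, Finsupp.degree_single]; omega
    | succ i =>
      rw [ih i _ _ (by simpa using hi) (by simp [map_add, Finsupp.degree_single]; omega), if_neg]
      · simp only [List.take_succ_cons, lcnt, zero_add]
        congr 2
        rw [← add_assoc, add_comm s]
      · rintro rfl
        omega

theorem SC_levels {m : ℕ} (k : ℕ) (p : MvPolynomial (Fin m) ℕ) (hp : SC_s6 (2 * k + 1) p) :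
    ∃ l : List ((Fin m →₀ ℕ) × Fin m), (∀ q ∈ l, q.1.degree = k) ∧
      (∀ t : Fin m →₀ ℕ, t.degree = k →
        coeff t p = (l.map (fun q => if q.1 = t then 1 else 0)).sum) ∧
      (∀ t : Fin m →₀ ℕ, t.degree = k + 1 →
        coeff t p = (l.map (fun q => if q.1 + Finsupp.single q.2 1 = t then 1 else 0)).sum) := by
  induction hp with
  | zero => exact ⟨[], by simp, by simp, by simp⟩
  | add s L h p hp ih =>
    obtain ⟨l, h0, h1, h2⟩ := ih
    obtain ⟨i, hi⟩ : ∃ i, k = s.degree + i := ⟨k - s.degree, by omega⟩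
    have hiL : i < L.length := by omega
    refine ⟨(s + lcnt (L.take i), L[i]) :: l, ?_, ?_, ?_⟩
    · intro q hq
      rcases List.mem_cons.mp hq with rfl | hq
      · simp [map_add, degree_lcnt]; omega
      · exact h0 q hq
    · intro t ht
      rw [coeff_add, h1 t ht, coeff_chain L i s t hiL.le (by omega)]
      simp
    · intro t ht
      rw [coeff_add, h2 t ht, coeff_chain L (i + 1) s t hiL (by omega)]
      rw [List.take_succ_eq_append_getElem hiL, lcnt_append]
      simp [lcnt, add_assoc]

noncomputable def eS {m : ℕ} (S : Finset (Fin m)) : Fin m →₀ ℕ := ∑ x ∈ S, Finsupp.single x 1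

theorem eS_apply {m : ℕ} (S : Finset (Fin m)) (x : Fin m) : eS S x = if x ∈ S then 1 else 0 := by
  simp [eS, Finsupp.finsetSum_apply, Finsupp.single_apply]

theorem eS_inj {m : ℕ} {S T : Finset (Fin m)} (h : eS S = eS T) : S = T := by
  ext x
  have := DFunLike.congr_fun h x
  rw [eS_apply, eS_apply] at this
  by_cases h1 : x ∈ S <;> by_cases h2 : x ∈ T <;> simp_all

theorem eS_degree {m : ℕ} (S : Finset (Fin m)) : (eS S).degree = S.card := by
  simp [eS, map_sum, Finsupp.degree_single]

theorem eS_mon {m : ℕ} (S : Finset (Fin m)) (a : ℕ) :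
    C a * ∏ x ∈ S, X x = (monomial (eS S) a : MvPolynomial (Fin m) ℕ) := by
  unfold eS
  rw [← mul_one a, ← C_mul_monomial, monomial_sum_one]
  simp [X]

theorem coeff_gen {m : ℕ} (A : Finset (Fin m)) (f : Finset (Fin m) → ℕ) (t : Fin m →₀ ℕ) :
    coeff t (gen A f) = ∑ S ∈ A.powerset, if eS S = t then f S else 0 := by
  simp only [gen, eS_mon, coeff_sum, coeff_monomial]

theorem coeff_gen_eS {m : ℕ} (A : Finset (Fin m)) (f : Finset (Fin m) → ℕ) (S : Finset (Fin m))
    (hS : S ⊆ A) : coeff (eS S) (gen A f) = f S := by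
  rw [coeff_gen, Finset.sum_eq_single S]
  · simp
  · intro T _ hT
    rw [if_neg]; intro h; exact hT (eS_inj h)
  · simp [hS]

theorem coeff_gen_ne {m : ℕ} (A : Finset (Fin m)) (f : Finset (Fin m) → ℕ) (t : Fin m →₀ ℕ)
    (h : coeff t (gen A f) ≠ 0) : ∃ S ⊆ A, eS S = t := by
  rw [coeff_gen] at h
  obtain ⟨S, hS, h⟩ := Finset.exists_ne_zero_of_sum_ne_zero h
  exact ⟨S, Finset.mem_powerset.mp hS, by by_contra hc; simp [hc] at h⟩

theorem list_sum_ne {β : Type*} (l : List β) (P : β → Prop) [DecidablePred P] (q : β) (hq : q ∈ l) (hP : P q) :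
    (l.map (fun q => if P q then 1 else 0)).sum ≠ 0 := by
  intro h
  rw [List.sum_eq_zero_iff] at h
  have := h 1 (List.mem_map.mpr ⟨q, hq, by simp [hP]⟩)
  simp at this

theorem sum_list_swap {β γ : Type*} (l : List β) (s : Finset γ) (F : β → γ → ℝ) :
    ∑ c ∈ s, (l.map (fun q => F q c)).sum = (l.map (fun q => ∑ c ∈ s, F q c)).sum := by
  induction l with
  | nil => simp
  | cons a l ih => simp [Finset.sum_add_distrib, ih]

theorem eS_le {m : ℕ} {S T : Finset (Fin m)} {x : Fin m}
    (h : eS S + Finsupp.single x 1 = eS T) : S ⊆ T := by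
  intro y hy
  have := DFunLike.congr_fun h y
  rw [Finsupp.add_apply, eS_apply, eS_apply, if_pos hy] at this
  by_contra hc
  rw [if_neg hc] at this
  omega

theorem NMPB_of_SC {m : ℕ} (A : Finset (Fin m)) (k : ℕ) (f : Finset (Fin m) → ℕ)
    (h : SC_s6 (2 * k + 1) (gen A f)) : NMPB A k (fun S => (f S : ℝ)) := by
  obtain ⟨l, h0, h1, h2⟩ := SC_levels k _ h
  refine ⟨fun S T => (l.map (fun q =>
    if q.1 = eS S ∧ q.1 + Finsupp.single q.2 1 = eS T then (1 : ℝ) else 0)).sum, ?_, ?_, ?_⟩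
  · intro S T
    apply List.sum_nonneg
    intro a ha
    obtain ⟨q, _, rfl⟩ := List.mem_map.mp ha
    split_ifs <;> norm_num
  · intro S hS hk
    have := h1 (eS S) (by rw [eS_degree, hk])
    rw [coeff_gen_eS A f S hS] at this
    simp only
    rw [sum_list_swap, this, Nat.cast_list_sum, List.map_map]
    congr 1
    refine List.map_congr_left fun q hq => ?_
    simp only [Function.comp]
    by_cases hqS : q.1 = eS S
    · have hne : coeff (q.1 + Finsupp.single q.2 1) (gen A f) ≠ 0 := by
        rw [h2 _ (by rw [map_add, h0 q hq, Finsupp.degree_single])]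
        exact list_sum_ne l (fun q' => q'.1 + Finsupp.single q'.2 1 = q.1 + Finsupp.single q.2 1) q hq rfl
      obtain ⟨T, hT, hTe⟩ := coeff_gen_ne A f _ hne
      rw [Finset.sum_eq_single T]
      · rw [if_pos ⟨hqS, hTe.symm⟩]; simp [hqS]
      · intro T' _ hT'
        rw [if_neg]
        rintro ⟨_, h3⟩
        exact hT' (eS_inj (h3.symm.trans hTe.symm))
      · intro hn
        exfalso; apply hn
        simp only [Finset.mem_filter, Finset.mem_univ, true_and]
        refine ⟨hT, ?_, ?_⟩
        · rw [← eS_degree, hTe, map_add, h0 q hq, Finsupp.degree_single]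
        · rw [hqS] at hTe; exact eS_le hTe.symm
    · simp [hqS]
  · intro T hT hk
    have := h2 (eS T) (by rw [eS_degree, hk])
    rw [coeff_gen_eS A f T hT] at this
    simp only
    rw [sum_list_swap, this, Nat.cast_list_sum, List.map_map]
    congr 1
    refine List.map_congr_left fun q hq => ?_
    simp only [Function.comp]
    by_cases hqT : q.1 + Finsupp.single q.2 1 = eS T
    · have hne : coeff q.1 (gen A f) ≠ 0 := by
        rw [h1 _ (h0 q hq)]
        exact list_sum_ne l (fun q' => q'.1 = q.1) q hq rfl
      obtain ⟨S, hS, hSe⟩ := coeff_gen_ne A f _ hne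
      rw [Finset.sum_eq_single S]
      · rw [if_pos ⟨hSe.symm, hqT⟩]; simp [hqT]
      · intro S' _ hS'
        rw [if_neg]
        rintro ⟨h3, _⟩
        exact hS' (eS_inj (h3.symm.trans hSe.symm))
      · intro hn
        exfalso; apply hn
        simp only [Finset.mem_filter, Finset.mem_univ, true_and]
        refine ⟨hS, ?_, ?_⟩
        · rw [← eS_degree, hSe, h0 q hq]
        · rw [← hSe] at hqT; exact eS_le hqT
    · simp [hqT]

end polys

section elim

/-- not-all-equal indicator of a set of literals -/
def naeL {m : ℕ} (B : Finset (Fin m × Bool)) (O : Fin m → Bool) : ℕ :=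
  if (∃ l ∈ B, O l.1 = l.2) ∧ (∃ l ∈ B, O l.1 ≠ l.2) then 1 else 0

def prodL {m : ℕ} (Bs : List (Finset (Fin m × Bool))) (O : Fin m → Bool) : ℕ :=
  (Bs.map (fun B => naeL B O)).prod

theorem prodL_perm {m : ℕ} {Bs Bs' : List (Finset (Fin m × Bool))} (h : Bs.Perm Bs')
    (O : Fin m → Bool) : prodL Bs O = prodL Bs' O := (h.map _).prod_eq

theorem prodL_cons {m : ℕ} (B : Finset (Fin m × Bool)) (Bs : List (Finset (Fin m × Bool)))
    (O : Fin m → Bool) : prodL (B :: Bs) O = naeL B O * prodL Bs O := by simp [prodL]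

theorem naeL_update {m : ℕ} (B : Finset (Fin m × Bool)) (O : Fin m → Bool) (e : Fin m) (v : Bool)
    (h : ∀ l ∈ B, l.1 ≠ e) : naeL B (Function.update O e v) = naeL B O := by
  have h1 : ∀ l ∈ B, Function.update O e v l.1 = O l.1 := fun l hl =>
    Function.update_of_ne (h l hl) _ _
  unfold naeL
  congr 1
  grind

theorem prodL_update {m : ℕ} (Bs : List (Finset (Fin m × Bool))) (O : Fin m → Bool) (e : Fin m)
    (v : Bool) (h : ∀ B ∈ Bs, ∀ l ∈ B, l.1 ≠ e) :
    prodL Bs (Function.update O e v) = prodL Bs O := by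
  unfold prodL
  congr 1
  exact List.map_congr_left fun B hB => naeL_update B O e v (h B hB)

/-- an occurrence of literal `(e,s)`, with the opposite literal absent -/
theorem naeL_occ {m : ℕ} (B : Finset (Fin m × Bool)) (O : Fin m → Bool) (e : Fin m) (s v : Bool)
    (h : (e, s) ∈ B) (h' : (e, !s) ∉ B) :
    naeL B (Function.update O e v) =
      if v = s then (if ∃ l ∈ B.erase (e, s), O l.1 ≠ l.2 then 1 else 0)
      else (if ∃ l ∈ B.erase (e, s), O l.1 = l.2 then 1 else 0) := by
  have h1 : ∀ l ∈ B.erase (e, s), Function.update O e v l.1 = O l.1 := by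
    rintro ⟨j, t⟩ hl
    refine Function.update_of_ne ?_ _ _
    rintro rfl
    rw [Finset.mem_erase] at hl
    cases s <;> cases t <;> simp_all
  have h2 : Function.update O e v e = v := Function.update_self _ _ _
  unfold naeL
  have hA : (∃ l ∈ B, Function.update O e v l.1 = l.2) ↔
      (v = s ∨ ∃ l ∈ B.erase (e, s), O l.1 = l.2) := by
    constructor
    · rintro ⟨l, hl, hv⟩
      by_cases hle : l = (e, s)
      · subst hle; left; rw [← h2]; exact hv
      · right
        have hm := Finset.mem_erase.mpr ⟨hle, hl⟩
        exact ⟨l, hm, by rw [← h1 l hm]; exact hv⟩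
    · rintro (hv | ⟨l, hl, hv⟩)
      · exact ⟨_, h, by rw [← hv]; exact h2⟩
      · exact ⟨l, Finset.mem_of_mem_erase hl, by rw [h1 l hl]; exact hv⟩
  have hB : (∃ l ∈ B, Function.update O e v l.1 ≠ l.2) ↔
      (v ≠ s ∨ ∃ l ∈ B.erase (e, s), O l.1 ≠ l.2) := by
    constructor
    · rintro ⟨l, hl, hv⟩
      by_cases hle : l = (e, s)
      · subst hle; left; rw [← h2]; exact hv
      · right
        have hm := Finset.mem_erase.mpr ⟨hle, hl⟩
        exact ⟨l, hm, by rw [← h1 l hm]; exact hv⟩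
    · rintro (hv | ⟨l, hl, hv⟩)
      · exact ⟨_, h, by rw [h2]; exact hv⟩
      · exact ⟨l, Finset.mem_of_mem_erase hl, by rw [h1 l hl]; exact hv⟩
  simp only [hA, hB]
  by_cases hvs : v = s <;> simp [hvs]

theorem naeL_both {m : ℕ} (B : Finset (Fin m × Bool)) (O : Fin m → Bool) (e : Fin m)
    (h : ∀ s, (e, s) ∈ B) : naeL B O = 1 := by
  unfold naeL
  rw [if_pos]
  exact ⟨⟨_, h (O e), rfl⟩, ⟨_, h (!(O e)), by simp⟩⟩

def Occ {m : ℕ} (Bs : List (Finset (Fin m × Bool))) (l : Fin m × Bool) : Prop := ∃ B ∈ Bs, l ∈ B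

theorem sum_single {m : ℕ} (B : Finset (Fin m × Bool)) (O : Fin m → Bool) (e : Fin m) (s : Bool)
    (h : (e, s) ∈ B) (h' : (e, !s) ∉ B) (hne : (B.erase (e, s)).Nonempty) :
    naeL B (Function.update O e true) + naeL B (Function.update O e false)
      = 1 + naeL (B.erase (e, s)) O := by
  rw [naeL_occ B O e s _ h h', naeL_occ B O e s _ h h']
  generalize B.erase (e, s) = D at *
  obtain ⟨l, hl⟩ := hne
  unfold naeL
  by_cases h1 : ∃ l ∈ D, O l.1 = l.2 <;> by_cases h2 : ∃ l ∈ D, O l.1 ≠ l.2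
  · cases s <;> simp only [h1, h2] <;> simp
  · cases s <;> simp only [h1, h2] <;> simp
  · cases s <;> simp only [h1, h2] <;> simp
  · by_cases hh : O l.1 = l.2
    · exact absurd ⟨l, hl, hh⟩ h1
    · exact absurd ⟨l, hl, hh⟩ h2

theorem sum_pair {m : ℕ} (A B : Finset (Fin m × Bool)) (O : Fin m → Bool) (e : Fin m)
    (hA : (e, true) ∈ A) (hA' : (e, false) ∉ A) (hB : (e, false) ∈ B) (hB' : (e, true) ∉ B)
    (hAn : (A.erase (e, true)).Nonempty) (hBn : (B.erase (e, false)).Nonempty) :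
    naeL A (Function.update O e true) * naeL B (Function.update O e true)
      + naeL A (Function.update O e false) * naeL B (Function.update O e false)
      = naeL (A.erase (e, true) ∪ B.erase (e, false)) O
        + naeL (A.erase (e, true)) O * naeL (B.erase (e, false)) O := by
  rw [naeL_occ A O e true _ hA (by simpa), naeL_occ A O e true _ hA (by simpa),
    naeL_occ B O e false _ hB (by simpa), naeL_occ B O e false _ hB (by simpa)]
  generalize A.erase (e, true) = D at *
  generalize B.erase (e, false) = E at *
  obtain ⟨l, hl⟩ := hAn
  obtain ⟨l', hl'⟩ := hBn
  unfold naeL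
  have hu1 : (∃ l ∈ D ∪ E, O l.1 = l.2) ↔ ((∃ l ∈ D, O l.1 = l.2) ∨ (∃ l ∈ E, O l.1 = l.2)) := by
    simp only [Finset.mem_union]; grind
  have hu2 : (∃ l ∈ D ∪ E, O l.1 ≠ l.2) ↔ ((∃ l ∈ D, O l.1 ≠ l.2) ∨ (∃ l ∈ E, O l.1 ≠ l.2)) := by
    simp only [Finset.mem_union]; grind
  have o1 : (∃ l ∈ D, O l.1 = l.2) ∨ (∃ l ∈ D, O l.1 ≠ l.2) := by
    by_cases hh : O l.1 = l.2
    · exact Or.inl ⟨l, hl, hh⟩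
    · exact Or.inr ⟨l, hl, hh⟩
  have o2 : (∃ l ∈ E, O l.1 = l.2) ∨ (∃ l ∈ E, O l.1 ≠ l.2) := by
    by_cases hh : O l'.1 = l'.2
    · exact Or.inl ⟨l', hl', hh⟩
    · exact Or.inr ⟨l', hl', hh⟩
  by_cases a : (∃ l ∈ D, O l.1 = l.2) <;> by_cases b : (∃ l ∈ D, O l.1 ≠ l.2) <;>
    by_cases c : (∃ l ∈ E, O l.1 = l.2) <;> by_cases d : (∃ l ∈ E, O l.1 ≠ l.2) <;>
    first
    | exact absurd o1 (not_or.mpr ⟨a, b⟩)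
    | exact absurd o2 (not_or.mpr ⟨c, d⟩)
    | (simp only [hu1, hu2, a, b, c, d]; simp)

theorem naeL_singleton {m : ℕ} (B : Finset (Fin m × Bool)) (O : Fin m → Bool) (l : Fin m × Bool)
    (h : ¬ (B.erase l).Nonempty) : naeL B O = 0 := by
  have hB : ∀ x ∈ B, x = l := by
    intro x hx
    by_contra hc
    exact h ⟨x, Finset.mem_erase.mpr ⟨hc, hx⟩⟩
  unfold naeL
  rw [if_neg]
  rintro ⟨⟨x, hx, h1⟩, ⟨y, hy, h2⟩⟩
  rw [hB x hx] at h1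
  rw [hB y hy] at h2
  exact h2 h1

/-- eliminating a variable -/
theorem eliminate {m : ℕ} (Bs : List (Finset (Fin m × Bool))) (hd : Bs.Pairwise Disjoint)
    (e : Fin m) : ∃ Rs : List (List (Finset (Fin m × Bool))),
      (∀ R ∈ Rs, R.Pairwise Disjoint ∧ ∀ l, Occ R l → Occ Bs l ∧ l.1 ≠ e) ∧
      ∀ O, prodL Bs (Function.update O e true) + prodL Bs (Function.update O e false)
        = (Rs.map (fun R => prodL R O)).sum := by
  have key : ∀ (B : Finset (Fin m × Bool)) (Bs' : List (Finset (Fin m × Bool))),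
      Bs.Perm (B :: Bs') → (∀ D ∈ Bs', Disjoint B D) ∧ Bs'.Pairwise Disjoint := by
    intro B Bs' hp
    have := (hp.pairwise_iff (fun h => Disjoint.symm h)).mp hd
    exact List.pairwise_cons.mp this
  have occp : ∀ (Bs' : List (Finset (Fin m × Bool))), Bs.Perm Bs' → ∀ l, Occ Bs' l → Occ Bs l := by
    rintro Bs' hp l ⟨B, hB, hl⟩
    exact ⟨B, hp.mem_iff.mpr hB, hl⟩
  by_cases h0 : ∃ s, Occ Bs (e, s)
  swap
  · have hno : ∀ B ∈ Bs, ∀ l ∈ B, l.1 ≠ e := by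
      rintro B hB ⟨j, s⟩ hl rfl
      exact h0 ⟨s, B, hB, hl⟩
    refine ⟨[Bs, Bs], ?_, ?_⟩
    · intro R hR
      have : R = Bs := by simpa using hR
      subst this
      exact ⟨hd, fun l hl => ⟨hl, by obtain ⟨B, hB, hl⟩ := hl; exact hno B hB l hl⟩⟩
    · intro O
      rw [prodL_update _ _ _ _ hno, prodL_update _ _ _ _ hno]; simp
  by_cases hc : ∃ B ∈ Bs, ∀ s, (e, s) ∈ B
  · obtain ⟨B, hB, hboth⟩ := hc
    have hp := List.perm_cons_erase hB
    generalize Bs.erase B = Bs' at hp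
    obtain ⟨k1, k2⟩ := key _ _ hp
    have hno : ∀ D ∈ Bs', ∀ l ∈ D, l.1 ≠ e := by
      rintro D hD ⟨j, s⟩ hl rfl
      exact Finset.disjoint_left.mp (k1 D hD) (hboth s) hl
    refine ⟨[Bs', Bs'], ?_, ?_⟩
    · intro R hR
      have : R = Bs' := by simpa using hR
      subst this
      exact ⟨k2, fun l ⟨D, hD, hl⟩ => ⟨occp _ hp l ⟨D, by simp [hD], hl⟩, hno D hD l hl⟩⟩
    · intro O
      rw [prodL_perm hp, prodL_perm hp, prodL_cons, prodL_cons,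
        prodL_update _ _ _ _ hno, prodL_update _ _ _ _ hno, naeL_both _ _ e hboth,
        naeL_both _ _ e hboth]; simp
  obtain ⟨s, B, hB, hs⟩ := h0
  have hs' : ∀ B ∈ Bs, ∀ s, (e, s) ∈ B → (e, !s) ∉ B := by
    intro B hB s h1 h2
    exact hc ⟨B, hB, fun t => by cases s <;> cases t <;> simp_all⟩
  by_cases hemp : ∃ B ∈ Bs, ∃ l, ¬ (B.erase l).Nonempty
  · obtain ⟨D, hD, l, hl⟩ := hemp
    refine ⟨[], by simp, fun O => ?_⟩
    have hp := List.perm_cons_erase hD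
    rw [prodL_perm hp, prodL_perm hp, prodL_cons, prodL_cons, naeL_singleton _ _ l hl,
      naeL_singleton _ _ l hl]; simp
  push Not at hemp
  by_cases ho : Occ Bs (e, !s)
  · -- both literals occur, in different blocks
    have : ∃ A ∈ Bs, ∃ D ∈ Bs, (e, true) ∈ A ∧ (e, false) ∈ D := by
      obtain ⟨D, hD, hl⟩ := ho
      cases s
      · exact ⟨D, hD, B, hB, hl, hs⟩
      · exact ⟨B, hB, D, hD, hs, hl⟩
    clear hs ho hB B s
    obtain ⟨A, hA, D, hD, hAe, hDe⟩ := this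
    have hA' := hs' A hA _ hAe
    have hD' := hs' D hD _ hDe
    simp only [Bool.not_true, Bool.not_false] at hA' hD'
    have hp := List.perm_cons_erase hA
    have hDm : D ∈ Bs.erase A := by
      rcases List.mem_cons.mp (hp.mem_iff.mp hD) with h | h
      · subst h; exact absurd hDe hA'
      · exact h
    have hp2 := hp.trans ((List.perm_cons_erase hDm).cons A)
    generalize (Bs.erase A).erase D = Bs' at hp2
    obtain ⟨k1, k2⟩ := key _ _ hp2
    obtain ⟨k3, k4⟩ := List.pairwise_cons.mp k2
    have kAD := k1 D (by simp)
    have kA : ∀ E ∈ Bs', Disjoint A E := fun E hE => k1 E (by simp [hE])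
    have hno : ∀ E ∈ Bs', ∀ l ∈ E, l.1 ≠ e := by
      rintro E hE ⟨j, s⟩ hl rfl
      cases s
      · exact Finset.disjoint_left.mp (k3 E hE) hDe hl
      · exact Finset.disjoint_left.mp (kA E hE) hAe hl
    have hAno : ∀ l ∈ A.erase (e, true), l.1 ≠ e := by
      rintro ⟨j, s⟩ hl rfl
      cases s <;> simp_all
    have hDno : ∀ l ∈ D.erase (e, false), l.1 ≠ e := by
      rintro ⟨j, s⟩ hl rfl
      cases s <;> simp_all
    have eA : A.erase (e, true) ⊆ A := Finset.erase_subset _ _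
    have eD : D.erase (e, false) ⊆ D := Finset.erase_subset _ _
    have occA : ∀ l ∈ A.erase (e, true), Occ Bs l ∧ l.1 ≠ e := fun l hl =>
      ⟨⟨A, hA, eA hl⟩, hAno l hl⟩
    have occD : ∀ l ∈ D.erase (e, false), Occ Bs l ∧ l.1 ≠ e := fun l hl =>
      ⟨⟨D, hD, eD hl⟩, hDno l hl⟩
    have occ' : ∀ E ∈ Bs', ∀ l ∈ E, Occ Bs l ∧ l.1 ≠ e := fun E hE l hl =>
      ⟨occp _ hp2 l ⟨E, by simp [hE], hl⟩, hno E hE l hl⟩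
    refine ⟨[(A.erase (e, true) ∪ D.erase (e, false)) :: Bs',
      A.erase (e, true) :: D.erase (e, false) :: Bs'], ?_, ?_⟩
    · intro R hR
      simp only [List.mem_cons, List.not_mem_nil, or_false] at hR
      rcases hR with rfl | rfl
      · refine ⟨List.pairwise_cons.mpr ⟨fun E hE => ?_, k4⟩, ?_⟩
        · rw [Finset.disjoint_union_left]
          exact ⟨Finset.disjoint_of_subset_left eA (kA E hE),
            Finset.disjoint_of_subset_left eD (k3 E hE)⟩
        · rintro l ⟨E, hE, hl⟩
          rcases List.mem_cons.mp hE with rfl | hE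
          · rcases Finset.mem_union.mp hl with hl | hl
            · exact occA l hl
            · exact occD l hl
          · exact occ' E hE l hl
      · refine ⟨List.pairwise_cons.mpr ⟨fun E hE => ?_, List.pairwise_cons.mpr
          ⟨fun E hE => Finset.disjoint_of_subset_left eD (k3 E hE), k4⟩⟩, ?_⟩
        · rcases List.mem_cons.mp hE with rfl | hE
          · exact Finset.disjoint_of_subset_left eA (Finset.disjoint_of_subset_right eD kAD)
          · exact Finset.disjoint_of_subset_left eA (kA E hE)
        · rintro l ⟨E, hE, hl⟩
          rcases List.mem_cons.mp hE with rfl | hE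
          · exact occA l hl
          rcases List.mem_cons.mp hE with rfl | hE
          · exact occD l hl
          · exact occ' E hE l hl
    · intro O
      have := sum_pair A D O e hAe hA' hDe hD' (hemp A hA _) (hemp D hD _)
      rw [prodL_perm hp2, prodL_perm hp2]
      simp only [prodL_cons, prodL_update _ _ _ _ hno, List.map_cons, List.map_nil, List.sum_cons,
        List.sum_nil]
      rw [← mul_assoc, ← mul_assoc, ← add_mul, this]; ring
  · have hp := List.perm_cons_erase hB
    generalize Bs.erase B = Bs' at hp
    obtain ⟨k1, k2⟩ := key _ _ hp
    have hno : ∀ E ∈ Bs', ∀ l ∈ E, l.1 ≠ e := by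
      rintro E hE ⟨j, t⟩ hl rfl
      by_cases hts : t = s
      · subst hts; exact Finset.disjoint_left.mp (k1 E hE) hs hl
      · have : t = !s := by cases t <;> cases s <;> simp_all
        subst this
        exact ho (occp _ hp _ ⟨E, by simp [hE], hl⟩)
    have hBs := hs' B hB s hs
    have hBno : ∀ l ∈ B.erase (e, s), l.1 ≠ e := by
      rintro ⟨j, t⟩ hl rfl
      cases s <;> cases t <;> simp_all
    have eB : B.erase (e, s) ⊆ B := Finset.erase_subset _ _
    have occ' : ∀ E ∈ Bs', ∀ l ∈ E, Occ Bs l ∧ l.1 ≠ e := fun E hE l hl =>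
      ⟨occp _ hp l ⟨E, by simp [hE], hl⟩, hno E hE l hl⟩
    refine ⟨[Bs', B.erase (e, s) :: Bs'], ?_, ?_⟩
    · intro R hR
      simp only [List.mem_cons, List.not_mem_nil, or_false] at hR
      rcases hR with rfl | rfl
      · exact ⟨k2, fun l ⟨E, hE, hl⟩ => occ' E hE l hl⟩
      · refine ⟨List.pairwise_cons.mpr
          ⟨fun E hE => Finset.disjoint_of_subset_left eB (k1 E hE), k2⟩, ?_⟩
        rintro l ⟨E, hE, hl⟩
        rcases List.mem_cons.mp hE with rfl | hE
        · exact ⟨⟨B, hB, eB hl⟩, hBno l hl⟩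
        · exact occ' E hE l hl
    · intro O
      have := sum_single B O e s hs hBs (hemp B hB _)
      rw [prodL_perm hp, prodL_perm hp]
      simp only [prodL_cons, prodL_update _ _ _ _ hno, List.map_cons, List.map_nil, List.sum_cons,
        List.sum_nil]
      rw [← add_mul, this]; ring

theorem eliminate_many {m : ℕ} (Bs : List (Finset (Fin m × Bool))) (hd : Bs.Pairwise Disjoint)
    (E : Finset (Fin m)) : ∃ Rs : List (List (Finset (Fin m × Bool))),
      (∀ R ∈ Rs, R.Pairwise Disjoint ∧ ∀ l, Occ R l → Occ Bs l ∧ l.1 ∉ E) ∧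
      ∀ O : Fin m → Bool,
        ∑ U ∈ E.powerset, prodL Bs (fun j => if j ∈ E then decide (j ∈ U) else O j)
        = (Rs.map (fun R => prodL R O)).sum := by
  induction E using Finset.induction_on with
  | empty => exact ⟨[Bs], by simpa using hd, by simp⟩
  | insert e E he ih =>
    obtain ⟨Rs, h1, h2⟩ := ih
    have step : ∀ Rs : List (List (Finset (Fin m × Bool))),
      (∀ R ∈ Rs, R.Pairwise Disjoint ∧ ∀ l, Occ R l → Occ Bs l ∧ l.1 ∉ E) →
      ∃ Rs' : List (List (Finset (Fin m × Bool))),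
      (∀ R ∈ Rs', R.Pairwise Disjoint ∧ ∀ l, Occ R l → Occ Bs l ∧ l.1 ∉ insert e E) ∧
      ∀ O : Fin m → Bool, (Rs.map (fun R => prodL R (Function.update O e true))).sum
        + (Rs.map (fun R => prodL R (Function.update O e false))).sum
        = (Rs'.map (fun R => prodL R O)).sum := by
      intro Rs
      induction Rs with
      | nil => intro _; exact ⟨[], by simp, by simp⟩
      | cons R Rs ih =>
        intro h
        obtain ⟨Rs1, a1, a2⟩ := ih (fun R hR => h R (by simp [hR]))
        obtain ⟨hR1, hR2⟩ := h R (by simp)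
        obtain ⟨Rs2, b1, b2⟩ := eliminate R hR1 e
        refine ⟨Rs2 ++ Rs1, ?_, ?_⟩
        · intro Q hQ
          rcases List.mem_append.mp hQ with hQ | hQ
          · refine ⟨(b1 Q hQ).1, fun l hl => ?_⟩
            obtain ⟨c1, c2⟩ := (b1 Q hQ).2 l hl
            obtain ⟨c3, c4⟩ := hR2 l c1
            exact ⟨c3, by simp [c2, c4]⟩
          · exact a1 Q hQ
        · intro O
          rw [List.map_append, List.sum_append, ← a2 O, ← b2 O]
          simp only [List.map_cons, List.sum_cons]; ring
    obtain ⟨Rs', h3, h4⟩ := step Rs h1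
    refine ⟨Rs', h3, fun O => ?_⟩
    rw [← h4, ← h2, ← h2, Finset.sum_powerset_insert he, add_comm]
    congr 1
    · refine Finset.sum_congr rfl fun U hU => ?_
      congr 1
      funext j
      by_cases hj : j = e
      · subst hj; simp [he]
      · simp [hj]
    · refine Finset.sum_congr rfl fun U hU => ?_
      rw [Finset.mem_powerset] at hU
      congr 1
      funext j
      by_cases hj : j = e
      · subst hj; simp [he]; exact fun h => he (hU h)
      · simp [hj]

end elim

section final

theorem prodL_eq {m : ℕ} (Bs : List (Finset (Fin m × Bool))) (O : Fin m → Bool) :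
    prodL Bs O = if (∀ B ∈ Bs, (∃ l ∈ B, O l.1 = l.2) ∧ (∃ l ∈ B, O l.1 ≠ l.2)) then 1 else 0 := by
  induction Bs with
  | nil => simp [prodL]
  | cons B Bs ih =>
    rw [prodL_cons, ih]
    unfold naeL
    by_cases h1 : (∃ l ∈ B, O l.1 = l.2) ∧ (∃ l ∈ B, O l.1 ≠ l.2)
    · rw [if_pos h1, one_mul]
      congr 1
      rw [List.forall_mem_cons]
      simp only [h1, true_and]
    · rw [if_neg h1, zero_mul, if_neg]
      intro h
      exact h1 (h B (by simp))

theorem SC_prodL {m : ℕ} (A : Finset (Fin m)) (R : List (Finset (Fin m × Bool)))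
    (hd : R.Pairwise Disjoint) (h : ∀ l, Occ R l → l.2 = true ∧ l.1 ∈ A) :
    SC_s6 A.card (gen A (fun S => prodL R (fun j => decide (j ∈ S)))) := by
  have := SC_gen (R.map (fun B => B.image Prod.fst)) A ?_ ?_
  · convert this using 2
    funext S
    rw [List.map_map]
    unfold prodL
    congr 1
    refine List.map_congr_left fun B hB => ?_
    have hpos : ∀ l ∈ B, l.2 = true := fun l hl => (h l ⟨B, hB, hl⟩).1
    unfold naeL naeS
    have e1 : (∃ l ∈ B, decide (l.1 ∈ S) = l.2) ↔ (∃ x ∈ B.image Prod.fst, x ∈ S) := by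
      constructor
      · rintro ⟨l, hl, h1⟩
        rw [hpos l hl] at h1
        exact ⟨l.1, Finset.mem_image_of_mem _ hl, by simpa using h1⟩
      · rintro ⟨x, hx, h1⟩
        obtain ⟨l, hl, rfl⟩ := Finset.mem_image.mp hx
        exact ⟨l, hl, by rw [hpos l hl]; simpa using h1⟩
    have e2 : (∃ l ∈ B, decide (l.1 ∈ S) ≠ l.2) ↔ (∃ x ∈ B.image Prod.fst, x ∉ S) := by
      constructor
      · rintro ⟨l, hl, h1⟩
        rw [hpos l hl] at h1
        exact ⟨l.1, Finset.mem_image_of_mem _ hl, by simpa using h1⟩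
      · rintro ⟨x, hx, h1⟩
        obtain ⟨l, hl, rfl⟩ := Finset.mem_image.mp hx
        exact ⟨l, hl, by rw [hpos l hl]; simpa using h1⟩
    simp only [Function.comp, e1, e2]
  · rw [List.pairwise_map]
    refine hd.imp_of_mem ?_
    intro B D hB hD hBD
    rw [Finset.disjoint_left] at hBD ⊢
    intro x hx hx'
    obtain ⟨l, hl, rfl⟩ := Finset.mem_image.mp hx
    obtain ⟨l', hl', he⟩ := Finset.mem_image.mp hx'
    have : l' = l := Prod.ext he
      ((h l' ⟨D, hD, hl'⟩).1.trans (h l ⟨B, hB, hl⟩).1.symm)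
    subst this
    exact hBD hl hl'
  · intro B hB
    obtain ⟨D, hD, rfl⟩ := List.mem_map.mp hB
    intro x hx
    obtain ⟨l, hl, rfl⟩ := Finset.mem_image.mp hx
    exact (h l ⟨D, hD, hl⟩).2

theorem SC_list {m : ℕ} (A : Finset (Fin m)) (Rs : List (List (Finset (Fin m × Bool))))
    (h : ∀ R ∈ Rs, R.Pairwise Disjoint ∧ ∀ l, Occ R l → l.2 = true ∧ l.1 ∈ A) :
    SC_s6 A.card (gen A (fun S => (Rs.map (fun R => prodL R (fun j => decide (j ∈ S)))).sum)) := by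
  induction Rs with
  | nil =>
    have : gen A (fun S => (List.map (fun R => prodL R (fun j => decide (j ∈ S)))
      ([] : List (List (Finset (Fin m × Bool))))).sum) = 0 := by simp [gen]
    rw [this]; exact SC_s6.zero
  | cons R Rs ih =>
    have h1 := SC_prodL A R (h R (by simp)).1 (h R (by simp)).2
    have h2 := h1.sum (ih (fun R hR => h R (by simp [hR])))
    convert h2 using 1
    simp only [gen, ← Finset.sum_add_distrib, ← add_mul, ← map_add, List.map_cons, List.sum_cons]

/-- literals of a vertex -/
def Blk (n : ℕ) {m : ℕ} (ga gb : Fin m → ℕ) (i : ℕ) : Finset (Fin m × Bool) :=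
  Finset.univ.filter fun l => (l.2 = true ∧ (gb l.1 = i ∨ (ga l.1 = i ∧ gb l.1 = n))) ∨
    (l.2 = false ∧ ga l.1 = i ∧ gb l.1 ≠ n)

theorem Blk_in (n : ℕ) {m : ℕ} (ga gb : Fin m → ℕ) (i : ℕ) (hi : i < n) (q : Fin m → Bool) :
    (∃ l ∈ Blk n ga gb i, q l.1 = l.2) ↔
      1 ≤ (inAt ga gb (fun j => xor (q j) (decide (gb j = n))) i).card := by
  rw [Nat.one_le_iff_ne_zero, ← Nat.pos_iff_ne_zero, Finset.card_pos]
  constructor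
  · rintro ⟨⟨j, s⟩, hl, h⟩
    refine ⟨j, ?_⟩
    simp only [Blk, inAt, Finset.mem_filter, Finset.mem_univ, true_and] at hl h ⊢
    by_cases hb : gb j = n
    · cases s <;> simp_all <;> omega
    · cases s <;> simp_all
  · rintro ⟨j, hj⟩
    refine ⟨(j, q j), ?_, rfl⟩
    simp only [Blk, inAt, Finset.mem_filter, Finset.mem_univ, true_and] at hj ⊢
    by_cases hb : gb j = n
    · cases hq : q j <;> simp_all <;> omega
    · cases hq : q j <;> simp_all

theorem Blk_out (n : ℕ) {m : ℕ} (ga gb : Fin m → ℕ) (i : ℕ) (hi : i < n) (q : Fin m → Bool) :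
    (∃ l ∈ Blk n ga gb i, q l.1 ≠ l.2) ↔
      1 ≤ (outAt ga gb (fun j => xor (q j) (decide (gb j = n))) i).card := by
  rw [Nat.one_le_iff_ne_zero, ← Nat.pos_iff_ne_zero, Finset.card_pos]
  constructor
  · rintro ⟨⟨j, s⟩, hl, h⟩
    refine ⟨j, ?_⟩
    simp only [Blk, outAt, Finset.mem_filter, Finset.mem_univ, true_and] at hl h ⊢
    by_cases hb : gb j = n
    · cases s <;> simp_all <;> omega
    · cases s <;> simp_all
  · rintro ⟨j, hj⟩
    refine ⟨(j, !(q j)), ?_, by simp⟩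
    simp only [Blk, outAt, Finset.mem_filter, Finset.mem_univ, true_and] at hj ⊢
    by_cases hb : gb j = n
    · cases hq : q j <;> simp_all <;> omega
    · cases hq : q j <;> simp_all

noncomputable def Blks (n : ℕ) {m : ℕ} (ga gb : Fin m → ℕ) (d : ℕ) :
    List (Finset (Fin m × Bool)) :=
  ((List.range (d + 1)).filter (fun i => decide (1 ≤ i ∧ ∀ j, ¬ (ga j = i ∧ gb j = i)))).map
    (Blk n ga gb)

theorem mem_Blks (n : ℕ) {m : ℕ} (ga gb : Fin m → ℕ) (d : ℕ) (B : Finset (Fin m × Bool)) :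
    B ∈ Blks n ga gb d ↔
      ∃ i, i ≤ d ∧ 1 ≤ i ∧ (∀ j, ¬ (ga j = i ∧ gb j = i)) ∧ B = Blk n ga gb i := by
  unfold Blks
  simp only [List.mem_map, List.mem_filter, List.mem_range, decide_eq_true_eq]
  constructor
  · rintro ⟨i, ⟨h1, h2, h3⟩, rfl⟩
    exact ⟨i, by omega, h2, h3, rfl⟩
  · rintro ⟨i, h1, h2, h3, rfl⟩
    exact ⟨i, ⟨by omega, h2, h3⟩, rfl⟩

theorem Blks_disj (n : ℕ) {m : ℕ} (ga gb : Fin m → ℕ) (d : ℕ) (hd : d < n) :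
    (Blks n ga gb d).Pairwise Disjoint := by
  unfold Blks
  rw [List.pairwise_map]
  refine List.Pairwise.imp_of_mem ?_ (List.nodup_range.filter _)
  intro i i' hi hi' hne
  simp only [List.mem_filter, List.mem_range, decide_eq_true_eq] at hi hi'
  rw [Finset.disjoint_left]
  rintro ⟨j, s⟩ h1 h2
  simp only [Blk, Finset.mem_filter, Finset.mem_univ, true_and] at h1 h2
  cases s <;> simp at h1 h2 <;> omega

theorem adm_iff (n : ℕ) {m : ℕ} (ga gb : Fin m → ℕ) (d : ℕ) (hd : d < n) (q : Fin m → Bool) :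
    (∀ B ∈ Blks n ga gb d, (∃ l ∈ B, q l.1 = l.2) ∧ (∃ l ∈ B, q l.1 ≠ l.2)) ↔
    (∀ i : ℕ, 1 ≤ i → i ≤ d →
      1 ≤ (outAt ga gb (fun j => xor (q j) (decide (gb j = n))) i).card ∧
      1 ≤ (inAt ga gb (fun j => xor (q j) (decide (gb j = n))) i).card) := by
  constructor
  · intro h i h1 h2
    by_cases hl : ∀ j, ¬ (ga j = i ∧ gb j = i)
    · have := h _ ((mem_Blks n ga gb d _).mpr ⟨i, h2, h1, hl, rfl⟩)
      rw [Blk_in n ga gb i (by omega), Blk_out n ga gb i (by omega)] at this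
      exact this.symm
    · push Not at hl
      obtain ⟨j, hj1, hj2⟩ := hl
      generalize (fun j => xor (q j) (decide (gb j = n))) = O
      constructor
      · refine Finset.card_pos.mpr ⟨j, ?_⟩
        simp [outAt, hj1, hj2]
      · refine Finset.card_pos.mpr ⟨j, ?_⟩
        simp [inAt, hj1, hj2]
  · intro h B hB
    obtain ⟨i, h1, h2, h3, rfl⟩ := (mem_Blks n ga gb d B).mp hB
    rw [Blk_in n ga gb i (by omega), Blk_out n ga gb i (by omega)]
    exact (h i h2 h1).symm

theorem M_eq (n : ℕ) {m : ℕ} (ga gb : Fin m → ℕ) (d : ℕ) (hd : d < n)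
    (hl : ∀ j, ¬ (ga j = n ∧ gb j = n)) (S : Finset (Fin m)) (hS : S ⊆ edgesAt ga gb n)
    (E : Finset (Fin m)) (hE : ∀ j, j ∈ E ↔ (ga j ≠ n ∧ gb j ≠ n ∧ ga j ≠ gb j)) :
    MoccW n ga gb d S = ∑ U ∈ E.powerset, prodL (Blks n ga gb d)
      (fun j => if j ∈ E then decide (j ∈ U) else decide (j ∈ S)) := by
  simp only [prodL_eq]
  rw [Finset.sum_boole, Nat.cast_id]
  unfold MoccW
  have hSX : ∀ j, j ∈ S → ga j = n ∨ gb j = n := by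
    intro j hj
    simpa [edgesAt] using hS hj
  have inv : ∀ O : Fin m → Bool, (∀ j, ga j = gb j → O j = false) → outAt ga gb O n = S →
      (fun j => xor (if j ∈ E then decide (j ∈ E.filter (fun j => O j = true)) else decide (j ∈ S))
        (decide (gb j = n))) = O := by
    intro O h1 h2
    funext j
    by_cases hj : j ∈ E
    · have := (hE j).mp hj
      simp [hj, this.2.1]
    · have hj' := mt (hE j).mpr hj
      have hjS : j ∈ S ↔ (O j = true ∧ ga j = n) ∨ (O j = false ∧ gb j = n) := by
        rw [← h2]; simp [outAt]
      have := hl j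
      have h1j := h1 j
      simp only [if_neg hj]
      by_cases hb : gb j = n
      · have ha : ga j ≠ n := fun h => this ⟨h, hb⟩
        cases hO : O j <;> simp_all
      · by_cases ha : ga j = n
        · cases hO : O j <;> simp_all
        · have : ga j = gb j := by by_contra hc; exact hj' ⟨ha, hb, hc⟩
          simp_all
  refine Finset.card_bij' (fun O _ => E.filter (fun j => O j = true))
    (fun U _ => fun j => xor (if j ∈ E then decide (j ∈ U) else decide (j ∈ S))
      (decide (gb j = n))) ?_ ?_ ?_ ?_
  · intro O hO
    simp only [Finset.mem_filter, Finset.mem_univ, true_and] at hO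
    obtain ⟨h1, h2, h3, h4⟩ := hO
    rw [Finset.mem_filter]
    refine ⟨Finset.mem_powerset.mpr (Finset.filter_subset _ _), ?_⟩
    refine (adm_iff n ga gb d hd (fun j => if j ∈ E then decide (j ∈ E.filter (fun j => O j = true)) else decide (j ∈ S))).mpr ?_
    rw [inv O h1 h3]
    exact h2
  · intro U hU
    simp only [Finset.mem_filter, Finset.mem_univ, true_and, Finset.mem_powerset] at hU ⊢
    refine ⟨?_, (adm_iff n ga gb d hd (fun j => if j ∈ E then decide (j ∈ U) else decide (j ∈ S))).mp hU.2, ?_, ?_⟩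
    · intro j hj
      have hjE : j ∉ E := fun h => ((hE j).mp h).2.2 hj
      have hb : gb j ≠ n := fun h => hl j ⟨hj.trans h, h⟩
      have hjS : j ∉ S := fun h => (hSX j h).elim (fun h => hb (hj ▸ h)) hb
      simp [hjE, hb, hjS]
    · ext j
      simp only [outAt, Finset.mem_filter, Finset.mem_univ, true_and]
      have := hl j
      have h2 := hSX j
      have h3 := hE j
      by_cases hb : gb j = n <;> by_cases ha : ga j = n <;> by_cases hjS : j ∈ S <;> simp_all
    · ext j
      simp only [inAt, edgesAt, Finset.mem_sdiff, Finset.mem_filter, Finset.mem_univ, true_and]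
      have := hl j
      have h2 := hSX j
      have h3 := hE j
      by_cases hb : gb j = n <;> by_cases ha : ga j = n <;> by_cases hjS : j ∈ S <;> simp_all
  · intro O hO
    simp only [Finset.mem_filter, Finset.mem_univ, true_and] at hO
    exact inv O hO.1 hO.2.2.1
  · intro U hU
    simp only [Finset.mem_filter, Finset.mem_powerset] at hU
    ext j
    rw [Finset.mem_filter]
    by_cases hj : j ∈ E
    · have := (hE j).mp hj
      simp [hj, this.2.1]
    · simp only [hj, false_and, false_iff]
      exact fun h => hj (hU.1 h)

theorem gen_congr {m : ℕ} (A : Finset (Fin m)) (f g : Finset (Fin m) → ℕ)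
    (h : ∀ S ⊆ A, f S = g S) : gen A f = gen A g := by
  unfold gen
  exact Finset.sum_congr rfl fun S hS => by rw [h S (Finset.mem_powerset.mp hS)]

end final

/-- (Lemma 3.1) `H_X` with the weight `M_{G,d}^occ` satisfies (NMP-B). -/
theorem lem_3_1 (n : ℕ) (hn : 1 ≤ n) (m : ℕ) (ga gb : Fin m → ℕ)
    (hga : ∀ j, 1 ≤ ga j ∧ ga j ≤ n) (hgb : ∀ j, 1 ≤ gb j ∧ gb j ≤ n)
    (d : ℕ) (hd : d ≤ n - 1)
    (k : ℕ) (hX : (edgesAt ga gb n).card = 2 * k + 1) :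
    NMPB (edgesAt ga gb n) k (fun S => (MoccW n ga gb d S : ℝ)) := by
  by_cases hl : ∀ j, ¬ (ga j = n ∧ gb j = n)
  swap
  · push Not at hl
    obtain ⟨j, hj1, hj2⟩ := hl
    have h0 : ∀ S, MoccW n ga gb d S = 0 := by
      intro S
      unfold MoccW
      rw [Finset.card_eq_zero, Finset.filter_eq_empty_iff]
      rintro O - ⟨-, -, h3, h4⟩
      have a1 : j ∈ S := by rw [← h3]; simp [outAt, hj1, hj2]
      have a2 : j ∈ edgesAt ga gb n \ S := by rw [← h4]; simp [inAt, hj1, hj2]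
      exact (Finset.mem_sdiff.mp a2).2 a1
    exact ⟨fun _ _ => 0, by simp, by simp [h0], by simp [h0]⟩
  have hdn : d < n := by omega
  apply NMPB_of_SC
  obtain ⟨Rs, h1, h2⟩ := eliminate_many (Blks n ga gb d) (Blks_disj n ga gb d hdn)
    (Finset.univ.filter fun j => ga j ≠ n ∧ gb j ≠ n ∧ ga j ≠ gb j)
  rw [gen_congr _ _ (fun S => (Rs.map (fun R => prodL R (fun j => decide (j ∈ S)))).sum), ← hX]
  · apply SC_list
    intro R hR
    refine ⟨(h1 R hR).1, fun l hlR => ?_⟩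
    obtain ⟨⟨B, hB, hlB⟩, hlE⟩ := (h1 R hR).2 l hlR
    obtain ⟨i, i1, i2, i3, rfl⟩ := (mem_Blks n ga gb d B).mp hB
    have hi3 := i3 l.1
    have hll := hl l.1
    simp only [Blk, edgesAt, Finset.mem_filter, Finset.mem_univ, true_and] at hlB hlE ⊢
    rcases l with ⟨j, s⟩
    simp only at *
    have hjX : ga j = n ∨ gb j = n := by
      by_contra hc
      push Not at hc
      apply hlE
      refine ⟨hc.1, hc.2, fun he => ?_⟩
      rcases hlB with h | h
      · omega
      · omega
    refine ⟨?_, hjX⟩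
    cases s
    · simp at hlB; omega
    · rfl
  · intro S hS
    rw [M_eq n ga gb d hdn hl S hS
      (Finset.univ.filter fun j => ga j ≠ n ∧ gb j ≠ n ∧ ga j ≠ gb j) (by intro j; simp), ← h2]
end

section
/- (Lemma 3.2, loop-edge recurrences) Suppose the last edge e_m of G is a loop, say at the vertex v_t, and let d ∈ {0,1,…,n−1} and S ⊆ X. Then: (1) if t = d (so d ≥ 1), M_{G,d}^occ(S) = M_{G−e_m, d−1}^occ(S); (2) if t = d+1 and d+1 < n, M_{G,d}^occ(S) = M_{G−e_m, d}^occ(S); (3) if t = n, M_{G,d}^occ(S) = 0. (In cases (1) and (2) the loop is not incident to v_n, so the set X is the same for G and G − e_m.) -/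
open Finset
open scoped Classical

/-- Relabel a set of edge indices of `G` as edge indices of `G − e_m`
(only meaningful when no element is the last index). -/
noncomputable def castdown {m : ℕ} (S : Finset (Fin (m+1))) : Finset (Fin m) :=
  S.preimage Fin.castSucc (Fin.castSucc_injective m).injOn

theorem aux_mem {m : ℕ} (n : ℕ) (ga gb : Fin (m+1) → ℕ) (d d' t : ℕ)
    (hl1 : ga (Fin.last m) = t) (hl2 : gb (Fin.last m) = t) (htn : t ≠ n)
    (S : Finset (Fin (m+1))) (hS : S ⊆ edgesAt ga gb n)
    (h1 : ∀ i, i ≠ t → (i ≤ d ↔ i ≤ d')) (h2 : ¬ t ≤ d') (O : Fin (m+1) → Bool) :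
    ((∀ j, ga j = gb j → O j = false) ∧
    (∀ i : ℕ, 1 ≤ i → i ≤ d → 1 ≤ (outAt ga gb O i).card ∧ 1 ≤ (inAt ga gb O i).card) ∧
    outAt ga gb O n = S ∧ inAt ga gb O n = edgesAt ga gb n \ S) ↔
    O (Fin.last m) = false ∧
    ((∀ j : Fin m, ga j.castSucc = gb j.castSucc → O j.castSucc = false) ∧
    (∀ i : ℕ, 1 ≤ i → i ≤ d' →
      1 ≤ (outAt (fun j : Fin m => ga j.castSucc) (fun j : Fin m => gb j.castSucc)
        (fun j => O j.castSucc) i).card ∧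
      1 ≤ (inAt (fun j : Fin m => ga j.castSucc) (fun j : Fin m => gb j.castSucc)
        (fun j => O j.castSucc) i).card) ∧
    outAt (fun j : Fin m => ga j.castSucc) (fun j : Fin m => gb j.castSucc)
      (fun j => O j.castSucc) n = castdown S ∧
    inAt (fun j : Fin m => ga j.castSucc) (fun j : Fin m => gb j.castSucc)
      (fun j => O j.castSucc) n =
      edgesAt (fun j : Fin m => ga j.castSucc) (fun j : Fin m => gb j.castSucc) n
        \ castdown S) := by
  have hSl : Fin.last m ∉ S := by
    intro h
    have := hS h
    simp [edgesAt, hl1, hl2, htn] at this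
  simp only [Nat.succ_le_iff, Finset.card_pos, Finset.Nonempty, Finset.ext_iff, outAt, inAt,
    edgesAt, castdown, Finset.mem_filter, Finset.mem_univ, true_and, Finset.mem_sdiff,
    Finset.mem_preimage, Fin.forall_fin_succ', Fin.exists_fin_succ', hl1, hl2, htn, hSl]
  simp only [and_false, or_false, false_and, iff_true, and_true, forall_const, not_false_eq_true,
    or_self]
  constructor
  · rintro ⟨⟨a, b⟩, c, e, f⟩
    refine ⟨b, a, ?_, e, f⟩
    intro i hi hid
    have hit : i ≠ t := by rintro rfl; exact h2 hid
    have := c i hi ((h1 i hit).2 hid)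
    simpa [hit.symm] using this
  · rintro ⟨b, a, c, e, f⟩
    refine ⟨⟨a, b⟩, ?_, e, f⟩
    intro i hi hid
    by_cases hit : i = t
    · simp [hit, b]
    · have := c i hi ((h1 i hit).1 hid)
      exact ⟨Or.inl this.1, Or.inl this.2⟩

theorem aux_card {m : ℕ} (n : ℕ) (ga gb : Fin (m+1) → ℕ) (d d' t : ℕ)
    (hl1 : ga (Fin.last m) = t) (hl2 : gb (Fin.last m) = t) (htn : t ≠ n)
    (S : Finset (Fin (m+1))) (hS : S ⊆ edgesAt ga gb n)
    (h1 : ∀ i, i ≠ t → (i ≤ d ↔ i ≤ d')) (h2 : ¬ t ≤ d') :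
    MoccW n ga gb d S =
      MoccW n (fun j : Fin m => ga j.castSucc) (fun j : Fin m => gb j.castSucc)
        d' (castdown S) := by
  have key := aux_mem n ga gb d d' t hl1 hl2 htn S hS h1 h2
  unfold MoccW
  refine Finset.card_bij' (fun O _ => fun j => O j.castSucc)
    (fun O _ => Fin.snoc (α := fun _ => Bool) O false) ?_ ?_ ?_ ?_
  · intro O hO
    rw [Finset.mem_filter] at hO ⊢
    exact ⟨Finset.mem_univ _, ((key O).1 hO.2).2⟩
  · intro O hO
    rw [Finset.mem_filter] at hO ⊢
    refine ⟨Finset.mem_univ _, (key _).2 ⟨Fin.snoc_last _ _, ?_⟩⟩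
    simp only [Fin.snoc_castSucc]
    exact hO.2
  · intro O hO
    rw [Finset.mem_filter] at hO
    have := ((key O).1 hO.2).1
    funext j
    refine Fin.lastCases ?_ (fun j => ?_) j
    · simp [this]
    · simp
  · intro O hO
    funext j
    simp

/-- (Lemma 3.2, loop-edge recurrences) The last edge `e_m` of `G` is a loop at
the vertex `v_t`.  (1) if `t = d`, then `M_{G,d}^occ(S) = M_{G−e_m,d−1}^occ(S)`;
(2) if `t = d+1 < n`, then `M_{G,d}^occ(S) = M_{G−e_m,d}^occ(S)`;
(3) if `t = n`, then `M_{G,d}^occ(S) = 0`. -/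
theorem lem_3_2 (n : ℕ) (hn : 1 ≤ n) (m : ℕ) (ga gb : Fin (m+1) → ℕ)
    (hga : ∀ j, 1 ≤ ga j ∧ ga j ≤ n) (hgb : ∀ j, 1 ≤ gb j ∧ gb j ≤ n)
    (d : ℕ) (hd : d ≤ n - 1) (t : ℕ)
    (hl1 : ga (Fin.last m) = t) (hl2 : gb (Fin.last m) = t)
    (S : Finset (Fin (m+1))) (hS : S ⊆ edgesAt ga gb n) :
    (t = d → MoccW n ga gb d S =
      MoccW n (fun j : Fin m => ga j.castSucc) (fun j : Fin m => gb j.castSucc)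
        (d - 1) (castdown S)) ∧
    (t = d + 1 → d + 1 < n → MoccW n ga gb d S =
      MoccW n (fun j : Fin m => ga j.castSucc) (fun j : Fin m => gb j.castSucc)
        d (castdown S)) ∧
    (t = n → MoccW n ga gb d S = 0) := by
  refine ⟨?_, ?_, ?_⟩
  · intro h
    have := (hga (Fin.last m)).1
    exact aux_card n ga gb d (d-1) t hl1 hl2 (by omega) S hS (by intros; omega) (by omega)
  · intro h h'
    exact aux_card n ga gb d d t hl1 hl2 (by omega) S hS (by intros; omega) (by omega)
  · intro h
    unfold MoccW
    rw [Finset.card_eq_zero, Finset.filter_eq_empty_iff]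
    rintro O - ⟨hO, -, h3, h4⟩
    have hf := hO (Fin.last m) (by omega)
    have a : Fin.last m ∈ outAt ga gb O n := by simp [outAt, hf, hl2, h]
    have b : Fin.last m ∈ inAt ga gb O n := by simp [inAt, hf, hl1, h]
    rw [h3] at a
    rw [h4, Finset.mem_sdiff] at b
    exact b.2 a
end

section
/- (Lemma 3.4, Type B recurrences) Suppose 1 ≤ d < n−1 and the last edge e_m of G joins v_d and v_{d+1}. Then for every S ⊆ X: if deg_G(v_d) ≥ 2, then M_{G,d}^occ(S) = M_{G−e_m, d}^occ(S) + M_{G−e_m, d−1}^occ(S); and if deg_G(v_d) = 1, then M_{G,d}^occ(S) = 0. -/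
open Finset
open scoped Classical

def OutP {m : ℕ} (ga gb : Fin m → ℕ) (O : Fin m → Bool) (v : ℕ) : Prop :=
  ∃ j, (O j = true ∧ ga j = v) ∨ (O j = false ∧ gb j = v)

def InP {m : ℕ} (ga gb : Fin m → ℕ) (O : Fin m → Bool) (v : ℕ) : Prop :=
  ∃ j, (O j = true ∧ gb j = v) ∨ (O j = false ∧ ga j = v)

def NP (n : ℕ) {m : ℕ} (ga gb : Fin m → ℕ) (S : Finset (Fin m)) (O : Fin m → Bool) : Prop :=
  (∀ j, ga j = gb j → O j = false) ∧
  (∀ j, ((O j = true ∧ ga j = n) ∨ (O j = false ∧ gb j = n)) ↔ j ∈ S) ∧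
  (∀ j, ((O j = true ∧ gb j = n) ∨ (O j = false ∧ ga j = n)) ↔ ((ga j = n ∨ gb j = n) ∧ j ∉ S))

theorem MoccW_eq (n : ℕ) {m : ℕ} (ga gb : Fin m → ℕ) (d : ℕ) (S : Finset (Fin m)) :
    MoccW n ga gb d S = ∑ O : Fin m → Bool,
      if NP n ga gb S O ∧ ∀ i : ℕ, 1 ≤ i → i ≤ d → OutP ga gb O i ∧ InP ga gb O i
      then 1 else 0 := by
  unfold MoccW
  rw [Finset.card_filter]
  refine Finset.sum_congr rfl fun O _ => ?_
  refine if_congr ?_ rfl rfl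
  simp only [NP, OutP, InP, Nat.one_le_iff_ne_zero, ← Nat.pos_iff_ne_zero, Finset.card_pos,
    Finset.ext_iff, outAt, inAt, edgesAt, Finset.Nonempty, Finset.mem_filter, Finset.mem_univ,
    true_and, Finset.mem_sdiff]
  tauto

theorem NP_snoc (n : ℕ) {m : ℕ} (ga gb : Fin (m+1) → ℕ) (S : Finset (Fin (m+1)))
    (h1 : ga (Fin.last m) ≠ n) (h2 : gb (Fin.last m) ≠ n)
    (h3 : ga (Fin.last m) ≠ gb (Fin.last m)) (hS : Fin.last m ∉ S)
    (O : Fin m → Bool) (b : Bool) :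
    NP n ga gb S (Fin.snoc (α := fun _ => Bool) O b) ↔
      NP n (fun j : Fin m => ga j.castSucc) (fun j : Fin m => gb j.castSucc) (castdown S) O := by
  simp [NP, Fin.forall_fin_succ', h1, h2, h3, hS, castdown]

theorem OutP_snoc {m : ℕ} (ga gb : Fin (m+1) → ℕ) (O : Fin m → Bool) (b : Bool) (v : ℕ) :
    OutP ga gb (Fin.snoc (α := fun _ => Bool) O b) v ↔
      OutP (fun j : Fin m => ga j.castSucc) (fun j : Fin m => gb j.castSucc) O v ∨
      ((b = true ∧ ga (Fin.last m) = v) ∨ (b = false ∧ gb (Fin.last m) = v)) := by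
  simp only [OutP, Fin.exists_fin_succ', Fin.snoc_castSucc, Fin.snoc_last]

theorem InP_snoc {m : ℕ} (ga gb : Fin (m+1) → ℕ) (O : Fin m → Bool) (b : Bool) (v : ℕ) :
    InP ga gb (Fin.snoc (α := fun _ => Bool) O b) v ↔
      InP (fun j : Fin m => ga j.castSucc) (fun j : Fin m => gb j.castSucc) O v ∨
      ((b = true ∧ gb (Fin.last m) = v) ∨ (b = false ∧ ga (Fin.last m) = v)) := by
  simp only [InP, Fin.exists_fin_succ', Fin.snoc_castSucc, Fin.snoc_last]

theorem forall_le_split (d : ℕ) (hd : 1 ≤ d) (P : ℕ → Prop) :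
    (∀ i, 1 ≤ i → i ≤ d → P i) ↔ (∀ i, 1 ≤ i → i ≤ d - 1 → P i) ∧ P d := by
  constructor
  · intro h
    exact ⟨fun i h1 h2 => h i h1 (by omega), h d hd le_rfl⟩
  · rintro ⟨h, h'⟩ i h1 h2
    by_cases hi : i = d
    · exact hi ▸ h'
    · exact h i h1 (by omega)

theorem degAt_succ {m : ℕ} (ga gb : Fin (m+1) → ℕ) (d : ℕ)
    (he : (ga (Fin.last m) = d ∧ gb (Fin.last m) = d + 1) ∨
          (ga (Fin.last m) = d + 1 ∧ gb (Fin.last m) = d)) :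
    degAt ga gb d =
      degAt (fun j : Fin m => ga j.castSucc) (fun j : Fin m => gb j.castSucc) d + 1 := by
  unfold degAt
  simp only [Finset.card_filter, Fin.sum_univ_castSucc]
  rcases he with ⟨h1, h2⟩ | ⟨h1, h2⟩ <;> simp [h1, h2] <;> omega

theorem degAt_zero {m : ℕ} (ga gb : Fin m → ℕ) (d : ℕ) (O : Fin m → Bool) :
    degAt ga gb d = 0 ↔ ¬ OutP ga gb O d ∧ ¬ InP ga gb O d := by
  simp only [degAt, Nat.add_eq_zero_iff, Finset.card_eq_zero, Finset.filter_eq_empty_iff,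
    Finset.mem_univ, true_implies, OutP, InP, not_exists, ← forall_and]
  refine forall_congr' fun j => ?_
  cases O j <;> simp <;> tauto

theorem ite_aux_s9 (L1 L2 A B P Q : Prop) [Decidable L1] [Decidable L2] [Decidable A] [Decidable B]
    (h : ¬ (¬ P ∧ ¬ Q))
    (hL : ((L1 ↔ A ∧ P) ∧ (L2 ↔ A ∧ Q)) ∨ ((L1 ↔ A ∧ Q) ∧ (L2 ↔ A ∧ P)))
    (hB : B ↔ A ∧ P ∧ Q) :
    (if L1 then 1 else 0) + (if L2 then 1 else 0) =
      (if B then 1 else 0) + (if A then 1 else 0) := by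
  rcases hL with ⟨e1, e2⟩ | ⟨e1, e2⟩ <;> by_cases hA : A <;> by_cases hP : P <;>
    by_cases hQ : Q <;> simp_all

theorem lem_3_4 (n : ℕ) (m : ℕ) (ga gb : Fin (m+1) → ℕ)
    (hga : ∀ j, 1 ≤ ga j ∧ ga j ≤ n) (hgb : ∀ j, 1 ≤ gb j ∧ gb j ≤ n)
    (d : ℕ) (hd1 : 1 ≤ d) (hd2 : d < n - 1)
    (he : (ga (Fin.last m) = d ∧ gb (Fin.last m) = d + 1) ∨
          (ga (Fin.last m) = d + 1 ∧ gb (Fin.last m) = d))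
    (S : Finset (Fin (m+1))) (hS : S ⊆ edgesAt ga gb n) :
    (2 ≤ degAt ga gb d →
      MoccW n ga gb d S =
        MoccW n (fun j : Fin m => ga j.castSucc) (fun j : Fin m => gb j.castSucc)
          d (castdown S) +
        MoccW n (fun j : Fin m => ga j.castSucc) (fun j : Fin m => gb j.castSucc)
          (d - 1) (castdown S)) ∧
    (degAt ga gb d = 1 → MoccW n ga gb d S = 0) := by
  have h1 : ga (Fin.last m) ≠ n := by omega
  have h2 : gb (Fin.last m) ≠ n := by omega
  have h3 : ga (Fin.last m) ≠ gb (Fin.last m) := by omega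
  have hl : Fin.last m ∉ S := fun h => by
    have := hS h
    simp [edgesAt, h1, h2] at this
  have key : ∀ (O : Fin m → Bool) (b : Bool),
      (NP n ga gb S (Fin.snoc (α := fun _ => Bool) O b) ∧ ∀ i : ℕ, 1 ≤ i → i ≤ d →
        OutP ga gb (Fin.snoc (α := fun _ => Bool) O b) i ∧
        InP ga gb (Fin.snoc (α := fun _ => Bool) O b) i) ↔
      ((NP n (fun j : Fin m => ga j.castSucc) (fun j : Fin m => gb j.castSucc) (castdown S) O ∧
        ∀ i : ℕ, 1 ≤ i → i ≤ d - 1 →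
        OutP (fun j : Fin m => ga j.castSucc) (fun j : Fin m => gb j.castSucc) O i ∧
        InP (fun j : Fin m => ga j.castSucc) (fun j : Fin m => gb j.castSucc) O i) ∧
       ((OutP (fun j : Fin m => ga j.castSucc) (fun j : Fin m => gb j.castSucc) O d ∨
        ((b = true ∧ ga (Fin.last m) = d) ∨ (b = false ∧ gb (Fin.last m) = d))) ∧
        (InP (fun j : Fin m => ga j.castSucc) (fun j : Fin m => gb j.castSucc) O d ∨
        ((b = true ∧ gb (Fin.last m) = d) ∨ (b = false ∧ ga (Fin.last m) = d))))) := by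
    intro O b
    rw [NP_snoc n ga gb S h1 h2 h3 hl, forall_le_split d hd1, OutP_snoc, InP_snoc, ← and_assoc]
    refine and_congr (and_congr Iff.rfl ?_) Iff.rfl
    refine forall_congr' fun i => forall_congr' fun hi1 => forall_congr' fun hi2 => ?_
    have e1 : ga (Fin.last m) ≠ i := by omega
    have e2 : gb (Fin.last m) ≠ i := by omega
    rw [OutP_snoc, InP_snoc]
    simp [e1, e2]
  have hsum : MoccW n ga gb d S = ∑ O : Fin m → Bool, ∑ b : Bool,
      if (NP n ga gb S (Fin.snoc (α := fun _ => Bool) O b) ∧ ∀ i : ℕ, 1 ≤ i → i ≤ d →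
        OutP ga gb (Fin.snoc (α := fun _ => Bool) O b) i ∧
        InP ga gb (Fin.snoc (α := fun _ => Bool) O b) i) then 1 else 0 := by
    rw [MoccW_eq, ← (Fin.snocEquiv (fun _ : Fin (m+1) => Bool)).sum_comp,
      Fintype.sum_prod_type, Finset.sum_comm]
    rfl
  rw [hsum, degAt_succ ga gb d he]
  simp only [key]
  constructor
  · intro hdeg
    rw [MoccW_eq, MoccW_eq, ← Finset.sum_add_distrib]
    refine Finset.sum_congr rfl fun O _ => ?_
    have hz := (degAt_zero (fun j : Fin m => ga j.castSucc) (fun j : Fin m => gb j.castSucc) d O)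
    have hz' := mt hz.2 (by omega)
    rw [Fintype.sum_bool]
    have hsplit := forall_le_split d hd1 (fun i =>
      OutP (fun j : Fin m => ga j.castSucc) (fun j : Fin m => gb j.castSucc) O i ∧
      InP (fun j : Fin m => ga j.castSucc) (fun j : Fin m => gb j.castSucc) O i)
    refine ite_aux_s9 _ _ _ _ _ _ hz' ?_ ((and_congr Iff.rfl hsplit).trans and_assoc.symm)
    rcases he with ⟨e1, e2⟩ | ⟨e1, e2⟩
    · right
      simp [e1, e2]
    · left
      simp [e1, e2]
  · intro hdeg
    refine Finset.sum_eq_zero fun O _ => Finset.sum_eq_zero fun b _ => if_neg ?_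
    have hz := (degAt_zero (fun j : Fin m => ga j.castSucc) (fun j : Fin m => gb j.castSucc) d O).1
      (by omega)
    rintro ⟨-, hP, hQ⟩
    have hP := hP.resolve_left hz.1
    have hQ := hQ.resolve_left hz.2
    cases b <;> simp at hP hQ <;> omega
end
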